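/- Let β>0 and let h be a real analytic and even Schwartz function which is positive semi-definite (i.e. its Fourier transform ĥ is nonnegative). Then for all real analytic, strongly convex and even functions Q with α_Q > sup_{t∈ℝ}(−h''(t)), the first correlation measure ρ_{N,Q,β}^{h,1}(t)dt of P_{N,Q,β}^h converges weakly, as N→∞, to a compactly supported probability measure μ_{Q,β}^h which has a non-zero continuous density on the interior of its support. -/

import Mathlib

open MeasureTheory Real Filter Finset Topology

noncomputable section

/-- Product over pairs `i < j` of `|x i - x j| ^ β` (the β-Vandermonde interaction). -/
def vdm (β : ℝ) {N : ℕ} (x : Fin N → ℝ) : ℝ :=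
  ∏ p ∈ Finset.univ.filter (fun p : Fin N × Fin N => p.1 < p.2), |x p.1 - x p.2| ^ β

/-- Sum over pairs `i < j` of `g (x i - x j)`. -/
def pairSum {N : ℕ} (g : ℝ → ℝ) (x : Fin N → ℝ) : ℝ :=
  ∑ p ∈ Finset.univ.filter (fun p : Fin N × Fin N => p.1 < p.2), g (x p.1 - x p.2)

/-- Unnormalized density of `P_{N,Q,β}^h`. -/
def weightH (β : ℝ) (Q g : ℝ → ℝ) (N : ℕ) (x : Fin N → ℝ) : ℝ :=
  vdm β x * Real.exp (-(N : ℝ) * ∑ j, Q (x j) - pairSum g x)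

/-- Normalization constant `Z_{N,Q,β}^h`. -/
def ZH (β : ℝ) (Q g : ℝ → ℝ) (N : ℕ) : ℝ := ∫ x : Fin N → ℝ, weightH β Q g N x

/-- The density `P_{N,Q,β}^h`. -/
def PH (β : ℝ) (Q g : ℝ → ℝ) (N : ℕ) (x : Fin N → ℝ) : ℝ := weightH β Q g N x / ZH β Q g N

/-- Unnormalized density of the β-ensemble `P_{N,V,β}`. -/
def weightV (β : ℝ) (V : ℝ → ℝ) (N : ℕ) (x : Fin N → ℝ) : ℝ :=
  vdm β x * Real.exp (-(N : ℝ) * ∑ j, V (x j))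

/-- Normalization constant `Z_{N,V,β}`. -/
def ZV (β : ℝ) (V : ℝ → ℝ) (N : ℕ) : ℝ := ∫ x : Fin N → ℝ, weightV β V N x

/-- The β-ensemble density `P_{N,V,β}`. -/
def PV (β : ℝ) (V : ℝ → ℝ) (N : ℕ) (x : Fin N → ℝ) : ℝ := weightV β V N x / ZV β V N

/-- Expectation w.r.t. `P_{N,Q,β}^h`. -/
def EH (β : ℝ) (Q g : ℝ → ℝ) (N : ℕ) (f : (Fin N → ℝ) → ℝ) : ℝ :=
  ∫ x : Fin N → ℝ, f x * PH β Q g N x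

/-- Expectation w.r.t. `P_{N,V,β}`. -/
def EV (β : ℝ) (V : ℝ → ℝ) (N : ℕ) (f : (Fin N → ℝ) → ℝ) : ℝ :=
  ∫ x : Fin N → ℝ, f x * PV β V N x

/-- `k`-th correlation function of a density `P` on `ℝ^N`. -/
def correlationFn (N k : ℕ) (P : (Fin N → ℝ) → ℝ) (t : Fin k → ℝ) : ℝ :=
  ∫ y : Fin (N - k) → ℝ,
    P (fun i => if hik : (i : ℕ) < k then t ⟨(i : ℕ), hik⟩
        else y ⟨(i : ℕ) - k, by have := i.isLt; omega⟩)

/-- `f_μ(s) = ∫ f(t-s) dμ(t)`. -/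
def fMu (g : ℝ → ℝ) (μ : Measure ℝ) (s : ℝ) : ℝ := ∫ t, g (t - s) ∂μ

/-- `f_{μμ} = ∬ f(t-s) dμ(t) dμ(s)`. -/
def fMuMu (g : ℝ → ℝ) (μ : Measure ℝ) : ℝ := ∫ s, fMu g μ s ∂μ

/-- The Hoeffding-remainder `U(x)`. -/
def UU (g : ℝ → ℝ) (μ : Measure ℝ) (N : ℕ) (x : Fin N → ℝ) : ℝ :=
  -(1/2) * ∑ i, ∑ j, (g (x i - x j) - fMu g μ (x i) - fMu g μ (x j) + fMuMu g μ)

/-- The weighted logarithmic energy functional `I_{V,β}`. -/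
def logEnergy (β : ℝ) (V : ℝ → ℝ) (μ : Measure ℝ) : ℝ :=
  ∫ t, V t ∂μ + β / 2 * ∫ s, ∫ t, Real.log |s - t|⁻¹ ∂μ ∂μ

/-- `μ` is the equilibrium measure to the external field `V` and `β`. -/
def IsEquilibriumMeasure (β : ℝ) (V : ℝ → ℝ) (μ : Measure ℝ) : Prop :=
  IsProbabilityMeasure μ ∧
    ∀ ν : Measure ℝ, IsProbabilityMeasure ν → logEnergy β V μ ≤ logEnergy β V ν

/-- `α_Q = inf_t Q''(t)`. -/
def alphaQ (Q : ℝ → ℝ) : ℝ := ⨅ t : ℝ, iteratedDeriv 2 Q t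

/-- `g` is (the restriction of) a Schwartz function. -/
def IsSchwartz (g : ℝ → ℝ) : Prop := ∃ H : SchwartzMap ℝ ℝ, ∀ t, H t = g t

/-- `g` is an even function. -/
def IsEvenFun (g : ℝ → ℝ) : Prop := ∀ t, g (-t) = g t

/-- Partial derivative in coordinate `j`. -/
def partialDeriv {N : ℕ} (f : (Fin N → ℝ) → ℝ) (j : Fin N) (x : Fin N → ℝ) : ℝ :=
  deriv (fun s => f (Function.update x j s)) (x j)

/-- Dirichlet form `D_ω(f) = (2N)⁻¹ ∑_j ∫ (∂_j f)² dω`. -/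
def dirichletForm {N : ℕ} (ω : Measure (Fin N → ℝ)) (f : (Fin N → ℝ) → ℝ) : ℝ :=
  (1 / (2 * (N : ℝ))) * ∑ j : Fin N, ∫ x, (partialDeriv f j x) ^ 2 ∂ω

/-- Relative entropy `S_ω(q) = ∫ q log q dω`. -/
def entropy {N : ℕ} (ω : Measure (Fin N → ℝ)) (q : (Fin N → ℝ) → ℝ) : ℝ :=
  ∫ x, q x * Real.log (q x) ∂ω

/-- The measure with density `P_{N,V,β}`. -/
def measV (β : ℝ) (V : ℝ → ℝ) (N : ℕ) : Measure (Fin N → ℝ) :=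
  volume.withDensity (fun x => ENNReal.ofReal (PV β V N x))

/-- `Z_{N,V,β,U}`. -/
def ZVU (β : ℝ) (V g : ℝ → ℝ) (μ : Measure ℝ) (N : ℕ) : ℝ :=
  ∫ x : Fin N → ℝ, vdm β x * Real.exp (-(N : ℝ) * ∑ j, V (x j) + UU g μ N x)

/-- probability of a set under `P_{N,V,β}`. -/
def ProbV (β : ℝ) (V : ℝ → ℝ) (N : ℕ) (A : Set (Fin N → ℝ)) : ℝ := ∫ x in A, PV β V N x

/-- probability of a set under `P_{N,Q,β}^h`. -/
def ProbH (β : ℝ) (Q g : ℝ → ℝ) (N : ℕ) (A : Set (Fin N → ℝ)) : ℝ := ∫ x in A, PH β Q g N x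


/-- The Fourier transform `ĥ(t) = (2π)^{-1/2} ∫ e^{-its} h(s) ds`. -/
def hhatC (h : ℝ → ℝ) (t : ℝ) : ℂ :=
  (1 / Real.sqrt (2 * Real.pi) : ℝ) *
    ∫ s : ℝ, Complex.exp (-Complex.I * (t : ℂ) * (s : ℂ)) * (h s : ℂ)

lemma re_charFun_mul (μ ν : Measure ℝ) [IsProbabilityMeasure μ] [IsProbabilityMeasure ν] (ω : ℝ) :
    ∫ p : ℝ × ℝ, cos (ω * (p.1 - p.2)) ∂(μ.prod ν)
      = (charFun μ ω * (starRingEnd ℂ) (charFun ν ω)).re := by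
  rw [← charFun_neg, charFun_apply_real, charFun_apply_real, ← integral_prod_mul]
  have hintg : Integrable (fun z : ℝ × ℝ => Complex.exp (ω * z.1 * Complex.I) *
      Complex.exp ((-ω : ℝ) * z.2 * Complex.I)) (μ.prod ν) := by
    apply Integrable.of_bound (C := 1) (by fun_prop)
    refine Eventually.of_forall fun z => ?_
    rw [← Complex.exp_add]
    have : (ω * z.1 * Complex.I + (-ω : ℝ) * z.2 * Complex.I : ℂ)
      = ((ω * (z.1 - z.2) : ℝ) : ℂ) * Complex.I := by push_cast; ring
    rw [this, Complex.norm_exp_ofReal_mul_I]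
  have := integral_re hintg
  simp only [RCLike.re_eq_complex_re] at this
  rw [← this]
  refine integral_congr_ae (Eventually.of_forall fun z => ?_)
  simp only
  rw [← Complex.exp_add]
  have h2 : (ω * z.1 * Complex.I + (-ω : ℝ) * z.2 * Complex.I : ℂ)
      = ((ω * (z.1 - z.2) : ℝ) : ℂ) * Complex.I := by push_cast; ring
  rw [h2, Complex.exp_ofReal_mul_I_re]

lemma pair_fourier (l : Measure ℝ) [SFinite l] (w b : ℝ → ℝ) (c : ℝ) (hw : Measurable w)
    (hb : Integrable b l)
    (hbd : ∀ᵐ ω ∂l, ∀ u : ℝ, |w ω * (cos (ω * u) - c)| ≤ b ω * (1 + |u|))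
    (μ ν : Measure ℝ) [IsProbabilityMeasure μ] [IsProbabilityMeasure ν]
    (hμ : Integrable (fun x : ℝ => x) μ) (hν : Integrable (fun x : ℝ => x) ν) :
    Integrable (fun ω => w ω * ((charFun μ ω * (starRingEnd ℂ) (charFun ν ω)).re - c)) l ∧
    Integrable (fun p : ℝ × ℝ => ∫ ω, w ω * (cos (ω * (p.1 - p.2)) - c) ∂l) (μ.prod ν) ∧
    ∫ p : ℝ × ℝ, (∫ ω, w ω * (cos (ω * (p.1 - p.2)) - c) ∂l) ∂(μ.prod ν)
      = ∫ ω, w ω * ((charFun μ ω * (starRingEnd ℂ) (charFun ν ω)).re - c) ∂l := by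
  set F : (ℝ × ℝ) → ℝ → ℝ := fun p ω => w ω * (cos (ω * (p.1 - p.2)) - c) with hF
  have hdom : Integrable (fun q : (ℝ × ℝ) × ℝ => (1 + |q.1.1| + |q.1.2|) * b q.2)
      ((μ.prod ν).prod l) := by
    apply Integrable.mul_prod (f := fun p : ℝ × ℝ => 1 + |p.1| + |p.2|) _ hb
    have h1 : Integrable (fun p : ℝ × ℝ => |p.1|) (μ.prod ν) := (hμ.comp_fst ν).abs
    have h2 : Integrable (fun p : ℝ × ℝ => |p.2|) (μ.prod ν) := (hν.comp_snd μ).abs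
    exact ((integrable_const 1).add h1).add h2
  have hFi : Integrable (Function.uncurry F) ((μ.prod ν).prod l) := by
    refine hdom.mono' ?_ ?_
    · apply Measurable.aestronglyMeasurable
      simp only [hF, Function.uncurry_def]
      fun_prop
    · have : ∀ᵐ q : (ℝ × ℝ) × ℝ ∂((μ.prod ν).prod l),
          ∀ u : ℝ, |w q.2 * (cos (q.2 * u) - c)| ≤ b q.2 * (1 + |u|) :=
        Measure.quasiMeasurePreserving_snd.ae hbd
      filter_upwards [this] with q hq
      simp only [Function.uncurry, hF, norm_eq_abs]
      refine (hq _).trans ?_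
      have hb0 : 0 ≤ b q.2 := by
        have := (abs_nonneg _).trans (hq 0); simpa using this
      have : |q.1.1 - q.1.2| ≤ |q.1.1| + |q.1.2| := abs_sub _ _
      nlinarith
  have hinner : ∀ ω, ∫ p, F p ω ∂(μ.prod ν)
      = w ω * ((charFun μ ω * (starRingEnd ℂ) (charFun ν ω)).re - c) := by
    intro ω
    simp only [hF]
    rw [integral_const_mul, integral_sub, re_charFun_mul]
    · simp
    · apply Integrable.of_bound (C := 1)
      · apply Measurable.aestronglyMeasurable; fun_prop
      · exact Eventually.of_forall fun z => by simpa using abs_cos_le_one _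
    · exact integrable_const _
  refine ⟨?_, hFi.integral_prod_left, ?_⟩
  · have := hFi.integral_prod_right
    simpa [hinner] using this
  · rw [integral_integral_swap hFi]
    simp [hinner]

/-- Combined quadratic form. -/
lemma pair_fourier_quad (l : Measure ℝ) [SFinite l] (w b k : ℝ → ℝ) (c : ℝ) (hw : Measurable w)
    (hb : Integrable b l)
    (hbd : ∀ᵐ ω ∂l, ∀ u : ℝ, |w ω * (cos (ω * u) - c)| ≤ b ω * (1 + |u|))
    (hk : ∀ u, k u = ∫ ω, w ω * (cos (ω * u) - c) ∂l)
    (μ ν : Measure ℝ) [IsProbabilityMeasure μ] [IsProbabilityMeasure ν]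
    (hμ : Integrable (fun x : ℝ => x) μ) (hν : Integrable (fun x : ℝ => x) ν) :
    Integrable (fun ω => w ω * ‖charFun μ ω - charFun ν ω‖ ^ 2) l ∧
    (∫ p : ℝ × ℝ, k (p.1 - p.2) ∂(μ.prod μ)) - 2 * (∫ p : ℝ × ℝ, k (p.1 - p.2) ∂(μ.prod ν))
      + (∫ p : ℝ × ℝ, k (p.1 - p.2) ∂(ν.prod ν))
      = ∫ ω, w ω * ‖charFun μ ω - charFun ν ω‖ ^ 2 ∂l := by
  obtain ⟨a1, -, a3⟩ := pair_fourier l w b c hw hb hbd μ μ hμ hμ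
  obtain ⟨b1, -, b3⟩ := pair_fourier l w b c hw hb hbd μ ν hμ hν
  obtain ⟨c1, -, c3⟩ := pair_fourier l w b c hw hb hbd ν ν hν hν
  have hid : ∀ ω, w ω * ‖charFun μ ω - charFun ν ω‖ ^ 2 =
      w ω * ((charFun μ ω * (starRingEnd ℂ) (charFun μ ω)).re - c)
      - 2 * (w ω * ((charFun μ ω * (starRingEnd ℂ) (charFun ν ω)).re - c))
      + w ω * ((charFun ν ω * (starRingEnd ℂ) (charFun ν ω)).re - c) := by
    intro ω
    rw [← Complex.normSq_eq_norm_sq]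
    simp only [Complex.normSq_apply, Complex.mul_re, Complex.conj_re, Complex.conj_im,
      Complex.sub_re, Complex.sub_im]
    ring
  simp_rw [hk, a3, b3, c3, hid]
  refine ⟨(a1.sub (b1.const_mul 2)).add c1, ?_⟩
  have e1 := integral_add (a1.sub (b1.const_mul 2)) c1
  have e2 := integral_sub a1 (b1.const_mul 2)
  have e3 := integral_const_mul (μ := l) 2 (fun ω => w ω * ((charFun μ ω * (starRingEnd ℂ) (charFun ν ω)).re - c))
  simp only [Pi.sub_apply] at e1
  rw [e1, e2, e3]

lemma laplace_sin (ε u : ℝ) (hε : 0 < ε) :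
    ∫ ω in Set.Ioi (0:ℝ), exp (-ε * ω) * sin (ω * u) = u / (ε ^ 2 + u ^ 2) := by
  have h := integral_exp_mul_complex_Ioi (a := (-ε : ℂ) + u * Complex.I) (by simpa using hε) 0
  have hi := integrableOn_exp_mul_complex_Ioi (a := (-ε : ℂ) + u * Complex.I) (by simpa using hε) 0
  have h2 := integral_im hi
  have e : ∀ ω : ℝ, exp (-ε * ω) * sin (ω * u)
      = RCLike.im (Complex.exp (((-ε : ℂ) + u * Complex.I) * ω)) := by
    intro ω
    simp only [RCLike.im_eq_complex_im, Complex.exp_im]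
    congr 2
    · simp
    · simp [mul_comm]
  simp_rw [e]
  rw [h2, h]
  have hne : ε ^ 2 + u ^ 2 ≠ 0 := by positivity
  simp only [Complex.ofReal_zero, mul_zero, Complex.exp_zero, RCLike.im_eq_complex_im]
  rw [neg_div, Complex.neg_im, Complex.div_im]
  simp [Complex.normSq_apply]
  field_simp

lemma abs_cos_sub_one_le' (x : ℝ) : |cos x - 1| ≤ |x| := by
  have h : cos x - 1 = -(2 * sin (x / 2) * sin (x / 2)) := by
    have := cos_two_mul' (x / 2)
    have h2 := sin_sq_add_cos_sq (x / 2)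
    have h3 : 2 * (x / 2) = x := by ring
    rw [h3] at this
    nlinarith
  rw [h, abs_neg, abs_mul, abs_mul]
  have h1 : |sin (x / 2)| ≤ |x / 2| := abs_sin_le_abs
  have h2 : |sin (x / 2)| ≤ 1 := abs_sin_le_one _
  have h3 : |x / 2| = |x| / 2 := by rw [abs_div]; norm_num
  rw [h3] at h1
  have : |(2:ℝ)| = 2 := by norm_num
  rw [this]
  nlinarith [abs_nonneg (sin (x / 2)), abs_nonneg x]

/-- weight of the regularised logarithmic kernel -/
def wE (ε ω : ℝ) : ℝ := exp (-ε * ω) / ω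

lemma wE_bound (ε : ℝ) : ∀ᵐ ω ∂(volume.restrict (Set.Ioi (0:ℝ))), ∀ u : ℝ,
    |wE ε ω * (cos (ω * u) - 1)| ≤ exp (-ε * ω) * (1 + |u|) := by
  refine (ae_restrict_iff' measurableSet_Ioi).2 (Eventually.of_forall fun ω hω u => ?_)
  have hω : 0 < ω := hω
  rw [abs_mul, wE, abs_div, abs_of_pos (exp_pos _), abs_of_pos hω]
  have := abs_cos_sub_one_le' (ω * u)
  rw [abs_mul, abs_of_pos hω] at this
  calc exp (-ε * ω) / ω * |cos (ω * u) - 1| ≤ exp (-ε * ω) / ω * (ω * |u|) := by gcongr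
    _ = exp (-ε * ω) * |u| := by field_simp
    _ ≤ _ := by gcongr; linarith

lemma exp_neg_int (ε : ℝ) (hε : 0 < ε) :
    Integrable (fun ω => exp (-ε * ω)) (volume.restrict (Set.Ioi (0:ℝ))) :=
  integrableOn_exp_mul_Ioi (by linarith) 0

lemma wE_meas (ε : ℝ) : Measurable (wE ε) := by unfold wE; fun_prop

lemma wE_kernel (ε u : ℝ) (hε : 0 < ε) :
    -(1/2) * log (1 + u ^ 2 / ε ^ 2)
      = ∫ ω in Set.Ioi (0:ℝ), wE ε ω * (cos (ω * u) - 1) := by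
  have hintg : ∀ u, Integrable (fun ω => wE ε ω * (cos (ω * u) - 1))
      (volume.restrict (Set.Ioi (0:ℝ))) := by
    intro u
    refine Integrable.mono' ((exp_neg_int ε hε).mul_const (1 + |u|)) ?_ ?_
    · have := wE_meas ε
      apply Measurable.aestronglyMeasurable; fun_prop
    · filter_upwards [wE_bound ε] with ω h using h u
  have hd : ∀ u, HasDerivAt (fun u => ∫ ω in Set.Ioi (0:ℝ), wE ε ω * (cos (ω * u) - 1))
      (-(u / (ε ^ 2 + u ^ 2))) u := by
    intro u
    rw [← laplace_sin ε u hε, ← integral_neg]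
    refine (hasDerivAt_integral_of_dominated_loc_of_deriv_le (s := Set.univ) (bound := fun ω => exp (-ε * ω))
      (F' := fun u ω => -(exp (-ε * ω) * sin (ω * u))) univ_mem
      (Eventually.of_forall fun v => (hintg v).aestronglyMeasurable) (hintg u) ?_ ?_ (exp_neg_int ε hε) ?_).2
    · apply Measurable.aestronglyMeasurable; fun_prop
    · refine Eventually.of_forall fun ω v _ => ?_
      rw [norm_neg, norm_mul, norm_eq_abs, norm_eq_abs, abs_of_pos (exp_pos _)]
      exact mul_le_of_le_one_right (exp_pos _).le (abs_sin_le_one _)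
    · refine (ae_restrict_iff' measurableSet_Ioi).2 (Eventually.of_forall fun ω hω v _ => ?_)
      have hω : (0:ℝ) < ω := hω
      have h1 : HasDerivAt (fun v => cos (ω * v) - 1) (-sin (ω * v) * (ω * 1)) v :=
        (((hasDerivAt_id v).const_mul ω).cos).sub_const 1
      have h2 := h1.const_mul (wE ε ω)
      refine h2.congr_deriv ?_
      unfold wE
      field_simp
  have hd2 : ∀ u, HasDerivAt (fun u : ℝ => -(1/2) * log (1 + u ^ 2 / ε ^ 2))
      (-(u / (ε ^ 2 + u ^ 2))) u := by
    intro u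
    have hp : 1 + u ^ 2 / ε ^ 2 ≠ 0 := by positivity
    have h1 : HasDerivAt (fun u : ℝ => 1 + u ^ 2 / ε ^ 2) ((2 * u) / ε ^ 2) u := by
      have := ((hasDerivAt_pow 2 u).div_const (ε ^ 2)).const_add 1
      simpa using this
    have h2 := (h1.log hp).const_mul (-(1/2) : ℝ)
    refine h2.congr_deriv ?_
    have : ε ^ 2 + u ^ 2 ≠ 0 := by positivity
    field_simp
  have hc := is_const_of_deriv_eq_zero (f := fun u => -(1/2) * log (1 + u ^ 2 / ε ^ 2) -
      ∫ ω in Set.Ioi (0:ℝ), wE ε ω * (cos (ω * u) - 1))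
      (fun x => ((hd2 x).sub (hd x)).differentiableAt)
      (fun x => ((hd2 x).sub (hd x)).deriv.trans (by ring)) u 0
  simp at hc
  linarith

/-- Regularised log kernel, `-½ log(1+u²/ε²)` -/
def Lk (ε u : ℝ) : ℝ := -(1/2) * log (1 + u ^ 2 / ε ^ 2)

lemma Lk_quad (ε : ℝ) (hε : 0 < ε) (μ ν : Measure ℝ) [IsProbabilityMeasure μ]
    [IsProbabilityMeasure ν]
    (hμ : Integrable (fun x : ℝ => x) μ) (hν : Integrable (fun x : ℝ => x) ν) :
    Integrable (fun ω => wE ε ω * ‖charFun μ ω - charFun ν ω‖ ^ 2) (volume.restrict (Set.Ioi (0:ℝ))) ∧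
    (∫ p : ℝ × ℝ, Lk ε (p.1 - p.2) ∂(μ.prod μ)) - 2 * (∫ p : ℝ × ℝ, Lk ε (p.1 - p.2) ∂(μ.prod ν))
      + (∫ p : ℝ × ℝ, Lk ε (p.1 - p.2) ∂(ν.prod ν))
      = ∫ ω in Set.Ioi (0:ℝ), wE ε ω * ‖charFun μ ω - charFun ν ω‖ ^ 2 :=
  pair_fourier_quad _ (wE ε) _ (Lk ε) 1 (wE_meas ε) (exp_neg_int ε hε) (wE_bound ε)
    (fun u => wE_kernel ε u hε) μ ν hμ hν

/-- comparison of the log kernel with its regularisation. -/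
lemma neg_log_ge_Lk (ε u : ℝ) (hε : 0 < ε) (hu : u ≠ 0) : Lk ε u - log ε ≤ -log |u| := by
  unfold Lk
  have hu2 : 0 < u ^ 2 := by positivity
  have h1 : log (u ^ 2) = 2 * log |u| := by rw [← sq_abs, log_pow]; norm_num
  have h2 : log (ε ^ 2) = 2 * log ε := by rw [log_pow]; norm_num
  have h3 : log (1 + u ^ 2 / ε ^ 2) = log (ε ^ 2 + u ^ 2) - log (ε ^ 2) := by
    rw [← log_div (by positivity) (by positivity)]; congr 1; field_simp
  have h4 : log (u ^ 2) ≤ log (ε ^ 2 + u ^ 2) := log_le_log hu2 (by nlinarith)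
  rw [h3]; linarith

lemma neg_log_le_Lk (ε u : ℝ) (hε : 0 < ε) (hu : u ≠ 0) :
    -log |u| ≤ Lk ε u - log ε + 2 * sqrt ε * |u| ^ (-(1/2) : ℝ) := by
  unfold Lk
  have hu2 : 0 < u ^ 2 := by positivity
  have hua : 0 < |u| := abs_pos.2 hu
  have h1 : log (u ^ 2) = 2 * log |u| := by rw [← sq_abs, log_pow]; norm_num
  have h2 : log (ε ^ 2) = 2 * log ε := by rw [log_pow]; norm_num
  have h3 : log (1 + u ^ 2 / ε ^ 2) = log (ε ^ 2 + u ^ 2) - log (ε ^ 2) := by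
    rw [← log_div (by positivity) (by positivity)]; congr 1; field_simp
  have h4 : log (1 + ε ^ 2 / u ^ 2) = log (ε ^ 2 + u ^ 2) - log (u ^ 2) := by
    rw [← log_div (by positivity) (by positivity)]; congr 1; field_simp; ring
  have h5 : log (1 + ε ^ 2 / u ^ 2) ≤ 4 * (sqrt ε * |u| ^ (-(1/2) : ℝ)) := by
    set y := sqrt ε * |u| ^ (-(1/2) : ℝ) with hy
    have hy0 : 0 ≤ y := by positivity
    have hy4 : y ^ 4 = ε ^ 2 / u ^ 2 := by
      rw [hy, mul_pow, show (4:ℕ) = 2 * 2 by norm_num, pow_mul, sq_sqrt hε.le,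
        ← rpow_natCast (|u| ^ (-(1/2) : ℝ)), ← rpow_mul hua.le, ← sq_abs u]
      have : (-(1/2) * ((2 * 2 : ℕ) : ℝ) : ℝ) = -((2:ℕ):ℝ) := by norm_num
      rw [this, rpow_neg hua.le, rpow_natCast]
      rfl
    rw [← hy4]
    have : log (1 + y ^ 4) ≤ log ((1 + y) ^ 4) := by
      apply log_le_log (by positivity)
      nlinarith [pow_nonneg hy0 3, pow_nonneg hy0 2]
    have h6 : log ((1 + y) ^ 4) = 4 * log (1 + y) := by rw [log_pow]; norm_num
    have h7 : log (1 + y) ≤ y := by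
      have := log_le_sub_one_of_pos (show 0 < 1 + y by positivity); linarith
    linarith
  rw [h3]; linarith

open scoped FourierTransform in
lemma h_repr (h : ℝ → ℝ) (hEv : IsEvenFun h) (hSch : IsSchwartz h)
    (hpsd : ∀ t : ℝ, (hhatC h t).im = 0 ∧ 0 ≤ (hhatC h t).re) :
    ∃ κ : ℝ → ℝ, Continuous κ ∧ (∀ ω, 0 ≤ κ ω) ∧ (∀ ω, κ (-ω) = κ ω) ∧
      (∀ n : ℕ, Integrable (fun ω => |ω| ^ n * κ ω)) ∧ (∃ C, ∀ ω, |ω| * κ ω ≤ C) ∧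
      (∀ u, h u = ∫ ω, κ ω * cos (ω * u)) := by
  obtain ⟨H, hH⟩ := hSch
  let Hc : SchwartzMap ℝ ℂ := SchwartzMap.postcompCLM (𝕜 := ℝ) Complex.ofRealCLM H
  have hHc : ∀ t, Hc t = (h t : ℂ) := by intro t; simp [Hc, hH]
  let f : SchwartzMap ℝ ℂ := 𝓕 Hc
  have hf : ∀ ξ, f ξ = ∫ s : ℝ, Complex.exp (-Complex.I * ((2 * π * ξ : ℝ) : ℂ) * (s : ℂ)) * (h s : ℂ) := by
    intro ξ
    have : f ξ = 𝓕 (Hc : ℝ → ℂ) ξ := rfl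
    rw [this, fourier_real_eq_integral_exp_smul]
    refine integral_congr_ae (Eventually.of_forall fun s => ?_)
    simp only [hHc, smul_eq_mul]
    congr 2
    push_cast; ring
  have hs : (0:ℝ) < sqrt (2 * π) := by positivity
  have hf2 : ∀ ξ, f ξ = (sqrt (2 * π) : ℝ) * hhatC h (2 * π * ξ) := by
    intro ξ
    rw [hf, hhatC, ← mul_assoc, ← Complex.ofReal_mul]
    have : sqrt (2 * π) * (1 / sqrt (2 * π)) = 1 := by field_simp
    rw [this]; simp
  have hfim : ∀ ξ, (f ξ).im = 0 := by
    intro ξ; rw [hf2, Complex.im_ofReal_mul, (hpsd _).1, mul_zero]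
  have hfre : ∀ ξ, 0 ≤ (f ξ).re := by
    intro ξ; rw [hf2, Complex.re_ofReal_mul]; exact mul_nonneg hs.le (hpsd _).2
  have hfev : ∀ ξ, f (-ξ) = f ξ := by
    intro ξ
    rw [hf, hf, ← integral_neg_eq_self]
    refine integral_congr_ae (Eventually.of_forall fun s => ?_)
    simp only [hEv s]
    congr 2
    push_cast; ring
  have hinv : ∀ u, (h u : ℂ) = ∫ ξ : ℝ, Complex.exp (((2 * π * (ξ * u) : ℝ) : ℂ) * Complex.I) * f ξ := by
    intro u
    have h1 : 𝓕⁻ f = Hc := FourierTransform.fourierInv_fourier_eq Hc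
    have h2 : (𝓕⁻ f) u = 𝓕⁻ (f : ℝ → ℂ) u := by rw [← SchwartzMap.fourierInv_coe]
    rw [← hHc, ← h1, h2, Real.fourierInv_eq']
    refine integral_congr_ae (Eventually.of_forall fun s => ?_)
    simp only [smul_eq_mul]
    congr 3
    simp [mul_comm]
  have hinv2 : ∀ u, h u = ∫ ξ : ℝ, (f ξ).re * cos (2 * π * (ξ * u)) := by
    intro u
    have hi : Integrable (fun ξ : ℝ => Complex.exp (((2 * π * (ξ * u) : ℝ) : ℂ) * Complex.I) * f ξ) := by
      refine f.integrable.bdd_mul (c := 1) (by fun_prop) (Eventually.of_forall fun ξ => ?_)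
      rw [Complex.norm_exp_ofReal_mul_I]
    have := integral_re hi
    simp only [RCLike.re_eq_complex_re] at this
    rw [← hinv u, Complex.ofReal_re] at this
    rw [← this]
    refine integral_congr_ae (Eventually.of_forall fun s => ?_)
    simp only [Complex.mul_re, Complex.exp_ofReal_mul_I_re, hfim]
    ring
  have hp : (0:ℝ) < 2 * π := by positivity
  refine ⟨fun ω => (2 * π)⁻¹ * (f ((2 * π)⁻¹ * ω)).re, ?_, ?_, ?_, ?_, ?_, ?_⟩
  · have := f.continuous; fun_prop
  · intro ω; exact mul_nonneg (by positivity) (hfre _)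
  · intro ω; simp only [mul_neg, hfev]
  · intro n
    have h1 : Integrable (fun ξ : ℝ => |ξ| ^ n * (f ξ).re) := by
      refine (f.integrable_pow_mul volume n).mono' ?_ (Eventually.of_forall fun ξ => ?_)
      · have := f.continuous
        apply Continuous.aestronglyMeasurable; fun_prop
      · rw [norm_mul, norm_pow, norm_eq_abs, abs_abs, norm_eq_abs, norm_eq_abs]
        gcongr
        exact Complex.abs_re_le_norm _
    have h2 := (h1.comp_mul_left' (R := (2 * π)⁻¹) (by positivity)).const_mul ((2 * π) ^ n * (2 * π)⁻¹)
    refine h2.congr (Eventually.of_forall fun ω => ?_)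
    simp only [abs_mul, abs_inv, abs_of_pos hp, mul_pow, inv_pow]
    field_simp
  · obtain ⟨C, hC⟩ := f.decay' 1 0
    refine ⟨C, fun ω => ?_⟩
    have := hC ((2 * π)⁻¹ * ω)
    simp only [pow_one, norm_iteratedFDeriv_zero, norm_mul, norm_inv, norm_eq_abs] at this
    have h3 := Complex.abs_re_le_norm (f ((2 * π)⁻¹ * ω))
    rw [abs_of_nonneg (hfre _)] at h3
    calc |ω| * ((2 * π)⁻¹ * (f ((2 * π)⁻¹ * ω)).re)
        = (2 * π)⁻¹ * |ω| * (f ((2 * π)⁻¹ * ω)).re := by ring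
      _ ≤ (2 * π)⁻¹ * |ω| * ‖(f ((2 * π)⁻¹ * ω))‖ := by gcongr
      _ ≤ C := by
        have e : (|2| * |π|)⁻¹ = (2 * π)⁻¹ := by rw [abs_of_pos pi_pos]; norm_num
        rw [e] at this
        exact this
  · intro u
    rw [hinv2]
    have h3 : ∀ ω, (2 * π)⁻¹ * (f ((2 * π)⁻¹ * ω)).re * cos (ω * u) = (2 * π)⁻¹ *
      ((f ((2 * π)⁻¹ * ω)).re * cos (2 * π * ((2 * π)⁻¹ * ω * u))) := by
      intro ω
      have : 2 * π * ((2 * π)⁻¹ * ω * u) = ω * u := by field_simp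
      rw [this]; ring
    simp_rw [h3]
    rw [integral_const_mul, Measure.integral_comp_mul_left (fun ξ => (f ξ).re * cos (2 * π * (ξ * u)))]
    simp only [inv_inv, abs_of_pos hp, smul_eq_mul]
    rw [← mul_assoc, inv_mul_cancel₀ hp.ne', one_mul]

lemma kappa_deriv (κ h : ℝ → ℝ) (hκc : Continuous κ) (hκ0 : ∀ ω, 0 ≤ κ ω)
    (hκi : ∀ n : ℕ, Integrable (fun ω => |ω| ^ n * κ ω))
    (hh : ∀ u, h u = ∫ ω, κ ω * cos (ω * u)) :
    (∀ u, HasDerivAt h (∫ ω, -(ω * κ ω * sin (ω * u))) u) ∧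
    (∀ u, HasDerivAt (fun u => ∫ ω, -(ω * κ ω * sin (ω * u)))
      (∫ ω, -(ω ^ 2 * κ ω * cos (ω * u))) u) := by
  have hκi0 : Integrable κ := by simpa using hκi 0
  constructor
  · intro u
    have : h = fun u => ∫ ω, κ ω * cos (ω * u) := funext hh
    rw [this]
    refine (hasDerivAt_integral_of_dominated_loc_of_deriv_le (s := Set.univ)
      (bound := fun ω => |ω| ^ 1 * κ ω)
      (F' := fun u ω => -(ω * κ ω * sin (ω * u))) univ_mem
      (Eventually.of_forall fun v => ?_) ?_ ?_ ?_ (hκi 1) ?_).2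
    · apply Continuous.aestronglyMeasurable; fun_prop
    · refine hκi0.mul_bdd (c := 1) (by fun_prop) (Eventually.of_forall fun ω => abs_cos_le_one _)
    · apply Continuous.aestronglyMeasurable; fun_prop
    · refine Eventually.of_forall fun ω v _ => ?_
      rw [norm_neg, norm_mul, norm_mul, norm_eq_abs, norm_eq_abs, norm_eq_abs, abs_of_nonneg (hκ0 ω), pow_one]
      exact mul_le_of_le_one_right (mul_nonneg (abs_nonneg _) (hκ0 _)) (abs_sin_le_one _)
    · refine Eventually.of_forall fun ω v _ => ?_
      refine ((((hasDerivAt_id v).const_mul ω).cos).const_mul (κ ω)).congr_deriv ?_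
      simp; ring
  · intro u
    refine (hasDerivAt_integral_of_dominated_loc_of_deriv_le (s := Set.univ)
      (bound := fun ω => |ω| ^ 2 * κ ω)
      (F' := fun u ω => -(ω ^ 2 * κ ω * cos (ω * u))) univ_mem
      (Eventually.of_forall fun v => ?_) ?_ ?_ ?_ (hκi 2) ?_).2
    · apply Continuous.aestronglyMeasurable; fun_prop
    · refine (hκi 1).mono' (by apply Continuous.aestronglyMeasurable; fun_prop) (Eventually.of_forall fun ω => ?_)
      rw [norm_neg, norm_mul, norm_mul, norm_eq_abs, norm_eq_abs, norm_eq_abs, abs_of_nonneg (hκ0 ω), pow_one]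
      exact mul_le_of_le_one_right (mul_nonneg (abs_nonneg _) (hκ0 _)) (abs_sin_le_one _)
    · apply Continuous.aestronglyMeasurable; fun_prop
    · refine Eventually.of_forall fun ω v _ => ?_
      rw [norm_neg, norm_mul, norm_mul, norm_eq_abs, norm_eq_abs, abs_pow, norm_eq_abs, abs_of_nonneg (hκ0 ω)]
      exact mul_le_of_le_one_right (mul_nonneg (by positivity) (hκ0 _)) (abs_cos_le_one _)
    · refine Eventually.of_forall fun ω v _ => ?_
      refine ((((hasDerivAt_id v).const_mul ω).sin).const_mul (ω * κ ω)).neg.congr_deriv ?_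
      simp; ring

lemma kappa_deriv2 (κ h : ℝ → ℝ) (hκc : Continuous κ) (hκ0 : ∀ ω, 0 ≤ κ ω)
    (hκi : ∀ n : ℕ, Integrable (fun ω => |ω| ^ n * κ ω))
    (hh : ∀ u, h u = ∫ ω, κ ω * cos (ω * u)) (u : ℝ) :
    iteratedDeriv 2 h u = ∫ ω, -(ω ^ 2 * κ ω * cos (ω * u)) := by
  obtain ⟨h1, h2⟩ := kappa_deriv κ h hκc hκ0 hκi hh
  rw [iteratedDeriv_succ, iteratedDeriv_one]
  have : deriv h = fun u => ∫ ω, -(ω * κ ω * sin (ω * u)) := funext fun u => (h1 u).deriv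
  rw [this, (h2 u).deriv]

/-- truncated arcosh -/
def AC (s : ℝ) : ℝ := arcosh (max 1 |s|)

lemma root_exists (s : ℝ) : ∃ w : ℂ, w ≠ 0 ∧ w + w⁻¹ = 2 * s ∧ log⁺ ‖w‖ + log⁺ ‖w⁻¹‖ = AC s := by
  by_cases hs : |s| ≤ 1
  · have h1 : 0 ≤ 1 - s ^ 2 := by
      have := sq_abs s
      have h0 := abs_nonneg s
      nlinarith
    have hn : Complex.normSq (⟨s, √(1 - s ^ 2)⟩ : ℂ) = 1 := by
      rw [Complex.normSq_apply]
      have := mul_self_sqrt h1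
      simp only
      nlinarith
    have hw0 : (⟨s, √(1 - s ^ 2)⟩ : ℂ) ≠ 0 := by
      intro h0; rw [h0] at hn; simp at hn
    refine ⟨⟨s, √(1 - s ^ 2)⟩, hw0, ?_, ?_⟩
    · rw [Complex.inv_def, hn]
      apply Complex.ext <;> simp
      ring
    · have hnorm : ‖(⟨s, √(1 - s ^ 2)⟩ : ℂ)‖ = 1 := by
        rw [Complex.norm_def, hn, sqrt_one]
      rw [norm_inv, hnorm, AC, max_eq_left hs]
      simp
  · push Not at hs
    have h1 : 0 ≤ s ^ 2 - 1 := by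
      have := sq_abs s
      nlinarith
    obtain ⟨σ, hσ, hσs⟩ : ∃ σ : ℝ, σ * σ = 1 ∧ s = σ * |s| := by
      rcases le_total 0 s with h | h
      · exact ⟨1, by norm_num, by rw [abs_of_nonneg h]; ring⟩
      · exact ⟨-1, by norm_num, by rw [abs_of_nonpos h]; ring⟩
    set R := |s| + √(s ^ 2 - 1) with hR
    have hR1 : 1 < R := by have := sqrt_nonneg (s ^ 2 - 1); linarith
    have hinv : R⁻¹ = |s| - √(s ^ 2 - 1) := by
      rw [inv_eq_one_div, div_eq_iff (by linarith)]
      have := mul_self_sqrt h1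
      have := sq_abs s
      rw [hR]; nlinarith
    have hσ0 : σ ≠ 0 := by intro h; rw [h] at hσ; norm_num at hσ
    have hσi : σ⁻¹ = σ := by rw [inv_eq_one_div, div_eq_iff hσ0, hσ]
    have hσa : |σ| = 1 := by
      have := abs_mul_abs_self σ
      rw [hσ] at this
      have h0 := abs_nonneg σ
      nlinarith
    refine ⟨((σ * R : ℝ) : ℂ), ?_, ?_, ?_⟩
    · exact_mod_cast mul_ne_zero hσ0 (by linarith)
    · have : σ * R + (σ * R)⁻¹ = 2 * s := by
        rw [mul_inv, hσi, hinv, hR]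
        conv_rhs => rw [hσs]
        ring
      exact_mod_cast this
    · rw [norm_inv, Complex.norm_real, norm_eq_abs, abs_mul, hσa, one_mul, abs_of_pos (by linarith), AC,
        max_eq_right hs.le, posLog_eq_log (by rw [abs_of_pos (by linarith)]; exact hR1.le),
        posLog_eq_zero_iff _ |>.2, add_zero, arcosh, sq_abs]
      rw [abs_of_pos (by rw [inv_pos]; linarith)]
      exact inv_le_one_of_one_le₀ hR1.le

lemma norm_fact (s θ : ℝ) (w : ℂ) (hw : w ≠ 0) (h : w + w⁻¹ = 2 * s) :
    ‖circleMap 0 1 θ - w‖ * ‖circleMap 0 1 θ - w⁻¹‖ = 2 * |s - cos θ| := by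
  rw [← norm_mul]
  have e1 : circleMap 0 1 θ = Complex.exp (θ * Complex.I) := by simp [circleMap]
  have hne := Complex.exp_ne_zero (θ * Complex.I)
  have hc : Complex.exp (θ * Complex.I) + (Complex.exp (θ * Complex.I))⁻¹ = 2 * Complex.cos θ := by
    rw [← Complex.exp_neg, Complex.cos]; ring_nf
  have e2 : (circleMap 0 1 θ - w) * (circleMap 0 1 θ - w⁻¹)
      = Complex.exp (θ * Complex.I) * (2 * ((cos θ - s : ℝ) : ℂ)) := by
    rw [e1]
    push_cast
    have : 2 * (Complex.cos θ - s) = (2 * Complex.cos θ) - (2 * s) := by ring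
    rw [this, ← hc, ← h]
    field_simp
    ring
  rw [e2, norm_mul, norm_mul, Complex.norm_exp_ofReal_mul_I, Complex.norm_real, norm_eq_abs, abs_sub_comm]
  simp

lemma cos_ne_ae (s : ℝ) : ∀ᵐ θ : ℝ, cos θ ≠ s := by
  have : {θ : ℝ | cos θ = s}.Countable := by
    by_cases hs : ∃ α, cos α = s
    · obtain ⟨α, rfl⟩ := hs
      refine ((Set.countable_range (fun k : ℤ => 2 * k * π + α)).union
        (Set.countable_range (fun k : ℤ => 2 * k * π - α))).mono ?_
      intro θ hθ
      obtain ⟨k, hk⟩ := cos_eq_cos_iff.1 (Eq.symm (show cos θ = cos α from hθ))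
      rcases hk with hk | hk
      · exact Or.inl ⟨k, hk.symm⟩
      · exact Or.inr ⟨k, hk.symm⟩
    · convert Set.countable_empty
      ext θ
      simp only [Set.mem_ofPred_eq, Set.mem_empty_iff_false, iff_false]
      exact fun h => hs ⟨θ, h⟩
  have := this.measure_zero volume
  rw [ae_iff]
  simpa using this

lemma circ_log (r t : ℝ) (hr : 0 < r) :
    IntegrableOn (fun θ => log |t - r * cos θ|) (Set.Ioo (-π) π) ∧
    (2 * π)⁻¹ * ∫ θ in Set.Ioo (-π) π, log |t - r * cos θ| = log (r / 2) + AC (t / r) := by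
  obtain ⟨w, hw0, hw, hl⟩ := root_exists (t / r)
  have key : ∀ a : ℂ, IntegrableOn (fun θ => log ‖circleMap 0 1 θ - a‖) (Set.Ioo (-π) π) ∧
      (2 * π)⁻¹ * ∫ θ in Set.Ioo (-π) π, log ‖circleMap 0 1 θ - a‖ = log⁺ ‖a‖ := by
    intro a
    have hper : Function.Periodic (fun θ => log ‖circleMap 0 1 θ - a‖) (2 * π) := by
      intro θ; simp only [periodic_circleMap (0:ℂ) 1 θ]
    have hi : IntervalIntegrable (fun θ => log ‖circleMap 0 1 θ - a‖) volume 0 (2 * π) :=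
      circleIntegrable_log_norm_sub_const (a := a) (c := 0) 1
    have h1 := circleAverage_log_norm_sub_const_eq_posLog (a := a)
    rw [circleAverage_def] at h1
    have h2 := hper.intervalIntegral_add_eq 0 (-π)
    have e3 : -π + 2 * π = π := by ring
    rw [zero_add, e3] at h2
    rw [h2] at h1
    have hi' : IntervalIntegrable (fun θ => log ‖circleMap 0 1 θ - a‖) volume (-π) π := by
      refine hper.intervalIntegrable (t := 0) two_pi_pos.ne' ?_ _ _
      simpa using hi
    have hpi := pi_pos
    rw [intervalIntegral.integral_of_le (by linarith), integral_Ioc_eq_integral_Ioo] at h1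
    refine ⟨?_, by simpa using h1⟩
    exact ((intervalIntegrable_iff_integrableOn_Ioo_of_le (by linarith)).1 hi')
  obtain ⟨i1, j1⟩ := key w
  obtain ⟨i2, j2⟩ := key w⁻¹
  have hae : ∀ᵐ θ ∂(volume.restrict (Set.Ioo (-π) π)), log ‖circleMap 0 1 θ - w‖ + log ‖circleMap 0 1 θ - w⁻¹‖
      + log (r / 2) = log |t - r * cos θ| := by
    filter_upwards [ae_restrict_of_ae (cos_ne_ae (t / r))] with θ hθ
    have hf := norm_fact (t / r) θ w hw0 (by simpa using hw)
    have hpos : 0 < 2 * |t / r - cos θ| := by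
      have : t / r - cos θ ≠ 0 := sub_ne_zero.2 (Ne.symm hθ)
      positivity
    have h1 : ‖circleMap 0 1 θ - w‖ ≠ 0 := by intro h; rw [h] at hf; linarith
    have h2 : ‖circleMap 0 1 θ - w⁻¹‖ ≠ 0 := by intro h; rw [h] at hf; linarith
    rw [← log_mul h1 h2, hf, ← log_mul hpos.ne' (by positivity)]
    congr 1
    have : t - r * cos θ = r * (t / r - cos θ) := by field_simp
    rw [this, abs_mul, abs_of_pos hr]; ring
  have hpi := pi_pos
  refine ⟨((i1.add i2).add (integrable_const (log (r/2)))).congr hae, ?_⟩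
  rw [← integral_congr_ae hae, integral_add (f := fun θ => log ‖circleMap 0 1 θ - w‖ + log ‖circleMap 0 1 θ - w⁻¹‖) (i1.add i2) (integrable_const _), integral_add i1 i2, mul_add,
    mul_add, j1, j2, ← hl]
  simp
  rw [max_eq_left (by linarith)]
  field_simp
  ring

lemma AC_nonneg (s : ℝ) : 0 ≤ AC s := arcosh_nonneg (le_max_left _ _)

lemma AC_zero (s : ℝ) (h : |s| ≤ 1) : AC s = 0 := by rw [AC, max_eq_left h]; simp [arcosh]

lemma AC_eq (s : ℝ) (h : 1 ≤ |s|) : AC s = arcosh |s| := by rw [AC, max_eq_right h]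

lemma AC_cont : Continuous AC := by
  unfold AC
  have : ContinuousOn arcosh (Set.Ici 1) := by
    unfold arcosh
    refine ContinuousOn.log (by fun_prop) ?_
    intro x hx
    have : (1:ℝ) ≤ x := hx
    have := sqrt_nonneg (x ^ 2 - 1)
    linarith
  refine this.comp_continuous (by fun_prop) (fun x => Set.mem_Ici.2 (le_max_left _ _))

lemma polar_disc (G φ : ℝ → ENNReal) (hG : Measurable G) (hφ : Measurable φ) :
    ∫⁻ r in Set.Ioi (0:ℝ), ENNReal.ofReal r * G r * ∫⁻ θ in Set.Ioo (-π) π, φ (r * cos θ)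
      = ∫⁻ x : ℝ, φ x * ∫⁻ y : ℝ, G (√(x ^ 2 + y ^ 2)) := by
  have h := lintegral_comp_polarCoord_symm (fun p : ℝ × ℝ => φ p.1 * G (√(p.1 ^ 2 + p.2 ^ 2)))
  have hm : Measurable (fun p : ℝ × ℝ => φ p.1 * G (√(p.1 ^ 2 + p.2 ^ 2))) := by fun_prop
  rw [show polarCoord.target = Set.Ioi (0:ℝ) ×ˢ Set.Ioo (-π) π from rfl, Measure.volume_eq_prod,
    lintegral_prod _ hm.aemeasurable, ← Measure.prod_restrict, lintegral_prod] at h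
  · have e : ∀ x : ℝ, φ x * ∫⁻ y : ℝ, G (√(x ^ 2 + y ^ 2))
        = ∫⁻ y : ℝ, φ x * G (√(x ^ 2 + y ^ 2)) := fun x => by
      rw [lintegral_const_mul]; fun_prop
    simp_rw [e]
    rw [← h]
    refine setLIntegral_congr_fun measurableSet_Ioi fun r hr => ?_
    have hr : 0 < r := hr
    rw [← lintegral_const_mul _ (by fun_prop)]
    refine lintegral_congr fun θ => ?_
    simp only [polarCoord_symm_apply, smul_eq_mul]
    have : (r * cos θ) ^ 2 + (r * sin θ) ^ 2 = r ^ 2 := by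
      have := sin_sq_add_cos_sq θ
      linear_combination r ^ 2 * this
    rw [this, sqrt_sq hr.le]
    ring
  · simp only [polarCoord_symm_apply, smul_eq_mul]
    fun_prop

lemma AC_int (x t : ℝ) (hx : x ≠ 0) (ht : 0 < t) :
    ∫⁻ y : ℝ, ENNReal.ofReal (AC (t / √(x ^ 2 + y ^ 2))) = ENNReal.ofReal (π * max (t - |x|) 0) := by
  have hx2 : 0 < x ^ 2 := by positivity
  have habs : ∀ y, |t / √(x ^ 2 + y ^ 2)| = t / √(x ^ 2 + y ^ 2) := fun y => abs_of_pos (by positivity)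
  by_cases hxt : t ≤ |x|
  · have : ∀ y : ℝ, AC (t / √(x ^ 2 + y ^ 2)) = 0 := by
      intro y
      apply AC_zero
      rw [habs, div_le_one (by positivity)]
      refine hxt.trans (abs_le_sqrt ?_)
      nlinarith [sq_nonneg y]
    simp [this, hxt]
  push Not at hxt
  have hxp : 0 < |x| := abs_pos.2 hx
  have hY2 : 0 < t ^ 2 - x ^ 2 := by rw [← sq_abs x]; nlinarith
  set Y := √(t ^ 2 - x ^ 2) with hY
  have hYp : 0 < Y := sqrt_pos.2 hY2
  have hYs : Y ^ 2 = t ^ 2 - x ^ 2 := sq_sqrt hY2.le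
  have hcont : Continuous (fun y : ℝ => AC (t / √(x ^ 2 + y ^ 2))) := by
    refine AC_cont.comp (Continuous.div₀ (by fun_prop) (by fun_prop) fun y => ?_)
    positivity
  have hzero : ∀ y, y ∉ Set.Ioc (-Y) Y → AC (t / √(x ^ 2 + y ^ 2)) = 0 := by
    intro y hy
    apply AC_zero
    rw [habs, div_le_one (by positivity)]
    refine le_sqrt_of_sq_le ?_
    have : Y ^ 2 ≤ y ^ 2 := by
      rw [sq_le_sq, abs_of_pos hYp]
      by_contra hc
      push Not at hc
      rw [abs_lt] at hc
      exact hy ⟨hc.1, hc.2.le⟩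
    linarith
  set F : ℝ → ℝ := fun y => y * AC (t / √(x ^ 2 + y ^ 2)) + t * arcsin (y / Y)
      - |x| * arcsin (t * y / (Y * √(x ^ 2 + y ^ 2))) with hF
  have hFc : Continuous F := by
    refine ((continuous_id.mul hcont).add (by fun_prop)).sub (continuous_const.mul
      (continuous_arcsin.comp (Continuous.div₀ (by fun_prop) (by fun_prop) fun y => ?_)))
    positivity
  have hFd : ∀ y ∈ Set.Ioo (-Y) Y, HasDerivAt F (AC (t / √(x ^ 2 + y ^ 2))) y := by
    intro y hy
    have hyY : y ^ 2 < Y ^ 2 := by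
      rw [sq_lt_sq, abs_of_pos hYp]; exact abs_lt.2 hy
    have hR2 : 0 < Y ^ 2 - y ^ 2 := by linarith
    set R := √(Y ^ 2 - y ^ 2) with hR
    have hRp : 0 < R := sqrt_pos.2 hR2
    have hRs : R ^ 2 = Y ^ 2 - y ^ 2 := sq_sqrt hR2.le
    set r := √(x ^ 2 + y ^ 2) with hr
    have hrp : 0 < r := sqrt_pos.2 (by positivity)
    have hrs : r ^ 2 = x ^ 2 + y ^ 2 := sq_sqrt (by positivity)
    have hre : ∀ᶠ z in 𝓝 y, AC (t / √(x ^ 2 + z ^ 2)) = log (t + √(Y ^ 2 - z ^ 2)) - log (√(x ^ 2 + z ^ 2)) := by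
      filter_upwards [isOpen_Ioo.mem_nhds hy] with z hz
      have hzY : z ^ 2 < Y ^ 2 := by
        rw [sq_lt_sq, abs_of_pos hYp]; exact abs_lt.2 hz
      have hrz : 0 < √(x ^ 2 + z ^ 2) := sqrt_pos.2 (by positivity)
      have hrzs : √(x ^ 2 + z ^ 2) ^ 2 = x ^ 2 + z ^ 2 := sq_sqrt (by positivity)
      have h1 : 1 ≤ t / √(x ^ 2 + z ^ 2) := by
        rw [one_le_div hrz]
        apply sqrt_le_iff.2 ⟨ht.le, by linarith⟩
      rw [AC_eq _ (by rw [habs]; exact h1), habs, arcosh, ← log_div _ hrz.ne']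
      · congr 1
        have : (t / √(x ^ 2 + z ^ 2)) ^ 2 - 1 = (Y ^ 2 - z ^ 2) / √(x ^ 2 + z ^ 2) ^ 2 := by
          field_simp
          rw [hrzs, hYs]; ring
        rw [this, sqrt_div' _ (by positivity), sqrt_sq hrz.le]
        ring
      · have := sqrt_nonneg (Y ^ 2 - z ^ 2)
        positivity
    have dR : HasDerivAt (fun z => √(Y ^ 2 - z ^ 2)) (-y / R) y := by
      have := (((hasDerivAt_id y).pow 2).const_sub (Y ^ 2)).sqrt (by simpa using hR2.ne')
      refine this.congr_deriv ?_
      simp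
      rw [← hR]; field_simp
    have dr : HasDerivAt (fun z => √(x ^ 2 + z ^ 2)) (y / r) y := by
      have := (((hasDerivAt_id y).pow 2).const_add (x ^ 2)).sqrt (by simp; positivity)
      refine this.congr_deriv ?_
      simp
      rw [← hr]; field_simp
    have dAC : HasDerivAt (fun z => AC (t / √(x ^ 2 + z ^ 2))) (-(y * t) / (R * r ^ 2)) y := by
      have h1 := ((dR.const_add t).log (by positivity)).sub (dr.log hrp.ne')
      refine (h1.congr_of_eventuallyEq hre).congr_deriv ?_
      rw [← hR, ← hr]
      field_simp
      linear_combination (-y) * (hrs + hRs + hYs)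
    have d2 : HasDerivAt (fun z => arcsin (z / Y)) (1 / R) y := by
      have hq : (y / Y) ^ 2 < 1 := by rw [div_pow, div_lt_one (by positivity)]; exact hyY
      have h1 := (hasDerivAt_arcsin (x := y / Y) (by nlinarith) (by nlinarith)).comp y
        ((hasDerivAt_id y).div_const Y)
      refine h1.congr_deriv ?_
      have : 1 - (y / Y) ^ 2 = (Y ^ 2 - y ^ 2) / Y ^ 2 := by field_simp
      rw [this, sqrt_div' _ (by positivity), sqrt_sq hYp.le, ← hR]
      field_simp
    have d3 : HasDerivAt (fun z => arcsin (t * z / (Y * √(x ^ 2 + z ^ 2)))) (t * |x| / (r ^ 2 * R)) y := by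
      have h1q : 1 - (t * y / (Y * r)) ^ 2 = (|x| * R / (Y * r)) ^ 2 := by
        field_simp
        rw [sq_abs, hRs, hrs, hYs]; ring
      have hq : (t * y / (Y * r)) ^ 2 < 1 := by
        have : 0 < (|x| * R / (Y * r)) ^ 2 := by positivity
        linarith
      have h1 := (hasDerivAt_arcsin (x := t * y / (Y * r)) (by nlinarith) (by nlinarith)).comp y
        (((hasDerivAt_id y).const_mul t).div (dr.const_mul Y) (by positivity))
      refine h1.congr_deriv ?_
      rw [h1q, sqrt_sq (by positivity), ← hr]
      simp only [id]
      field_simp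
      rw [sq_abs, hrs]; ring
    refine (((hasDerivAt_id y).mul dAC).add (d2.const_mul t) |>.sub (d3.const_mul |x|)).congr_deriv ?_
    simp only [id, ← hr]
    field_simp
    rw [sq_abs, hrs]; ring
  have hintg : ∫ y in (-Y)..Y, AC (t / √(x ^ 2 + y ^ 2)) = F Y - F (-Y) :=
    intervalIntegral.integral_eq_sub_of_hasDerivAt_of_le (by linarith) hFc.continuousOn hFd
      (hcont.intervalIntegrable _ _)
  have hval : F Y - F (-Y) = π * (t - |x|) := by
    have e1 : √(x ^ 2 + Y ^ 2) = t := by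
      rw [hYs, show x ^ 2 + (t ^ 2 - x ^ 2) = t ^ 2 by ring, sqrt_sq ht.le]
    have e2 : AC 1 = 0 := AC_zero 1 (by simp)
    have e3 : t * -Y / (Y * t) = -1 := by field_simp
    have e4 : t * Y / (Y * t) = 1 := by field_simp
    have e5 : -Y / Y = -1 := by field_simp
    simp only [hF, neg_sq, e1, div_self ht.ne', e2, div_self hYp.ne', e3, e4, e5, arcsin_neg, arcsin_one]
    ring
  rw [max_eq_left (by linarith), ← hval, ← hintg, intervalIntegral.integral_of_le (by linarith),
    ofReal_integral_eq_lintegral_ofReal (hcont.integrableOn_Ioc) (Eventually.of_forall fun y => AC_nonneg _),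
    ← lintegral_indicator measurableSet_Ioc]
  refine lintegral_congr fun y => ?_
  by_cases hy : y ∈ Set.Ioc (-Y) Y
  · rw [Set.indicator_of_mem hy]
  · rw [Set.indicator_of_notMem hy, hzero y hy, ENNReal.ofReal_zero]

/-- circle average -/
def avgc (v : ℝ → ℝ) (r : ℝ) : ℝ := (2 * π)⁻¹ * ∫ θ in (-π)..π, v (r * cos θ)

/-- potential with second derivative v -/
def Vv (v : ℝ → ℝ) (t : ℝ) : ℝ := ∫ s in (0:ℝ)..t, (t - s) * v s

lemma avgc_cont (v : ℝ → ℝ) (hv : Continuous v) : Continuous (avgc v) := by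
  unfold avgc
  refine continuous_const.mul ?_
  exact intervalIntegral.continuous_parametric_intervalIntegral_of_continuous' (by fun_prop) _ _

lemma avgc_ge (v : ℝ → ℝ) (hv : Continuous v) (c : ℝ) (hc : ∀ t, c ≤ v t) (r : ℝ) : c ≤ avgc v r := by
  unfold avgc
  have hpi := pi_pos
  have h : ∫ θ in (-π)..π, c ≤ ∫ θ in (-π)..π, v (r * cos θ) :=
    intervalIntegral.integral_mono_on (by linarith) (by simp)
      ((by fun_prop : Continuous fun θ => v (r * cos θ)).intervalIntegrable _ _) (fun θ _ => hc _)
  simp at h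
  rw [inv_mul_eq_div, le_div_iff₀ (by positivity)]
  linarith

lemma avgc_lint (v : ℝ → ℝ) (hv : Continuous v) (h0 : ∀ t, 0 ≤ v t) (r : ℝ) :
    ∫⁻ θ in Set.Ioo (-π) π, ENNReal.ofReal (v (r * cos θ)) = ENNReal.ofReal (2 * π * avgc v r) := by
  have hpi := pi_pos
  unfold avgc
  rw [← mul_assoc, mul_inv_cancel₀ (by positivity), one_mul, intervalIntegral.integral_of_le (by linarith),
    integral_Ioc_eq_integral_Ioo, ofReal_integral_eq_lintegral_ofReal]
  · exact ((by fun_prop : Continuous fun θ => v (r * cos θ)).integrableOn_Icc).mono_set Set.Ioo_subset_Icc_self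
  · exact Eventually.of_forall fun θ => h0 _

lemma Vv_neg (v : ℝ → ℝ) (hev : ∀ t, v (-t) = v t) (t : ℝ) : Vv v (-t) = Vv v t := by
  unfold Vv
  have := intervalIntegral.integral_comp_neg (a := 0) (b := t) (fun s => (-t - s) * v s)
  rw [neg_zero] at this
  rw [intervalIntegral.integral_symm, ← this, ← intervalIntegral.integral_neg]
  refine intervalIntegral.integral_congr fun s _ => ?_
  simp only [hev]; ring

lemma Vv_abs (v : ℝ → ℝ) (hev : ∀ t, v (-t) = v t) (t : ℝ) : Vv v |t| = Vv v t := by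
  rcases abs_choice t with h | h <;> rw [h]
  exact Vv_neg v hev t

lemma abel (v : ℝ → ℝ) (hv : Continuous v) (h0 : ∀ t, 0 ≤ v t) (hev : ∀ t, v (-t) = v t) (t : ℝ) (ht : 0 < t) :
    IntegrableOn (fun r => r * avgc v r * AC (t / r)) (Set.Ioi 0) ∧
    ∫ r in Set.Ioi (0:ℝ), r * avgc v r * AC (t / r) = Vv v t := by
  have hpi := pi_pos
  have hACm : Measurable (fun r => AC (t / r)) := AC_cont.measurable.comp (by fun_prop)
  have hVnn : ∀ t, 0 ≤ avgc v t := fun r => avgc_ge v hv 0 h0 r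
  have hcc : Continuous (fun x => v |x| * max (t - |x|) 0 / 2) := by fun_prop
  have hi : Integrable (fun x => v |x| * max (t - |x|) 0 / 2) := by
    refine hcc.integrable_of_hasCompactSupport ?_
    refine HasCompactSupport.intro (isCompact_Icc (a := -t) (b := t)) fun x hx => ?_
    have : max (t - |x|) 0 = 0 := by
      apply max_eq_right
      by_contra hc
      push Not at hc
      exact hx (abs_le.1 (by linarith))
    rw [this]; simp
  have hL : ∫⁻ r in Set.Ioi (0:ℝ), ENNReal.ofReal (r * avgc v r * AC (t / r)) = ENNReal.ofReal (Vv v t) := by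
    have h := polar_disc (fun r => ENNReal.ofReal ((2 * π)⁻¹ * AC (t / r))) (fun x => ENNReal.ofReal (v x))
      (by fun_prop) (by fun_prop)
    have e1 : ∫⁻ r in Set.Ioi (0:ℝ), ENNReal.ofReal (r * avgc v r * AC (t / r)) =
      ∫⁻ r in Set.Ioi (0:ℝ), ENNReal.ofReal r * ENNReal.ofReal ((2 * π)⁻¹ * AC (t / r)) * ∫⁻ θ in Set.Ioo (-π) π, ENNReal.ofReal (v (r * cos θ)) := by
      refine setLIntegral_congr_fun measurableSet_Ioi fun r hr => ?_
      have hr : 0 < r := hr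
      rw [avgc_lint v hv h0, ← ENNReal.ofReal_mul hr.le, ← ENNReal.ofReal_mul]
      · congr 1; field_simp
      · have := AC_nonneg (t / r); positivity
    rw [e1, h]
    have e2 : ∀ᵐ x : ℝ, ENNReal.ofReal (v x) * ∫⁻ y : ℝ, ENNReal.ofReal ((2 * π)⁻¹ * AC (t / √(x ^ 2 + y ^ 2)))
        = ENNReal.ofReal (v |x| * max (t - |x|) 0 / 2) := by
      have : ∀ᵐ x : ℝ, x ≠ 0 := by simp [ae_iff]
      filter_upwards [this] with x hx
      simp_rw [ENNReal.ofReal_mul (show 0 ≤ (2 * π)⁻¹ by positivity)]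
      rw [lintegral_const_mul, AC_int x t hx ht, ← ENNReal.ofReal_mul (by positivity), ← ENNReal.ofReal_mul (h0 x)]
      · congr 1
        have : v |x| = v x := by rcases abs_choice x with h | h <;> rw [h]; exact hev x
        rw [this]
        field_simp
      · exact ENNReal.measurable_ofReal.comp (AC_cont.measurable.comp (by fun_prop))
    rw [lintegral_congr_ae e2, ← ofReal_integral_eq_lintegral_ofReal hi]
    · congr 1
      rw [integral_comp_abs (f := fun x => v x * max (t - x) 0 / 2), Vv, intervalIntegral.integral_of_le ht.le,
        ← integral_const_mul]
      have e9 := setIntegral_eq_of_subset_of_forall_sdiff_eq_zero (μ := volume) measurableSet_Ioi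
        (s := Set.Ioc 0 t) (t := Set.Ioi 0) (f := fun x => 2 * (v x * max (t - x) 0 / 2)) ?_ ?_
      · rw [e9]
        refine setIntegral_congr_fun measurableSet_Ioc fun s hs => ?_
        rw [max_eq_left (by linarith [hs.2])]; ring
      · exact fun s hs => hs.1
      · intro s hs
        have h1 : 0 < s := hs.1
        have h2 : t < s := by
          by_contra hc; push Not at hc; exact hs.2 ⟨h1, hc⟩
        rw [max_eq_right (by linarith)]; simp
    · exact Eventually.of_forall fun x => by
        have := h0 |x|
        have h2 : 0 ≤ max (t - |x|) 0 := le_max_right _ _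
        simp only [Pi.zero_apply]; positivity
  have hnn : 0 ≤ᵐ[volume.restrict (Set.Ioi (0:ℝ))] fun r => r * avgc v r * AC (t / r) := by
    refine (ae_restrict_iff' measurableSet_Ioi).2 (Eventually.of_forall fun r hr => ?_)
    have hr : 0 < r := hr
    have := AC_nonneg (t / r)
    have := hVnn r
    simp only [Pi.zero_apply]; positivity
  have hms : AEStronglyMeasurable (fun r => r * avgc v r * AC (t / r)) (volume.restrict (Set.Ioi (0:ℝ))) := by
    refine Measurable.aestronglyMeasurable ?_
    have := (avgc_cont v hv).measurable
    fun_prop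
  have hVp : 0 ≤ Vv v t := by
    rw [Vv]
    refine intervalIntegral.integral_nonneg ht.le fun s hs => mul_nonneg (by linarith [hs.2]) (h0 s)
  refine ⟨⟨hms, ?_⟩, ?_⟩
  · rw [hasFiniteIntegral_iff_ofReal hnn, hL]; exact ENNReal.ofReal_lt_top
  · rw [integral_eq_lintegral_of_nonneg_ae hnn hms, hL, ENNReal.toReal_ofReal hVp]

/-- bounded compactly supported probability densities -/
structure Nice (g : ℝ → ℝ) (A M : ℝ) : Prop where
  meas : Measurable g
  nonneg : ∀ t, 0 ≤ g t
  le : ∀ t, g t ≤ M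
  supp : ∀ t, A < |t| → g t = 0
  one : ∫ t, g t = 1

/-- measure with density g -/
def dm (g : ℝ → ℝ) : Measure ℝ := volume.withDensity (fun x => ENNReal.ofReal (g x))

lemma Nice.int {g A M} (h : Nice g A M) : Integrable g := by
  by_contra hc
  have := integral_undef hc
  rw [h.one] at this; norm_num at this

lemma Nice.Mnn {g A M} (h : Nice g A M) : 0 ≤ M := (h.nonneg 0).trans (h.le 0)

lemma dm_integral (g : ℝ → ℝ) (hm : Measurable g) (h0 : ∀ t, 0 ≤ g t) (f : ℝ → ℝ) :
    ∫ x, f x ∂(dm g) = ∫ x, f x * g x := by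
  rw [dm, integral_withDensity_eq_integral_toReal_smul (by fun_prop) (Eventually.of_forall fun x => ENNReal.ofReal_lt_top)]
  refine integral_congr_ae (Eventually.of_forall fun x => ?_)
  simp only [smul_eq_mul, ENNReal.toReal_ofReal (h0 x)]; ring

lemma dm_integrable (g : ℝ → ℝ) (hm : Measurable g) (h0 : ∀ t, 0 ≤ g t) (f : ℝ → ℝ) :
    Integrable f (dm g) ↔ Integrable (fun x => f x * g x) := by
  rw [dm, integrable_withDensity_iff_integrable_smul' (by fun_prop) (Eventually.of_forall fun x => ENNReal.ofReal_lt_top)]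
  refine integrable_congr (Eventually.of_forall fun x => ?_)
  simp only [smul_eq_mul, ENNReal.toReal_ofReal (h0 x)]; ring

lemma Nice.prob {g A M} (h : Nice g A M) : IsProbabilityMeasure (dm g) := by
  constructor
  rw [dm, withDensity_apply _ MeasurableSet.univ, Measure.restrict_univ,
    ← ofReal_integral_eq_lintegral_ofReal h.int (Eventually.of_forall h.nonneg), h.one]
  simp

lemma Nice.int_of_bdd {g A M} (h : Nice g A M) (f : ℝ → ℝ) (hf : Measurable f) (B : ℝ)
    (hB : ∀ x, |x| ≤ A → |f x| ≤ B) : Integrable f (dm g) := by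
  rw [dm_integrable g h.meas h.nonneg]
  refine Integrable.mono' (h.int.const_mul B) (hf.mul h.meas).aestronglyMeasurable
    (Eventually.of_forall fun x => ?_)
  rw [norm_eq_abs, abs_mul, abs_of_nonneg (h.nonneg x)]
  by_cases hx : |x| ≤ A
  · exact mul_le_mul_of_nonneg_right (hB x hx) (h.nonneg x)
  · rw [h.supp x (not_le.1 hx)]; simp

lemma Nice.int_id {g A M} (h : Nice g A M) : Integrable (fun x : ℝ => x) (dm g) :=
  h.int_of_bdd _ measurable_id A (fun _ hx => hx)

/-- singular kernel -/
def ksing (u : ℝ) : ℝ := if |u| < 1 then |u| ^ (-(1/2) : ℝ) else 0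

lemma ksing_nonneg (u : ℝ) : 0 ≤ ksing u := by unfold ksing; split_ifs <;> positivity

lemma ksing_meas : Measurable ksing := by
  unfold ksing
  exact Measurable.ite (measurableSet_lt (by fun_prop) (by fun_prop)) (by fun_prop) (by fun_prop)

lemma rpow_le_ksing (u : ℝ) : |u| ^ (-(1/2) : ℝ) ≤ 1 + ksing u := by
  unfold ksing
  split_ifs with h
  · linarith
  · push Not at h
    rw [add_zero]
    exact rpow_le_one_of_one_le_of_nonpos h (by norm_num)

lemma ksing_int : Integrable ksing := by
  have h1 : IntegrableOn ksing (Set.Ioi 0) := by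
    have h2 : IntegrableOn (fun x : ℝ => x ^ (-(1/2) : ℝ)) (Set.Ioc 0 1) :=
      (intervalIntegrable_iff_integrableOn_Ioc_of_le zero_le_one).1
        (intervalIntegral.intervalIntegrable_rpow' (by norm_num))
    have h3 : IntegrableOn ksing (Set.Ioc 0 1) := by
      refine Integrable.mono' h2 ksing_meas.aestronglyMeasurable ?_
      refine (ae_restrict_iff' measurableSet_Ioc).2 (Eventually.of_forall fun x hx => ?_)
      rw [norm_eq_abs, abs_of_nonneg (ksing_nonneg x)]
      unfold ksing
      have : 0 < x := hx.1
      rw [abs_of_pos this]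
      split_ifs
      · exact le_rfl
      · positivity
    have h4 : IntegrableOn ksing (Set.Ioi 1) := by
      refine (integrableOn_zero (ε' := ℝ)).congr_fun ?_ measurableSet_Ioi
      intro x hx
      have : (1:ℝ) < x := hx
      simp only [ksing]
      rw [if_neg]
      rw [abs_of_pos (by linarith)]; linarith
    rw [← Set.Ioc_union_Ioi_eq_Ioi (zero_le_one (α := ℝ))]
    exact h3.union h4
  have h5 := (integrable_indicator_iff measurableSet_Ioi).2 h1
  refine (h5.add h5.comp_neg).congr (Eventually.of_forall fun x => ?_)
  simp only [Pi.add_apply, Set.indicator, Set.mem_Ioi]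
  rcases lt_trichotomy x 0 with hx | hx | hx
  · rw [if_neg (by linarith), if_pos (by linarith)]; simp [ksing]
  · rw [hx]; simp [ksing]
  · rw [if_pos (by linarith), if_neg (by linarith)]; simp

/-- constant -/
def K0 : ℝ := ∫ u, ksing u

lemma K0_nonneg : 0 ≤ K0 := integral_nonneg ksing_nonneg

lemma abs_log_le (u : ℝ) : |(log |u|)| ≤ 2 * (1 + ksing u + |u|) := by
  by_cases hu : u = 0
  · rw [hu]; simp; have := ksing_nonneg 0; linarith
  have hp : 0 < |u| := abs_pos.2 hu
  have h1 : log |u| ≤ |u| := (log_le_sub_one_of_pos hp).trans (by linarith)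
  have h2 : -log |u| ≤ 2 * (1 + ksing u) := by
    have h3 := log_le_sub_one_of_pos (x := |u| ^ (-(1/2) : ℝ)) (by positivity)
    rw [log_rpow hp] at h3
    have := rpow_le_ksing u
    linarith
  have := ksing_nonneg u
  rw [abs_le]; constructor <;> linarith

lemma Nice.ksing_int {g A M} (h : Nice g A M) (t : ℝ) :
    Integrable (fun s => ksing (t - s)) (dm g) ∧ ∫ s, ksing (t - s) ∂(dm g) ≤ M * K0 := by
  have hk : Integrable (fun s => ksing (t - s)) := _root_.ksing_int.comp_sub_left t
  have hle : ∀ s, ksing (t - s) * g s ≤ M * ksing (t - s) := fun s => by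
    rw [mul_comm M]; exact mul_le_mul_of_nonneg_left (h.le s) (ksing_nonneg _)
  have hi : Integrable (fun s => ksing (t - s) * g s) := by
    refine Integrable.mono' (hk.const_mul M) ?_ (Eventually.of_forall fun s => ?_)
    · exact (hk.aestronglyMeasurable).mul h.meas.aestronglyMeasurable
    · rw [norm_eq_abs, abs_of_nonneg (mul_nonneg (ksing_nonneg _) (h.nonneg _))]
      exact hle s
  refine ⟨(dm_integrable g h.meas h.nonneg _).2 hi, ?_⟩
  rw [dm_integral g h.meas h.nonneg]
  refine (integral_mono hi (hk.const_mul M) hle).trans (le_of_eq ?_)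
  rw [integral_const_mul, integral_sub_left_eq_self (fun x => ksing x) volume t, K0]

/-- admissible kernels are integrable -/
lemma Nice.ker_int {g A M} (h : Nice g A M) (k : ℝ → ℝ) (hk : Measurable k) (C : ℝ)
    (hC : ∀ u, |k u| ≤ C * (1 + ksing u + |u|)) (t : ℝ) : Integrable (fun s => k (t - s)) (dm g) := by
  have := h.prob
  refine Integrable.mono' ((((integrable_const (1:ℝ)).add (h.ksing_int t).1).add
    ((integrable_const t).sub h.int_id).abs).const_mul C) ?_ (Eventually.of_forall fun s => hC _)
  exact (hk.comp (by fun_prop)).aestronglyMeasurable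

lemma Nice.ker_int_prod {g A M} (h : Nice g A M) (k : ℝ → ℝ) (hk : Measurable k) (C : ℝ)
    (hC : ∀ u, |k u| ≤ C * (1 + ksing u + |u|)) (μ : Measure ℝ) [IsProbabilityMeasure μ]
    (hμ : Integrable (fun x : ℝ => x) μ) :
    Integrable (fun p : ℝ × ℝ => k (p.1 - p.2)) (μ.prod (dm g)) := by
  have := h.prob
  have hs : Integrable (fun p : ℝ × ℝ => ksing (p.1 - p.2)) (μ.prod (dm g)) := by
    have hm : AEStronglyMeasurable (fun p : ℝ × ℝ => ksing (p.1 - p.2)) (μ.prod (dm g)) :=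
      (ksing_meas.comp (by fun_prop)).aestronglyMeasurable
    refine (integrable_prod_iff hm).2 ⟨Eventually.of_forall fun x => (h.ksing_int x).1, ?_⟩
    refine Integrable.of_bound (C := M * K0) hm.norm.integral_prod_right' (Eventually.of_forall fun x => ?_)
    have e : ∀ s, ‖ksing (x - s)‖ = ksing (x - s) := fun s => abs_of_nonneg (ksing_nonneg _)
    simp only [e]
    rw [norm_eq_abs, abs_of_nonneg (integral_nonneg fun s => ksing_nonneg _)]
    exact (h.ksing_int x).2
  refine Integrable.mono' ((((integrable_const (1:ℝ)).add hs).add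
    ((hμ.comp_fst (dm g)).sub (h.int_id.comp_snd μ)).abs).const_mul C) ?_ (Eventually.of_forall fun s => hC _)
  exact (hk.comp (by fun_prop)).aestronglyMeasurable

lemma dm_ae_ne {g : ℝ → ℝ} (t : ℝ) : ∀ᵐ s ∂(dm g), t - s ≠ 0 := by
  have : ∀ᵐ s : ℝ, t - s ≠ 0 := by
    have : {s : ℝ | ¬ (t - s ≠ 0)} = {t} := by
      ext s; simp [sub_eq_zero, eq_comm]
    rw [ae_iff, this]; simp
  exact (withDensity_absolutelyContinuous _ _).ae_le this

/-- the equilibrium density -/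
def gd (v : ℝ → ℝ) (a x : ℝ) : ℝ :=
  (2 * π)⁻¹ * ∫ y in (-√(a ^ 2 - x ^ 2))..(√(a ^ 2 - x ^ 2)), avgc v (√(x ^ 2 + y ^ 2))

lemma gd_cont (v : ℝ → ℝ) (hv : Continuous v) (a : ℝ) : Continuous (gd v a) := by
  have hA := avgc_cont v hv
  unfold gd
  have hcx : ∀ x : ℝ, Continuous fun y : ℝ => avgc v (√(x ^ 2 + y ^ 2)) := fun x => by fun_prop
  have e : ∀ x : ℝ, ∫ y in (-√(a ^ 2 - x ^ 2))..(√(a ^ 2 - x ^ 2)), avgc v (√(x ^ 2 + y ^ 2))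
      = (∫ y in (0:ℝ)..(√(a ^ 2 - x ^ 2)), avgc v (√(x ^ 2 + y ^ 2)))
        - ∫ y in (0:ℝ)..(-√(a ^ 2 - x ^ 2)), avgc v (√(x ^ 2 + y ^ 2)) := fun x =>
    (intervalIntegral.integral_interval_sub_left ((hcx x).intervalIntegrable _ _) ((hcx x).intervalIntegrable _ _)).symm
  simp_rw [e]
  refine continuous_const.mul (Continuous.sub ?_ ?_)
  · exact intervalIntegral.continuous_parametric_intervalIntegral_of_continuous
      (f := fun x y => avgc v (√(x ^ 2 + y ^ 2))) (by fun_prop) (by fun_prop)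
  · exact intervalIntegral.continuous_parametric_intervalIntegral_of_continuous
      (f := fun x y => avgc v (√(x ^ 2 + y ^ 2))) (by fun_prop) (by fun_prop)

lemma gd_even (v : ℝ → ℝ) (a x : ℝ) : gd v a (-x) = gd v a x := by simp [gd]

lemma gd_nonneg (v : ℝ → ℝ) (hv : Continuous v) (h0 : ∀ t, 0 ≤ v t) (a x : ℝ) : 0 ≤ gd v a x := by
  unfold gd
  have hpi := pi_pos
  refine mul_nonneg (by positivity) (intervalIntegral.integral_nonneg ?_ fun y _ => avgc_ge v hv 0 h0 _)
  have := sqrt_nonneg (a ^ 2 - x ^ 2); linarith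

lemma gd_zero (v : ℝ → ℝ) (a x : ℝ) (ha : 0 < a) (hx : a ≤ |x|) : gd v a x = 0 := by
  unfold gd
  have : a ^ 2 - x ^ 2 ≤ 0 := by rw [← sq_abs x]; nlinarith
  rw [sqrt_eq_zero_of_nonpos this]; simp

lemma gd_pos (v : ℝ → ℝ) (hv : Continuous v) (c : ℝ) (hc : 0 < c) (h0 : ∀ t, c ≤ v t) (a x : ℝ)
    (hx : |x| < a) : 0 < gd v a x := by
  unfold gd
  have hpi := pi_pos
  have hA := avgc_cont v hv
  have h1 : 0 < √(a ^ 2 - x ^ 2) := by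
    apply sqrt_pos.2; rw [← sq_abs x]; have := abs_nonneg x; nlinarith
  refine mul_pos (by positivity) (intervalIntegral.intervalIntegral_pos_of_pos ?_ ?_ (by linarith))
  · exact (by fun_prop : Continuous fun y : ℝ => avgc v (√(x ^ 2 + y ^ 2))).intervalIntegrable _ _
  · exact fun y => hc.trans_le (avgc_ge v hv c h0 _)

lemma avgc_le (v : ℝ → ℝ) (hv : Continuous v) (r B : ℝ) (hr : 0 ≤ r) (hB : ∀ t, |t| ≤ r → v t ≤ B) :
    avgc v r ≤ B := by
  unfold avgc
  have hpi := pi_pos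
  have h : ∫ θ in (-π)..π, v (r * cos θ) ≤ ∫ θ in (-π)..π, B :=
    intervalIntegral.integral_mono_on (by linarith) 
      ((by fun_prop : Continuous fun θ => v (r * cos θ)).intervalIntegrable _ _) (by simp) (fun θ _ => hB _ (by
        rw [abs_mul, abs_of_nonneg hr]
        exact mul_le_of_le_one_right hr (abs_cos_le_one θ)))
  simp at h
  rw [inv_mul_eq_div, div_le_iff₀ (by positivity)]
  linarith

lemma gd_le (v : ℝ → ℝ) (hv : Continuous v) (a x B : ℝ) (ha : 0 < a) (hB0 : 0 ≤ B)
    (hB : ∀ t, |t| ≤ a → v t ≤ B) : gd v a x ≤ a * B := by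
  unfold gd
  have hpi := pi_gt_three
  have hA := avgc_cont v hv
  have hY0 := sqrt_nonneg (a ^ 2 - x ^ 2)
  have hYa : √(a ^ 2 - x ^ 2) ≤ a := by
    apply sqrt_le_iff.2 ⟨ha.le, by nlinarith⟩
  have h : ∫ y in (-√(a ^ 2 - x ^ 2))..(√(a ^ 2 - x ^ 2)), avgc v (√(x ^ 2 + y ^ 2))
      ≤ ∫ y in (-√(a ^ 2 - x ^ 2))..(√(a ^ 2 - x ^ 2)), B := by
    refine intervalIntegral.integral_mono_on_of_le_Ioo (by linarith)
      ((by fun_prop : Continuous fun y : ℝ => avgc v (√(x ^ 2 + y ^ 2))).intervalIntegrable _ _) (by simp) ?_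
    intro y hy
    refine avgc_le v hv _ _ (sqrt_nonneg _) fun t ht => hB t (ht.trans ?_)
    apply sqrt_le_iff.2 ⟨ha.le, ?_⟩
    have h1 := abs_lt.2 hy
    have h2 := (lt_sqrt (abs_nonneg y)).1 h1
    rw [sq_abs] at h2; linarith
  simp at h
  rw [inv_mul_eq_div, div_le_iff₀ (by positivity)]
  have : √(a ^ 2 - x ^ 2) * B ≤ a * B := mul_le_mul_of_nonneg_right hYa hB0
  have h3 : 0 ≤ a * B := by positivity
  nlinarith

/-- radial weight -/
def Gr (v : ℝ → ℝ) (a r : ℝ) : ENNReal := (Set.Iio a).indicator (fun r => ENNReal.ofReal ((2 * π)⁻¹ * avgc v r)) r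

lemma Gr_meas (v : ℝ → ℝ) (hv : Continuous v) (a : ℝ) : Measurable (Gr v a) := by
  have := (avgc_cont v hv).measurable
  exact Measurable.indicator (by fun_prop) measurableSet_Iio

lemma Gr_gd (v : ℝ → ℝ) (hv : Continuous v) (h0 : ∀ t, 0 ≤ v t) (a x : ℝ) (ha : 0 < a) :
    ∫⁻ y : ℝ, Gr v a (√(x ^ 2 + y ^ 2)) = ENNReal.ofReal (gd v a x) := by
  have hpi := pi_pos
  have hA := avgc_cont v hv
  have hY0 := sqrt_nonneg (a ^ 2 - x ^ 2)
  unfold gd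
  rw [intervalIntegral.integral_of_le (by linarith), integral_Ioc_eq_integral_Ioo, ← integral_const_mul,
    ofReal_integral_eq_lintegral_ofReal, ← lintegral_indicator measurableSet_Ioo]
  · refine lintegral_congr fun y => ?_
    have hiff : √(x ^ 2 + y ^ 2) < a ↔ y ∈ Set.Ioo (-√(a ^ 2 - x ^ 2)) (√(a ^ 2 - x ^ 2)) := by
      rw [sqrt_lt' ha, Set.mem_Ioo, ← abs_lt, lt_sqrt (abs_nonneg y), sq_abs]
      constructor <;> intro h <;> linarith
    unfold Gr Set.indicator
    simp only [Set.mem_Iio, hiff]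
  · exact ((by fun_prop : Continuous fun y : ℝ => (2 * π)⁻¹ * avgc v (√(x ^ 2 + y ^ 2))).integrableOn_Icc).mono_set Set.Ioo_subset_Icc_self
  · exact Eventually.of_forall fun y => mul_nonneg (by positivity) (avgc_ge v hv 0 h0 _)

lemma gd_measure (v : ℝ → ℝ) (hv : Continuous v) (h0 : ∀ t, 0 ≤ v t) (a : ℝ) (ha : 0 < a) :
    dm (gd v a) = Measure.map (fun p : ℝ × ℝ => p.1 * cos p.2)
      (((volume.restrict (Set.Ioi 0)).withDensity (fun r => ENNReal.ofReal r * Gr v a r)).prod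
        (volume.restrict (Set.Ioo (-π) π))) := by
  have hG := Gr_meas v hv a
  have hgm := (gd_cont v hv a).measurable
  have hmm : Measurable (fun p : ℝ × ℝ => p.1 * cos p.2) := by fun_prop
  refine Measure.ext_of_lintegral _ fun φ hφ => ?_
  rw [lintegral_map hφ hmm, lintegral_prod (fun p : ℝ × ℝ => φ (p.1 * cos p.2)) (hφ.comp hmm).aemeasurable, lintegral_withDensity_eq_lintegral_mul _ (by fun_prop)]
  · have h := polar_disc (Gr v a) φ hG hφ
    simp only [Pi.mul_apply] 
    rw [h, dm, lintegral_withDensity_eq_lintegral_mul _ (by fun_prop) hφ]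
    refine lintegral_congr fun x => ?_
    rw [Gr_gd v hv h0 a x ha]
    simp only [Pi.mul_apply]; ring
  · exact (hφ.comp hmm).lintegral_prod_right' 

lemma gd_radial (v : ℝ → ℝ) (hv : Continuous v) (h0 : ∀ t, 0 ≤ v t) (a : ℝ) (ha : 0 < a) (φ : ℝ → ℝ)
    (hφ : Measurable φ) (hi : Integrable φ (dm (gd v a))) :
    IntegrableOn (fun r => r * avgc v r * ((2 * π)⁻¹ * ∫ θ in Set.Ioo (-π) π, φ (r * cos θ))) (Set.Ioo 0 a) ∧
    ∫ r in Set.Ioo 0 a, r * avgc v r * ((2 * π)⁻¹ * ∫ θ in Set.Ioo (-π) π, φ (r * cos θ)) = ∫ x, φ x ∂(dm (gd v a)) := by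
  have hG := Gr_meas v hv a
  have hpi := pi_pos
  have hmm : Measurable (fun p : ℝ × ℝ => p.1 * cos p.2) := by fun_prop
  rw [gd_measure v hv h0 a ha] at hi ⊢
  rw [integral_map hmm.aemeasurable hφ.aestronglyMeasurable]
  rw [integrable_map_measure hφ.aestronglyMeasurable hmm.aemeasurable] at hi
  have hfin : ∀ᵐ r ∂(volume.restrict (Set.Ioi (0:ℝ))), ENNReal.ofReal r * Gr v a r < ⊤ := by
    refine Eventually.of_forall fun r => ENNReal.mul_lt_top ENNReal.ofReal_lt_top ?_
    unfold Gr Set.indicator; split_ifs <;> simp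
  have hmd : Measurable fun r => ENNReal.ofReal r * Gr v a r := by fun_prop
  have hsf : SFinite ((volume.restrict (Set.Ioi (0:ℝ))).withDensity (fun r => ENNReal.ofReal r * Gr v a r)) := inferInstance
  rw [integral_prod (fun p : ℝ × ℝ => φ (p.1 * cos p.2)) hi, integral_withDensity_eq_integral_toReal_smul hmd hfin]
  have hi2 := hi.integral_prod_left
  rw [integrable_withDensity_iff_integrable_smul' hmd hfin] at hi2
  have key : ∀ r : ℝ, 0 < r → (ENNReal.ofReal r * Gr v a r).toReal • (∫ θ in Set.Ioo (-π) π, φ (r * cos θ))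
      = (Set.Ioo 0 a).indicator (fun r => r * avgc v r * ((2 * π)⁻¹ * ∫ θ in Set.Ioo (-π) π, φ (r * cos θ))) r := by
    intro r hr
    unfold Gr Set.indicator
    simp only [Set.mem_Iio, Set.mem_Ioo, hr, true_and]
    split_ifs
    · rw [← ENNReal.ofReal_mul hr.le, ENNReal.toReal_ofReal, smul_eq_mul]
      · ring
      · have := avgc_ge v hv 0 h0 r; positivity
    · simp
  have hsub : Set.Ioi (0:ℝ) ∩ Set.Ioo 0 a = Set.Ioo 0 a := by ext r; simp
  constructor
  · have h3 : IntegrableOn ((Set.Ioo 0 a).indicator (fun r => r * avgc v r * ((2 * π)⁻¹ * ∫ θ in Set.Ioo (-π) π, φ (r * cos θ)))) (Set.Ioi 0) :=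
      IntegrableOn.congr_fun (f := fun r => (ENNReal.ofReal r * Gr v a r).toReal • (∫ θ in Set.Ioo (-π) π, φ (r * cos θ)))
        hi2 (fun r hr => key r hr) measurableSet_Ioi
    have h4 := (integrable_indicator_iff (μ := volume.restrict (Set.Ioi (0:ℝ))) measurableSet_Ioo).1 h3
    rw [IntegrableOn, Measure.restrict_restrict measurableSet_Ioo, Set.inter_comm, hsub] at h4
    exact h4
  · rw [setIntegral_congr_fun measurableSet_Ioi (fun r hr => key r hr), setIntegral_indicator measurableSet_Ioo, hsub]

/-- log potential -/
def Pot (g : ℝ → ℝ) (t : ℝ) : ℝ := ∫ s, log |t - s| ∂(dm g)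

lemma log_meas : Measurable (fun u : ℝ => log |u|) := by fun_prop

lemma gd_mass (v : ℝ → ℝ) (hv : Continuous v) (h0 : ∀ t, 0 ≤ v t) (a : ℝ) (ha : 0 < a) :
    ∫ x, gd v a x = ∫ r in (0:ℝ)..a, r * avgc v r := by
  have hgm := (gd_cont v hv a).measurable
  have hpi := pi_pos
  have hg0 := gd_nonneg v hv h0 a
  have hintg : Integrable (gd v a) := by
    refine (gd_cont v hv a).integrable_of_hasCompactSupport
      (HasCompactSupport.intro (isCompact_Icc (a := -a) (b := a)) fun x hx => gd_zero v a x ha ?_)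
    by_contra hc
    push Not at hc
    exact hx (abs_le.1 hc.le)
  have h := gd_radial v hv h0 a ha (fun _ => 1) measurable_const
    ((dm_integrable _ hgm hg0 _).2 (by simpa using hintg))
  rw [dm_integral _ hgm hg0] at h
  have h2 := h.2
  simp only [one_mul] at h2
  rw [← h2, intervalIntegral.integral_of_le ha.le, integral_Ioc_eq_integral_Ioo]
  refine setIntegral_congr_fun measurableSet_Ioo fun r hr => ?_
  simp
  rw [max_eq_left (by linarith)]
  field_simp
  norm_num

theorem equil0 (c : ℝ) (hc : 0 < c) (v : ℝ → ℝ) (hv : Continuous v) (hcv : ∀ t, c ≤ v t)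
    (hev : ∀ t, v (-t) = v t) :
    ∃ a : ℝ, 0 < a ∧ a ^ 2 ≤ 2 / c ∧ ∫ x, gd v a x = 1 ∧
      ∃ ℓ : ℝ, (∀ t, |t| ≤ a → Vv v t - Pot (gd v a) t = ℓ) ∧ (∀ t, ℓ ≤ Vv v t - Pot (gd v a) t) := by
  have h0 : ∀ t, 0 ≤ v t := fun t => hc.le.trans (hcv t)
  have hA := avgc_cont v hv
  have hpi := pi_pos
  -- choice of a
  have hci : ∀ x y, IntervalIntegrable (fun r => r * avgc v r) volume x y := fun x y =>
    (by fun_prop : Continuous fun r => r * avgc v r).intervalIntegrable _ _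
  obtain ⟨a, ha, ha2, hmass⟩ : ∃ a : ℝ, 0 < a ∧ a ^ 2 ≤ 2 / c ∧ ∫ r in (0:ℝ)..a, r * avgc v r = 1 := by
    have hcont : Continuous fun a => ∫ r in (0:ℝ)..a, r * avgc v r :=
      intervalIntegral.continuous_primitive hci 0
    have hb0 : 0 ≤ √(2 / c) := sqrt_nonneg _
    have hbs : √(2 / c) ^ 2 = 2 / c := sq_sqrt (by positivity)
    have hge : 1 ≤ ∫ r in (0:ℝ)..√(2 / c), r * avgc v r := by
      have : ∫ r in (0:ℝ)..√(2 / c), r * c ≤ ∫ r in (0:ℝ)..√(2 / c), r * avgc v r := by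
        refine intervalIntegral.integral_mono_on hb0 ((by fun_prop : Continuous fun r : ℝ => r * c).intervalIntegrable _ _)
          (hci _ _) fun r hr => mul_le_mul_of_nonneg_left (avgc_ge v hv c hcv r) hr.1
      rw [intervalIntegral.integral_mul_const, integral_id, hbs] at this
      refine le_trans (le_of_eq ?_) this
      field_simp; norm_num
    obtain ⟨a, ha, h1⟩ := intermediate_value_Icc hb0 hcont.continuousOn (show (1:ℝ) ∈ Set.Icc _ _ from
      ⟨by simp, hge⟩)
    refine ⟨a, lt_of_le_of_ne ha.1 ?_, ?_, h1⟩
    · rintro rfl; simp at h1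
    · rw [← hbs]; exact pow_le_pow_left₀ ha.1 ha.2 2
  refine ⟨a, ha, ha2, by rw [gd_mass v hv h0 a ha, hmass], ?_⟩
  obtain ⟨B, hB⟩ : ∃ B, ∀ t, |t| ≤ a → v t ≤ B := by
    obtain ⟨B, hB⟩ := (isCompact_Icc (a := -a) (b := a)).bddAbove_image hv.continuousOn
    exact ⟨B, fun t ht => hB ⟨t, abs_le.1 ht, rfl⟩⟩
  have hB0 : 0 ≤ B := (h0 0).trans (hB 0 (by simpa using ha.le))
  have hN : Nice (gd v a) a (a * B) :=
    ⟨(gd_cont v hv a).measurable, gd_nonneg v hv h0 a, fun x => gd_le v hv a x B ha hB0 hB,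
      fun t ht => gd_zero v a t ha ht.le, by rw [gd_mass v hv h0 a ha, hmass]⟩
  have hrad : ∀ t, IntegrableOn (fun r => r * avgc v r * (log (r / 2) + AC (t / r))) (Set.Ioo 0 a) ∧
      ∫ r in Set.Ioo 0 a, r * avgc v r * (log (r / 2) + AC (t / r)) = Pot (gd v a) t := by
    intro t
    have h := gd_radial v hv h0 a ha (fun s => log |t - s|) (by fun_prop)
      (hN.ker_int _ log_meas 2 abs_log_le t)
    have e : Set.EqOn (fun r => r * avgc v r * ((2 * π)⁻¹ * ∫ θ in Set.Ioo (-π) π, log |t - r * cos θ|))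
        (fun r => r * avgc v r * (log (r / 2) + AC (t / r))) (Set.Ioo 0 a) := by
      intro r hr
      simp only
      rw [(circ_log r t hr.1).2]
    exact ⟨h.1.congr_fun e measurableSet_Ioo, by rw [← setIntegral_congr_fun measurableSet_Ioo e, h.2, Pot]⟩
  have hL : IntegrableOn (fun r => r * avgc v r * log (r / 2)) (Set.Ioo 0 a) := by
    have := (hrad 0).1
    simpa [AC_zero] using this
  have hab : ∀ t, IntegrableOn (fun r => r * avgc v r * AC (t / r)) (Set.Ioi 0) ∧
      ∫ r in Set.Ioi (0:ℝ), r * avgc v r * AC (t / r) = Vv v t := by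
    intro t
    rcases eq_or_ne t 0 with rfl | ht
    · simp [AC_zero, Vv]
    · have h := abel v hv h0 hev |t| (abs_pos.2 ht)
      rw [Vv_abs v hev] at h
      have : ∀ r, AC (|t| / r) = AC (t / r) := fun r => by
        unfold AC; rw [abs_div, abs_div, abs_abs]
      simpa only [this] using h
  have hP : ∀ t, Pot (gd v a) t = (∫ r in Set.Ioo 0 a, r * avgc v r * log (r / 2))
      + ∫ r in Set.Ioo 0 a, r * avgc v r * AC (t / r) := by
    intro t
    rw [← (hrad t).2]
    simp_rw [mul_add]
    rw [integral_add hL ((hab t).1.mono_set Set.Ioo_subset_Ioi_self)]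
  refine ⟨-∫ r in Set.Ioo 0 a, r * avgc v r * log (r / 2), fun t ht => ?_, fun t => ?_⟩
  · rw [hP, ← (hab t).2]
    have := setIntegral_eq_of_subset_of_forall_sdiff_eq_zero (μ := volume) measurableSet_Ioi
        (s := Set.Ioo 0 a) (t := Set.Ioi 0) (f := fun r => r * avgc v r * AC (t / r)) Set.Ioo_subset_Ioi_self ?_
    · rw [this]; ring
    · intro r hr
      have h1 : 0 < r := hr.1
      have h2 : a ≤ r := by by_contra h; push Not at h; exact hr.2 ⟨h1, h⟩
      rw [AC_zero, mul_zero]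
      rw [abs_div, abs_of_pos h1, div_le_one h1]; linarith
  · rw [hP, ← (hab t).2]
    have : ∫ r in Set.Ioo 0 a, r * avgc v r * AC (t / r) ≤ ∫ r in Set.Ioi (0:ℝ), r * avgc v r * AC (t / r) := by
      refine setIntegral_mono_set (hab t).1 ?_ (Eventually.of_forall Set.Ioo_subset_Ioi_self)
      refine (ae_restrict_iff' measurableSet_Ioi).2 (Eventually.of_forall fun r hr => ?_)
      have hr : 0 < r := hr
      have := AC_nonneg (t / r)
      have := avgc_ge v hv 0 h0 r
      simp only [Pi.zero_apply]; positivity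
    linarith

/-- bilinear pairing -/
def BB (k : ℝ → ℝ) (μ ν : Measure ℝ) : ℝ := ∫ p : ℝ × ℝ, k (p.1 - p.2) ∂(μ.prod ν)

/-- quadratic form -/
def qd (k : ℝ → ℝ) (μ ν : Measure ℝ) : ℝ := BB k μ μ - 2 * BB k μ ν + BB k ν ν

/-- minus log -/
def nl (u : ℝ) : ℝ := -log |u|

lemma nl_meas : Measurable nl := by unfold nl; fun_prop

lemma nl_bd (u : ℝ) : |nl u| ≤ 2 * (1 + ksing u + |u|) := by
  unfold nl; rw [abs_neg]; exact abs_log_le u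

lemma Lk_meas (ε : ℝ) : Measurable (Lk ε) := by unfold Lk; fun_prop

lemma Lk_abs_le (ε : ℝ) (hε : 0 < ε) (u : ℝ) : |Lk ε u| ≤ |u| / ε := by
  unfold Lk
  have h1 : 0 ≤ log (1 + u ^ 2 / ε ^ 2) := by
    have : 0 ≤ u ^ 2 / ε ^ 2 := by positivity
    exact log_nonneg (by linarith)
  rw [abs_mul, abs_of_nonneg h1]
  have h2 : 1 + u ^ 2 / ε ^ 2 ≤ (1 + |u| / ε) ^ 2 := by
    have : 0 ≤ |u| / ε := by positivity
    have e : u ^ 2 / ε ^ 2 = (|u| / ε) ^ 2 := by rw [div_pow, sq_abs]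
    rw [e]; nlinarith
  have h3 := log_le_log (by positivity) h2
  rw [log_pow] at h3
  have h4 := log_le_sub_one_of_pos (x := 1 + |u| / ε) (by positivity)
  norm_num
  norm_num at h3
  linarith

lemma Lk_bd (ε : ℝ) (hε : 0 < ε) (u : ℝ) : |Lk ε u| ≤ ε⁻¹ * (1 + ksing u + |u|) := by
  refine (Lk_abs_le ε hε u).trans ?_
  rw [div_eq_inv_mul]
  have := ksing_nonneg u
  exact mul_le_mul_of_nonneg_left (by linarith) (by positivity)

lemma BB_int_fst {k : ℝ → ℝ} {μ ν : Measure ℝ} [SFinite μ] [SFinite ν] 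
    (h : Integrable (fun p : ℝ × ℝ => k (p.1 - p.2)) (μ.prod ν)) :
    BB k μ ν = ∫ x, ∫ y, k (x - y) ∂ν ∂μ := integral_prod _ h

lemma prod_ae_ne (μ : Measure ℝ) [SFinite μ] {g : ℝ → ℝ} [SFinite (dm g)] :
    ∀ᵐ p : ℝ × ℝ ∂(μ.prod (dm g)), p.1 - p.2 ≠ 0 := by
  refine (Measure.ae_prod_iff_ae_ae ?_).2 (Eventually.of_forall fun x => dm_ae_ne x)
  exact (measurableSet_eq_fun (by fun_prop) (by fun_prop)).compl

lemma cross_le {g A M} (h : Nice g A M) (ε : ℝ) (hε : 0 < ε) (μ : Measure ℝ) [IsProbabilityMeasure μ]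
    (hμ : Integrable (fun x : ℝ => x) μ) :
    BB nl μ (dm g) ≤ BB (Lk ε) μ (dm g) - log ε + 2 * √ε * (1 + M * K0) := by
  have := h.prob
  have i1 := h.ker_int_prod nl nl_meas 2 nl_bd μ hμ
  have i2 := h.ker_int_prod (Lk ε) (Lk_meas ε) _ (Lk_bd ε hε) μ hμ
  have i3 := h.ker_int_prod ksing ksing_meas 1 (fun u => by
    rw [abs_of_nonneg (ksing_nonneg u)]; have := abs_nonneg u; linarith) μ hμ
  have h1 : BB ksing μ (dm g) ≤ M * K0 := by
    rw [BB_int_fst i3]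
    have := integral_mono i3.integral_prod_left (integrable_const (M * K0)) (fun x => (h.ksing_int x).2)
    simpa using this
  have h2 : BB nl μ (dm g) ≤ ∫ p : ℝ × ℝ, (Lk ε (p.1 - p.2) - log ε + 2 * √ε * (1 + ksing (p.1 - p.2))) ∂(μ.prod (dm g)) := by
    refine integral_mono_ae i1 ((i2.sub (integrable_const _)).add (((integrable_const _).add i3).const_mul _)) ?_
    filter_upwards [prod_ae_ne μ (g := g)] with p hp
    refine (neg_log_le_Lk ε _ hε hp).trans ?_
    have := rpow_le_ksing (p.1 - p.2)
    have := mul_le_mul_of_nonneg_left this (show 0 ≤ 2 * √ε by positivity)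
    linarith
  rw [integral_add (f := fun p : ℝ × ℝ => Lk ε (p.1 - p.2) - log ε) (g := fun p : ℝ × ℝ => 2 * √ε * (1 + ksing (p.1 - p.2)))
    (i2.sub (integrable_const _)) (((integrable_const _).add i3).const_mul _),
    integral_sub i2 (integrable_const _), integral_const_mul, integral_add (integrable_const _) i3] at h2
  simp only [integral_const, smul_eq_mul, probReal_univ, one_mul] at h2
  unfold BB at h1 ⊢
  unfold BB at h2
  have := mul_le_mul_of_nonneg_left h1 (show 0 ≤ 2 * √ε by positivity)
  linarith

lemma self_ge {g A M} (h : Nice g A M) (ε : ℝ) (hε : 0 < ε) :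
    BB (Lk ε) (dm g) (dm g) - log ε ≤ BB nl (dm g) (dm g) := by
  have := h.prob
  have i1 := h.ker_int_prod nl nl_meas 2 nl_bd (dm g) h.int_id
  have i2 := h.ker_int_prod (Lk ε) (Lk_meas ε) _ (Lk_bd ε hε) (dm g) h.int_id
  have h2 : ∫ p : ℝ × ℝ, (Lk ε (p.1 - p.2) - log ε) ∂((dm g).prod (dm g)) ≤ BB nl (dm g) (dm g) := by
    refine integral_mono_ae (i2.sub (integrable_const _)) i1 ?_
    filter_upwards [prod_ae_ne (dm g) (g := g)] with p hp
    exact neg_log_ge_Lk ε _ hε hp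
  rw [integral_sub i2 (integrable_const _)] at h2
  simpa [BB] using h2

/-- regularised log distance -/
def we (ε : ℝ) (μ ν : Measure ℝ) : ℝ := ∫ ω in Set.Ioi (0:ℝ), wE ε ω * ‖charFun μ ω - charFun ν ω‖ ^ 2

lemma qd_nl_ge {g1 A1 M1 g2 A2 M2} (h1 : Nice g1 A1 M1) (h2 : Nice g2 A2 M2) (ε : ℝ) (hε : 0 < ε) :
    we ε (dm g1) (dm g2) ≤ qd nl (dm g1) (dm g2) + 4 * √ε * (1 + M2 * K0) := by
  have := h1.prob
  have := h2.prob
  have a1 := self_ge h1 ε hε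
  have a2 := self_ge h2 ε hε
  have a3 := cross_le h2 ε hε (dm g1) h1.int_id
  have a4 := (Lk_quad ε hε (dm g1) (dm g2) h1.int_id h2.int_id).2
  unfold we qd
  rw [← a4]
  unfold BB at *
  linarith

/-- h-distance squared -/
def hd (κ : ℝ → ℝ) (μ ν : Measure ℝ) : ℝ := ∫ ω : ℝ, κ ω * ‖charFun μ ω - charFun ν ω‖ ^ 2

lemma charFun_sub_le (μ ν : Measure ℝ) [IsProbabilityMeasure μ] [IsProbabilityMeasure ν] (ω : ℝ) :
    ‖charFun μ ω - charFun ν ω‖ ^ 2 ≤ 4 := by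
  have h : ‖charFun μ ω - charFun ν ω‖ ≤ 2 := (norm_sub_le _ _).trans (by
    have := norm_charFun_le_one (μ := μ) ω
    have := norm_charFun_le_one (μ := ν) ω
    linarith)
  have := norm_nonneg (charFun μ ω - charFun ν ω)
  nlinarith

lemma charFun_diff_meas (μ ν : Measure ℝ) [IsProbabilityMeasure μ] [IsProbabilityMeasure ν] :
    Measurable (fun ω => ‖charFun μ ω - charFun ν ω‖ ^ 2) := by
  have h1 := (measurable_charFun (μ := μ))
  have h2 := (measurable_charFun (μ := ν))
  fun_prop

lemma hd_int (κ : ℝ → ℝ) (hκ : Integrable κ) (μ ν : Measure ℝ) [IsProbabilityMeasure μ] [IsProbabilityMeasure ν] :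
    Integrable (fun ω => κ ω * ‖charFun μ ω - charFun ν ω‖ ^ 2) := by
  refine hκ.mul_bdd (c := 4) (charFun_diff_meas μ ν).aestronglyMeasurable (Eventually.of_forall fun ω => ?_)
  rw [norm_eq_abs, abs_of_nonneg (by positivity)]
  exact charFun_sub_le μ ν ω

lemma charFun_diff_abs (μ ν : Measure ℝ) (ω : ℝ) :
    ‖charFun μ |ω| - charFun ν |ω|‖ = ‖charFun μ ω - charFun ν ω‖ := by
  rcases abs_choice ω with h | h <;> rw [h]
  rw [charFun_neg, charFun_neg, ← map_sub, RCLike.norm_conj]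

lemma hd_le (κ : ℝ → ℝ) (hκ0 : ∀ ω, 0 ≤ κ ω) (hκe : ∀ ω, κ (-ω) = κ ω)
    (hκi : ∀ n : ℕ, Integrable (fun ω => |ω| ^ n * κ ω)) (C : ℝ) (hC : ∀ ω, |ω| * κ ω ≤ C)
    {g1 A1 M1 g2 A2 M2} (h1 : Nice g1 A1 M1) (h2 : Nice g2 A2 M2) :
    hd κ (dm g1) (dm g2) ≤ 2 * C * qd nl (dm g1) (dm g2) := by
  have p1 := h1.prob
  have p2 := h2.prob
  have hC0 : 0 ≤ C := by simpa using hC 0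
  have i0 : Integrable κ := by simpa using hκi 0
  have i1 : Integrable (fun ω => |ω| * κ ω) := by simpa using hκi 1
  have hb : ∀ ε : ℝ, 0 < ε → hd κ (dm g1) (dm g2) ≤ 2 * C * (qd nl (dm g1) (dm g2) + 4 * √ε * (1 + M2 * K0))
      + ε * (8 * ∫ ω in Set.Ioi (0:ℝ), |ω| * κ ω) := by
    intro ε hε
    have e1 : hd κ (dm g1) (dm g2) = 2 * ∫ ω in Set.Ioi (0:ℝ), κ ω * ‖charFun (dm g1) ω - charFun (dm g2) ω‖ ^ 2 := by
      rw [hd, ← integral_comp_abs (f := fun ω => κ ω * ‖charFun (dm g1) ω - charFun (dm g2) ω‖ ^ 2)]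
      refine integral_congr_ae (Eventually.of_forall fun ω => ?_)
      simp only [charFun_diff_abs]
      have : κ |ω| = κ ω := by rcases abs_choice ω with h | h <;> rw [h]; exact hκe ω
      rw [this]
    have hL := (Lk_quad ε hε (dm g1) (dm g2) h1.int_id h2.int_id).1
    have e2 : ∫ ω in Set.Ioi (0:ℝ), κ ω * ‖charFun (dm g1) ω - charFun (dm g2) ω‖ ^ 2
        ≤ ∫ ω in Set.Ioi (0:ℝ), (C * (wE ε ω * ‖charFun (dm g1) ω - charFun (dm g2) ω‖ ^ 2) + (4 * ε) * (|ω| * κ ω)) := by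
      refine setIntegral_mono_on (hd_int κ i0 _ _).integrableOn ((hL.const_mul C).add (i1.integrableOn.const_mul _))
        measurableSet_Ioi fun ω hω => ?_
      have hω : 0 < ω := hω
      have hx := charFun_sub_le (dm g1) (dm g2) ω
      set X := ‖charFun (dm g1) ω - charFun (dm g2) ω‖ ^ 2 with hX
      have hX0 : 0 ≤ X := by positivity
      have hexp := add_one_le_exp (-ε * ω)
      have hCω := hC ω
      rw [abs_of_pos hω] at hCω ⊢
      have hk := hκ0 ω
      have s1 : κ ω * X * exp (-ε * ω) ≤ C * (wE ε ω * X) := by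
        have : κ ω ≤ C / ω := by rw [le_div_iff₀ hω]; linarith
        unfold wE
        calc κ ω * X * exp (-ε * ω) = κ ω * (X * exp (-ε * ω)) := by ring
          _ ≤ C / ω * (X * exp (-ε * ω)) := mul_le_mul_of_nonneg_right this (by positivity)
          _ = _ := by ring
      have s2 : κ ω * X * (ε * ω) ≤ 4 * ε * (ω * κ ω) := by
        have := mul_le_mul_of_nonneg_left hx (show 0 ≤ κ ω * (ε * ω) by positivity)
        linarith
      have s3 : κ ω * X * (1 - ε * ω) ≤ κ ω * X * exp (-ε * ω) :=
        mul_le_mul_of_nonneg_left (by linarith) (by positivity)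
      linarith
    rw [integral_add (hL.const_mul C) (i1.integrableOn.const_mul _), integral_const_mul, integral_const_mul] at e2
    have e3 := qd_nl_ge h1 h2 ε hε
    unfold we at e3
    have e4 := mul_le_mul_of_nonneg_left e3 hC0
    rw [e1]; linarith
  have hlim : Tendsto (fun ε : ℝ => 2 * C * (qd nl (dm g1) (dm g2) + 4 * √ε * (1 + M2 * K0))
      + ε * (8 * ∫ ω in Set.Ioi (0:ℝ), |ω| * κ ω)) (𝓝[>] 0) (𝓝 (2 * C * qd nl (dm g1) (dm g2))) := by
    have : Continuous (fun ε : ℝ => 2 * C * (qd nl (dm g1) (dm g2) + 4 * √ε * (1 + M2 * K0))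
      + ε * (8 * ∫ ω in Set.Ioi (0:ℝ), |ω| * κ ω)) := by fun_prop
    have := (this.tendsto 0).mono_left (nhdsWithin_le_nhds (s := Set.Ioi 0))
    simpa using this
  exact ge_of_tendsto hlim (eventually_nhdsWithin_of_forall fun ε hε => hb ε hε)

/-- equilibrium property for second derivative `v` -/
def IsEq (v g : ℝ → ℝ) : Prop :=
  Continuous g ∧ (∀ t, g (-t) = g t) ∧ ∃ a M : ℝ, 0 < a ∧ Nice g a M ∧ (∀ t, |t| < a → 0 < g t) ∧
    (∀ t, a ≤ |t| → g t = 0) ∧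
    ∃ ℓ : ℝ, (∀ t, |t| ≤ a → Vv v t - Pot g t = ℓ) ∧ (∀ t, ℓ ≤ Vv v t - Pot g t)

theorem equil (c : ℝ) (hc : 0 < c) (v : ℝ → ℝ) (hv : Continuous v) (hcv : ∀ t, c ≤ v t)
    (hev : ∀ t, v (-t) = v t) : ∃ g, IsEq v g := by
  obtain ⟨a, ha, -, h1, ℓ, hl1, hl2⟩ := equil0 c hc v hv hcv hev
  have h0 : ∀ t, 0 ≤ v t := fun t => hc.le.trans (hcv t)
  obtain ⟨B, hB⟩ : ∃ B, ∀ t, |t| ≤ a → v t ≤ B := by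
    obtain ⟨B, hB⟩ := (isCompact_Icc (a := -a) (b := a)).bddAbove_image hv.continuousOn
    exact ⟨B, fun t ht => hB ⟨t, abs_le.1 ht, rfl⟩⟩
  have hB0 : 0 ≤ B := (h0 0).trans (hB 0 (by simpa using ha.le))
  have hN : Nice (gd v a) a (a * B) :=
    ⟨(gd_cont v hv a).measurable, gd_nonneg v hv h0 a, fun x => gd_le v hv a x B ha hB0 hB,
      fun t ht => gd_zero v a t ha ht.le, h1⟩
  exact ⟨gd v a, gd_cont v hv a, gd_even v a, a, a * B, ha, hN, fun t ht => gd_pos v hv c hc hcv a t ht,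
    fun t ht => gd_zero v a t ha ht, ℓ, hl1, hl2⟩

lemma BB_symm (k : ℝ → ℝ) (hk : ∀ u, k (-u) = k u) (μ ν : Measure ℝ) [SFinite μ] [SFinite ν] :
    BB k μ ν = BB k ν μ := by
  unfold BB
  rw [← integral_prod_swap]
  refine integral_congr_ae (Eventually.of_forall fun p => ?_)
  simp only [Prod.fst_swap, Prod.snd_swap]
  rw [← hk]; congr 1; ring

lemma nl_even (u : ℝ) : nl (-u) = nl u := by simp [nl]

lemma Pot_int {g1 A1 M1} (h1 : Nice g1 A1 M1) (μ : Measure ℝ) [IsProbabilityMeasure μ]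
    (hμ : Integrable (fun x : ℝ => x) μ) :
    Integrable (Pot g1) μ ∧ ∫ t, Pot g1 t ∂μ = - BB nl μ (dm g1) := by
  have := h1.prob
  have i1 := h1.ker_int_prod nl nl_meas 2 nl_bd μ hμ
  have e : ∀ t, ∫ s, nl (t - s) ∂(dm g1) = - Pot g1 t := fun t => by
    unfold nl Pot; rw [integral_neg]
  have i2 := i1.integral_prod_left
  simp only [e] at i2
  refine ⟨by simpa using i2.neg, ?_⟩
  rw [BB_int_fst i1]
  simp only [e, integral_neg, neg_neg]

lemma comparison (v1 v2 g1 g2 : ℝ → ℝ) (e1 : IsEq v1 g1) (e2 : IsEq v2 g2) (hv1 : Continuous (Vv v1))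
    (hv2 : Continuous (Vv v2)) :
    qd nl (dm g1) (dm g2) ≤ ∫ t, Vv v1 t ∂(dm g2) - ∫ t, Vv v1 t ∂(dm g1) - ∫ t, Vv v2 t ∂(dm g2) + ∫ t, Vv v2 t ∂(dm g1) := by
  obtain ⟨-, -, a1, M1, ha1, n1, -, z1, l1, E1, F1⟩ := e1
  obtain ⟨-, -, a2, M2, ha2, n2, -, z2, l2, E2, F2⟩ := e2
  have := n1.prob
  have := n2.prob
  have hbd : ∀ (V : ℝ → ℝ), Continuous V → ∀ a : ℝ, ∃ B, ∀ t, |t| ≤ a → |V t| ≤ B := by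
    intro V hV a
    obtain ⟨B, hB⟩ := (isCompact_Icc (a := -a) (b := a)).bddAbove_image hV.abs.continuousOn
    exact ⟨B, fun t ht => hB ⟨t, abs_le.1 ht, rfl⟩⟩
  have iV : ∀ (V : ℝ → ℝ), Continuous V → ∀ {g a M}, Nice g a M → Integrable V (dm g) := by
    intro V hV g a M hn
    obtain ⟨B, hB⟩ := hbd V hV a
    exact hn.int_of_bdd V hV.measurable B hB
  obtain ⟨p11, q11⟩ := Pot_int n1 (dm g1) n1.int_id
  obtain ⟨p12, q12⟩ := Pot_int n1 (dm g2) n2.int_id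
  obtain ⟨p21, q21⟩ := Pot_int n2 (dm g1) n1.int_id
  obtain ⟨p22, q22⟩ := Pot_int n2 (dm g2) n2.int_id
  have hge : ∀ (v g g' : ℝ → ℝ) (l : ℝ) [IsProbabilityMeasure (dm g')], (∀ t, l ≤ Vv v t - Pot g t) → Integrable (Vv v) (dm g') →
      Integrable (Pot g) (dm g') → l ≤ ∫ t, Vv v t ∂(dm g') - ∫ t, Pot g t ∂(dm g') := by
    intro v g g' l _ h i j
    rw [← integral_sub i j]
    have := integral_mono (integrable_const l) (i.sub j) h
    simpa using this
  have heq : ∀ (v g : ℝ → ℝ) (l a M : ℝ) [IsProbabilityMeasure (dm g)], Nice g a M → (∀ t, |t| ≤ a → Vv v t - Pot g t = l) → Integrable (Vv v) (dm g) →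
      Integrable (Pot g) (dm g) → l = ∫ t, Vv v t ∂(dm g) - ∫ t, Pot g t ∂(dm g) := by
    intro v g l a M _ hn h i j
    rw [← integral_sub i j]
    have h2 : ∀ᵐ t ∂(dm g), Vv v t - Pot g t = l := by
      unfold dm
      rw [ae_withDensity_iff (by have := hn.meas; fun_prop)]
      refine Eventually.of_forall fun t ht => h t ?_
      by_contra hc
      rw [hn.supp t (not_le.1 hc)] at ht
      simp at ht
    rw [integral_congr_ae h2]; simp
  have r1 := hge v1 g1 g2 l1 F1 (iV _ hv1 n2) p12
  have r2 := hge v2 g2 g1 l2 F2 (iV _ hv2 n1) p21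
  have s1 := heq v1 g1 l1 a1 M1 n1 E1 (iV _ hv1 n1) p11
  have s2 := heq v2 g2 l2 a2 M2 n2 E2 (iV _ hv2 n2) p22
  rw [q12] at r1
  rw [q21] at r2
  rw [q11] at s1
  rw [q22] at s2
  have sy := BB_symm nl nl_even (dm g1) (dm g2)
  unfold qd
  linarith

theorem mono_fixed {H : Type*} [NormedAddCommGroup H] [InnerProductSpace ℝ H] [CompleteSpace H]
    (S : Set H) (hS : IsClosed S) (hc : Convex ℝ S) (x0 : H) (hx0 : x0 ∈ S) (T : H → H)
    (hT : ∀ x ∈ S, T x ∈ S) (k : ℝ) (hk : 0 < k)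
    (hm : ∀ x ∈ S, ∀ y ∈ S, k * ‖T x - T y‖ ^ 2 ≤ - inner ℝ (x - y) (T x - T y)) :
    ∃ x ∈ S, T x = x := by
  set θ : ℝ := 2 * k / (1 + 2 * k) with hθ
  have hθ0 : 0 < θ := by positivity
  have hθ1 : θ < 1 := by rw [hθ, div_lt_one (by positivity)]; linarith
  have hθk : θ = 2 * (1 - θ) * k := by rw [hθ]; field_simp; ring
  let F : H → H := fun x => (1 - θ) • x + θ • T x
  have hF : Set.MapsTo F S S := fun x hx => hc hx (hT x hx) (by linarith) hθ0.le (by ring)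
  have hF2 : ∀ x ∈ S, ∀ y ∈ S, ‖F x - F y‖ ≤ (1 - θ) * ‖x - y‖ := by
    intro x hx y hy
    have e : F x - F y = (1 - θ) • (x - y) + θ • (T x - T y) := by
      simp only [F]; module
    have h2 : ‖F x - F y‖ ^ 2 ≤ ((1 - θ) * ‖x - y‖) ^ 2 := by
      rw [e, norm_add_sq_real, norm_smul, norm_smul, inner_smul_left, inner_smul_right]
      simp only [Real.norm_eq_abs, abs_of_pos hθ0, abs_of_pos (sub_pos.2 hθ1), conj_trivial]
      have := mul_le_mul_of_nonneg_left (hm x hx y hy) (by nlinarith : 0 ≤ 2 * (1 - θ) * θ)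
      have e2 : 2 * (1 - θ) * θ * (k * ‖T x - T y‖ ^ 2) = (θ * ‖T x - T y‖) ^ 2 := by
        calc _ = θ * (2 * (1 - θ) * k) * ‖T x - T y‖ ^ 2 := by ring
          _ = _ := by rw [← hθk]; ring
      linarith
    exact le_of_sq_le_sq h2 (by have := sub_pos.2 hθ1; positivity)
  have hcon : ContractingWith (1 - θ).toNNReal (hF.restrict F S S) := by
    constructor
    · rw [Real.toNNReal_lt_one]; linarith
    · refine LipschitzWith.of_dist_le_mul fun x y => ?_
      rw [Subtype.dist_eq, Subtype.dist_eq, dist_eq_norm, dist_eq_norm, Real.coe_toNNReal _ (by linarith)]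
      exact hF2 x x.2 y y.2
  obtain ⟨y, hy, hfix, -, -⟩ := ContractingWith.exists_fixedPoint' hS.isComplete hF hcon hx0 (edist_ne_top _ _)
  refine ⟨y, hy, ?_⟩
  have : (1 - θ) • y + θ • T y = y := hfix
  have h3 : θ • (T y - y) = 0 := by
    rw [← sub_eq_zero] at this
    rw [← this]; module
  exact sub_eq_zero.1 ((smul_eq_zero.1 h3).resolve_left hθ0.ne')

lemma Vv_of_deriv (F F1 v : ℝ → ℝ) (hF : ∀ t, HasDerivAt F (F1 t) t) (hF1 : ∀ t, HasDerivAt F1 (v t) t)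
    (hv : Continuous v) (h0 : F1 0 = 0) (t : ℝ) : Vv v t = F t - F 0 := by
  unfold Vv
  have h := intervalIntegral.integral_eq_sub_of_hasDerivAt
    (f := fun s => (t - s) * F1 s + F s) (f' := fun s => (t - s) * v s) (a := 0) (b := t)
    (fun s _ => ((((hasDerivAt_const s t).sub (hasDerivAt_id s)).mul (hF1 s)).add (hF s)).congr_deriv
      (by simp))
    (Continuous.intervalIntegrable (by fun_prop) _ _)
  rw [h, h0]; ring

/-- cosine transform of `f` with respect to `l` minus value at zero -/
def Wf (l : Measure ℝ) (f : ℝ → ℝ) (t : ℝ) : ℝ := ∫ ω, (cos (ω * t) - 1) * f ω ∂l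

/-- minus second derivative of `Wf` -/
def Wf2 (l : Measure ℝ) (f : ℝ → ℝ) (t : ℝ) : ℝ := ∫ ω, ω ^ 2 * cos (ω * t) * f ω ∂l


lemma memLp_pow (l : Measure ℝ) (hl : ∀ n : ℕ, Integrable (fun ω => |ω| ^ n) l) 
    (n : ℕ) : MemLp (fun ω : ℝ => |ω| ^ n) 2 l := by
  rw [memLp_two_iff_integrable_sq (by fun_prop)]
  simpa [← pow_mul] using hl (n * 2)

lemma pow_mul_int (l : Measure ℝ) [IsFiniteMeasure l] (hl : ∀ n : ℕ, Integrable (fun ω => |ω| ^ n) l) 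
    (f : ℝ → ℝ) (hf : MemLp f 2 l) (n : ℕ) : Integrable (fun ω => |ω| ^ n * |f ω|) l :=
  (memLp_pow l hl n).integrable_mul hf.abs

lemma Wf_deriv (l : Measure ℝ) [IsFiniteMeasure l] (hl : ∀ n : ℕ, Integrable (fun ω => |ω| ^ n) l) 
    (f : ℝ → ℝ) (hf : MemLp f 2 l) :
    (∀ u, HasDerivAt (Wf l f) (∫ ω, -(ω * sin (ω * u)) * f ω ∂l) u) ∧
    (∀ u, HasDerivAt (fun u => ∫ ω, -(ω * sin (ω * u)) * f ω ∂l) (- Wf2 l f u) u) ∧ Continuous (Wf2 l f) := by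
  have hm := hf.1
  have b1 : ∀ u ω, ‖-(ω * sin (ω * u)) * f ω‖ ≤ |ω| ^ 1 * |f ω| := by
    intro u ω
    rw [norm_mul, norm_neg, norm_mul, norm_eq_abs, norm_eq_abs, norm_eq_abs, pow_one]
    exact mul_le_mul_of_nonneg_right (mul_le_of_le_one_right (abs_nonneg _) (abs_sin_le_one _)) (abs_nonneg _)
  have b2 : ∀ u ω, ‖ω ^ 2 * cos (ω * u) * f ω‖ ≤ |ω| ^ 2 * |f ω| := by
    intro u ω
    rw [norm_mul, norm_mul, norm_eq_abs, norm_eq_abs, norm_eq_abs, abs_pow]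
    exact mul_le_mul_of_nonneg_right (mul_le_of_le_one_right (by positivity) (abs_cos_le_one _)) (abs_nonneg _)
  refine ⟨fun u => ?_, fun u => ?_, ?_⟩
  · refine (hasDerivAt_integral_of_dominated_loc_of_deriv_le (s := Set.univ)
      (bound := fun ω => |ω| ^ 1 * |f ω|)
      (F' := fun u ω => -(ω * sin (ω * u)) * f ω) univ_mem
      (Eventually.of_forall fun v => ?_) ?_ ?_ ?_ (pow_mul_int l hl f hf 1) ?_).2
    · exact (Continuous.aestronglyMeasurable (by fun_prop)).mul hm
    · refine ((pow_mul_int l hl f hf 0).const_mul 2).mono' ((Continuous.aestronglyMeasurable (by fun_prop)).mul hm)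
        (Eventually.of_forall fun ω => ?_)
      rw [norm_mul, norm_eq_abs, norm_eq_abs, pow_zero, one_mul]
      refine mul_le_mul_of_nonneg_right ?_ (abs_nonneg _)
      rw [abs_le]; constructor <;> linarith [neg_one_le_cos (ω * u), cos_le_one (ω * u)]
    · exact (Continuous.aestronglyMeasurable (by fun_prop)).mul hm
    · exact Eventually.of_forall fun ω v _ => b1 v ω
    · refine Eventually.of_forall fun ω v _ => ?_
      refine (((((hasDerivAt_id v).const_mul ω).cos).sub_const 1).mul_const (f ω)).congr_deriv ?_
      simp only [id]; ring
  · have := (hasDerivAt_integral_of_dominated_loc_of_deriv_le (s := Set.univ) (μ := l) (x₀ := u)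
      (bound := fun ω => |ω| ^ 2 * |f ω|)
      (F := fun u ω => -(ω * sin (ω * u)) * f ω)
      (F' := fun u ω => -(ω ^ 2 * cos (ω * u) * f ω)) univ_mem
      (Eventually.of_forall fun v => ?_) ?_ ?_ ?_ (pow_mul_int l hl f hf 2) ?_).2
    · refine this.congr_deriv ?_
      rw [integral_neg]; rfl
    · exact (Continuous.aestronglyMeasurable (by fun_prop)).mul hm
    · exact (pow_mul_int l hl f hf 1).mono' ((Continuous.aestronglyMeasurable (by fun_prop)).mul hm)
        (Eventually.of_forall fun ω => b1 u ω)
    · exact ((Continuous.aestronglyMeasurable (by fun_prop)).mul hm).neg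
    · exact Eventually.of_forall fun ω v _ => by rw [norm_neg]; exact b2 v ω
    · refine Eventually.of_forall fun ω v _ => ?_
      refine (((((hasDerivAt_id v).const_mul ω).sin).const_mul ω).neg.mul_const (f ω)).congr_deriv ?_
      simp only [id]; ring
  · refine continuous_of_dominated (bound := fun ω => |ω| ^ 2 * |f ω|)
      (fun u => (Continuous.aestronglyMeasurable (by fun_prop)).mul hm)
      (fun u => Eventually.of_forall fun ω => b2 u ω) (pow_mul_int l hl f hf 2)
      (Eventually.of_forall fun ω => by fun_prop)

/-- potential identity -/
lemma Vv_Wf (l : Measure ℝ) [IsFiniteMeasure l] (hl : ∀ n : ℕ, Integrable (fun ω => |ω| ^ n) l) 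
    (Q : ℝ → ℝ) (hQ : ∀ x, AnalyticAt ℝ Q x) (hQe : ∀ t, Q (-t) = Q t) (β : ℝ)
    (f : ℝ → ℝ) (hf : MemLp f 2 l) :
    Continuous (fun t => (iteratedDeriv 2 Q t - Wf2 l f t) / β) ∧
    ∀ t, Vv (fun t => (iteratedDeriv 2 Q t - Wf2 l f t) / β) t = (Q t - Q 0 + Wf l f t) / β := by
  obtain ⟨d1, d2, c⟩ := Wf_deriv l hl f hf
  have hQs : ContDiff ℝ 2 Q := contDiff_iff_contDiffAt.2 fun x => (hQ x).contDiffAt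
  have q1 : ∀ t, HasDerivAt Q (deriv Q t) t := fun t => (hQ t).differentiableAt.hasDerivAt
  have q2 : ∀ t, HasDerivAt (deriv Q) (iteratedDeriv 2 Q t) t := fun t => by
    rw [iteratedDeriv_succ, iteratedDeriv_one]
    exact (hQ t).deriv.differentiableAt.hasDerivAt
  have q0 : deriv Q 0 = 0 := by
    have h1 : HasDerivAt (fun t => Q (-t)) (-deriv Q (-0)) 0 := by
      have := (q1 (-0)).comp (0:ℝ) (hasDerivAt_neg (0:ℝ))
      exact this.congr_deriv (by ring)
    have h2 : (fun t => Q (-t)) = Q := funext hQe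
    rw [h2] at h1
    have := h1.unique (q1 0)
    simp at this
    linarith
  have qc : Continuous (iteratedDeriv 2 Q) := hQs.continuous_iteratedDeriv 2 le_rfl
  have hc : Continuous (fun t => (iteratedDeriv 2 Q t - Wf2 l f t) / β) := (qc.sub c).div_const β
  refine ⟨hc, fun t => ?_⟩
  rw [Vv_of_deriv (fun t => (Q t + Wf l f t) / β)
    (fun t => (deriv Q t + ∫ ω, -(ω * sin (ω * t)) * f ω ∂l) / β) _
    (fun t => ((q1 t).add (d1 t)).div_const β)
    (fun t => (((q2 t).add (d2 t)).div_const β).congr_deriv (by ring)) hc (by simp [q0])]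
  simp [Wf]; ring

lemma Wf2_int (l : Measure ℝ) [IsFiniteMeasure l] (hl : ∀ n : ℕ, Integrable (fun ω => |ω| ^ n) l) 
    (f : ℝ → ℝ) (hf : MemLp f 2 l) (t : ℝ) : Integrable (fun ω => ω ^ 2 * cos (ω * t) * f ω) l := by
  refine (pow_mul_int l hl f hf 2).mono' ((Continuous.aestronglyMeasurable (by fun_prop)).mul hf.1)
        (Eventually.of_forall fun ω => ?_)
  rw [norm_mul, norm_mul, norm_eq_abs, norm_eq_abs, norm_eq_abs, abs_pow]
  exact mul_le_mul_of_nonneg_right (mul_le_of_le_one_right (by positivity) (abs_cos_le_one _)) (abs_nonneg _)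

/-- cosine transform of a measure -/
def tau (μ : Measure ℝ) (ω : ℝ) : ℝ := ∫ s, cos (ω * s) ∂μ

lemma tau_cont (μ : Measure ℝ) [IsProbabilityMeasure μ] : Continuous (tau μ) := by
  refine continuous_of_dominated (bound := fun _ => 1)
      (fun u => (Continuous.aestronglyMeasurable (by fun_prop)))
      (fun u => Eventually.of_forall fun ω => abs_cos_le_one _) (integrable_const _)
      (Eventually.of_forall fun ω => by fun_prop)

lemma tau_abs (μ : Measure ℝ) [IsProbabilityMeasure μ] (ω : ℝ) : |tau μ ω| ≤ 1 := by
  have := norm_integral_le_of_norm_le_const (μ := μ) (f := fun s => cos (ω * s)) (C := 1)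
    (Eventually.of_forall fun s => abs_cos_le_one _)
  simpa [tau] using this

lemma tau_memLp (l : Measure ℝ) [IsFiniteMeasure l] (μ : Measure ℝ) [IsProbabilityMeasure μ] : MemLp (tau μ) 2 l :=
  MemLp.of_bound (tau_cont μ).aestronglyMeasurable 1 (Eventually.of_forall fun ω => tau_abs μ ω)

lemma Wf_fubini (l : Measure ℝ) [SFinite l] (μ : Measure ℝ) [IsProbabilityMeasure μ] (f : ℝ → ℝ) (hf : Integrable f l) :
    ∫ t, Wf l f t ∂μ = ∫ ω, (tau μ ω - 1) * f ω ∂l := by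
  unfold Wf
  rw [integral_integral_swap]
  · refine integral_congr_ae (Eventually.of_forall fun ω => ?_)
    simp only
    rw [integral_mul_const, integral_sub, tau]
    · simp
    · exact Integrable.of_bound (C := 1) (Continuous.aestronglyMeasurable (by fun_prop))
        (Eventually.of_forall fun s => abs_cos_le_one _)
    · exact integrable_const _
  · refine ((hf.comp_snd μ).norm.const_mul 2).mono' ?_ (Eventually.of_forall fun p => ?_)
    · exact (Continuous.aestronglyMeasurable (by fun_prop)).mul hf.1.comp_snd
    · simp only [Function.uncurry, norm_mul, norm_eq_abs]
      refine mul_le_mul_of_nonneg_right ?_ (abs_nonneg _)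
      rw [abs_le]; constructor <;> linarith [neg_one_le_cos (p.2 * p.1), cos_le_one (p.2 * p.1)]

/-- multiplying by the transform of an even measure is convolution -/
lemma cos_tau (μ : Measure ℝ) [IsProbabilityMeasure μ] (hs : ∀ ω : ℝ, ∫ s, sin (ω * s) ∂μ = 0) (ω t : ℝ) :
    cos (ω * t) * tau μ ω = ∫ s, cos (ω * (t - s)) ∂μ := by
  have : ∀ s, cos (ω * (t - s)) = cos (ω * t) * cos (ω * s) + sin (ω * t) * sin (ω * s) := fun s => by
    rw [mul_sub, cos_sub]
  simp only [this]
  have i1 : Integrable (fun s => cos (ω * s)) μ := Integrable.of_bound (C := 1) (Continuous.aestronglyMeasurable (by fun_prop))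
        (Eventually.of_forall fun s => abs_cos_le_one _)
  have i2 : Integrable (fun s => sin (ω * s)) μ := Integrable.of_bound (C := 1) (Continuous.aestronglyMeasurable (by fun_prop))
        (Eventually.of_forall fun s => abs_sin_le_one _)
  rw [integral_add (i1.const_mul _) (i2.const_mul _), integral_const_mul, integral_const_mul, hs, tau]
  ring

lemma conv_fubini (l : Measure ℝ) [SFinite l] (μ : Measure ℝ) [IsProbabilityMeasure μ] (hs : ∀ ω : ℝ, ∫ s, sin (ω * s) ∂μ = 0)
    (w : ℝ → ℝ) (hw : Integrable w l) (t : ℝ) :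
    ∫ ω, w ω * cos (ω * t) * tau μ ω ∂l = ∫ s, ∫ ω, w ω * cos (ω * (t - s)) ∂l ∂μ := by
  simp only [mul_assoc, cos_tau μ hs, ← integral_const_mul]
  rw [integral_integral_swap]
  refine ((hw.comp_fst μ).norm).mono' ?_ (Eventually.of_forall fun p => ?_)
  · exact hw.1.comp_fst.mul (Continuous.aestronglyMeasurable (by fun_prop))
  · simp only [Function.uncurry, norm_mul, norm_eq_abs]
    exact mul_le_of_le_one_right (abs_nonneg _) (abs_cos_le_one _)

lemma tau_eq_re (μ : Measure ℝ) [IsProbabilityMeasure μ] (ω : ℝ) : tau μ ω = (charFun μ ω).re := by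
  rw [charFun_apply_real]
  have hintg : Integrable (fun x : ℝ => Complex.exp (ω * x * Complex.I)) μ := by
    apply Integrable.of_bound (C := 1) (by fun_prop)
    refine Eventually.of_forall fun z => ?_
    rw [← Complex.ofReal_mul, Complex.norm_exp_ofReal_mul_I]
  have := integral_re hintg
  simp only [RCLike.re_eq_complex_re] at this
  rw [← this]
  refine integral_congr_ae (Eventually.of_forall fun z => ?_)
  simp only
  rw [← Complex.ofReal_mul, Complex.exp_ofReal_mul_I_re]

lemma sin_zero_of_even {g A M} (hn : Nice g A M) (he : ∀ t, g (-t) = g t) (ω : ℝ) :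
    ∫ s, sin (ω * s) ∂(dm g) = 0 := by
  rw [dm_integral g hn.meas hn.nonneg]
  have h := integral_neg_eq_self (fun s => sin (ω * s) * g s) (volume : Measure ℝ)
  simp only [he, mul_neg, sin_neg, neg_mul, integral_neg] at h
  linarith

lemma inner_Lp (l : Measure ℝ) (x y : Lp ℝ 2 l) : inner ℝ x y = ∫ ω, x ω * y ω ∂l := by
  rw [L2.inner_def]
  refine integral_congr_ae (Eventually.of_forall fun ω => ?_)
  simp [mul_comm]

lemma Wf_congr (l : Measure ℝ) (f1 f2 : ℝ → ℝ) (h : f1 =ᵐ[l] f2) : Wf l f1 = Wf l f2 ∧ Wf2 l f1 = Wf2 l f2 := by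
  constructor <;> funext t <;> refine integral_congr_ae (h.mono fun ω hω => ?_) <;> simp only [hω]

lemma Wf_cont (l : Measure ℝ) [IsFiniteMeasure l] (hl : ∀ n : ℕ, Integrable (fun ω => |ω| ^ n) l)
    (f : ℝ → ℝ) (hf : MemLp f 2 l) : Continuous (Wf l f) :=
  continuous_iff_continuousAt.2 fun t => ((Wf_deriv l hl f hf).1 t).continuousAt

theorem mf_equil (β : ℝ) (hβ : 0 < β) (h κ Q : ℝ → ℝ) (hκc : Continuous κ) (hκ0 : ∀ ω, 0 ≤ κ ω)
    (hκe : ∀ ω, κ (-ω) = κ ω) (hκi : ∀ n : ℕ, Integrable (fun ω => |ω| ^ n * κ ω))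
    (C : ℝ) (hC : ∀ ω, |ω| * κ ω ≤ C) (hh : ∀ u, h u = ∫ ω, κ ω * cos (ω * u))
    (hQ : ∀ x, AnalyticAt ℝ Q x) (hQe : ∀ t, Q (-t) = Q t) (hQc : ∃ c > 0, ∀ t : ℝ, c ≤ iteratedDeriv 2 Q t)
    (hs : (⨆ t : ℝ, -(iteratedDeriv 2 h t)) < alphaQ Q) :
    ∃ g : ℝ → ℝ, Continuous g ∧ (∀ t, g (-t) = g t) ∧ ∃ a M : ℝ, 0 < a ∧ Nice g a M ∧
      (∀ t, |t| < a → 0 < g t) ∧ (∀ t, a ≤ |t| → g t = 0) ∧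
      ∃ ℓ : ℝ, (∀ t, |t| ≤ a → Q t + ∫ s, h (t - s) ∂(dm g) - β * Pot g t = ℓ) ∧
        (∀ t, ℓ ≤ Q t + ∫ s, h (t - s) ∂(dm g) - β * Pot g t) := by
  set σ := ⨆ t : ℝ, -(iteratedDeriv 2 h t) with hσ
  set c := alphaQ Q - σ with hc
  have hc0 : 0 < c := sub_pos.2 hs
  have hκm := hκc.measurable
  set l := dm κ with hldef
  have hfin : IsFiniteMeasure l := by
    have hi : Integrable κ := by simpa using hκi 0
    exact isFiniteMeasure_withDensity_ofReal hi.2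
  have hl : ∀ n : ℕ, Integrable (fun ω => |ω| ^ n) l := fun n =>
    (dm_integrable κ hκm hκ0 _).2 (hκi n)
  have lint : ∀ f : ℝ → ℝ, ∫ x, f x ∂l = ∫ x, f x * κ x := dm_integral κ hκm hκ0
  have hh1 : ∀ u, h u = ∫ ω, cos (ω * u) ∂l := fun u => by
    rw [lint, hh]; exact integral_congr_ae (Eventually.of_forall fun ω => mul_comm _ _)
  have hh2 : ∀ u, -iteratedDeriv 2 h u = ∫ ω, ω ^ 2 * cos (ω * u) ∂l := fun u => by
    rw [lint, kappa_deriv2 κ h hκc hκ0 hκi hh, integral_neg, neg_neg]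
    exact integral_congr_ae (Eventually.of_forall fun ω => by simp only; ring)
  have isq : Integrable (fun ω : ℝ => ω ^ 2) l := by simpa using hl 2
  have hbd : ∀ u, ∫ ω, ω ^ 2 * cos (ω * u) ∂l ≤ σ := by
    intro u
    rw [← hh2]
    refine le_ciSup (f := fun t => -iteratedDeriv 2 h t) ⟨∫ ω, ω ^ 2 ∂l, ?_⟩ u
    rintro _ ⟨t, rfl⟩
    simp only
    rw [hh2]
    refine integral_mono (isq.mul_bdd (c := 1) (by fun_prop) (Eventually.of_forall fun ω => abs_cos_le_one _)) isq fun ω => ?_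
    exact mul_le_of_le_one_right (by positivity) (cos_le_one _)
  have hQ2 : ∀ t, alphaQ Q ≤ iteratedDeriv 2 Q t := by
    obtain ⟨c', -, h'⟩ := hQc
    exact fun t => ciInf_le ⟨c', by rintro _ ⟨t, rfl⟩; exact h' t⟩ t
  let v : (ℝ → ℝ) → ℝ → ℝ := fun f t => (iteratedDeriv 2 Q t - Wf2 l f t) / β
  have hVc : ∀ f, MemLp f 2 l → Continuous (Vv (v f)) := fun f hf => by
    have : Vv (v f) = fun t => (Q t - Q 0 + Wf l f t) / β := funext (Vv_Wf l hl Q hQ hQe β f hf).2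
    rw [this]
    have q : Continuous Q := continuous_iff_continuousAt.2 fun t => (hQ t).continuousAt
    have := Wf_cont l hl f hf
    fun_prop
  have i2e : ∀ t, iteratedDeriv 2 Q (-t) = iteratedDeriv 2 Q t := by
    intro t
    have e : (fun x => Q (-x)) = Q := funext hQe
    have := iteratedDeriv_comp_neg 2 Q t
    rw [e] at this
    simpa using this.symm
  have hcont : Continuous (fun u => ∫ ω, ω ^ 2 * cos (ω * u) ∂l) := by
    have := (Wf_deriv l hl (fun _ => 1) (memLp_const 1)).2.2
    have e : (fun u => ∫ ω, ω ^ 2 * cos (ω * u) ∂l) = Wf2 l (fun _ => 1) := by funext u; simp [Wf2]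
    rw [e]; exact this
  let S : Set (Lp ℝ 2 l) := {f | ∀ t, Wf2 l f t ≤ σ}
  have hk2 : ∀ t : ℝ, MemLp (fun ω : ℝ => ω ^ 2 * cos (ω * t)) 2 l := fun t => by
    refine (memLp_pow l hl 2).mono (Continuous.aestronglyMeasurable (by fun_prop)) (Eventually.of_forall fun ω => ?_)
    rw [norm_mul, norm_eq_abs, norm_eq_abs, norm_eq_abs, abs_pow, abs_pow, abs_abs]
    exact mul_le_of_le_one_right (by positivity) (abs_cos_le_one _)
  have hWi : ∀ (f : Lp ℝ 2 l) t, Wf2 l f t = inner ℝ ((hk2 t).toLp) f := fun f t => by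
    rw [inner_Lp]
    exact integral_congr_ae ((hk2 t).coeFn_toLp.mono fun ω hω => by simp only [hω])
  have hS1 : IsClosed S := by
    have : S = ⋂ t, {f | inner ℝ ((hk2 t).toLp) f ≤ σ} := by
      ext f; simp only [S, Set.mem_iInter, Set.mem_ofPred_eq, hWi]
    rw [this]
    exact isClosed_iInter fun t => isClosed_le (by fun_prop) continuous_const
  have hS2 : Convex ℝ S := by
    intro x hx y hy a b ha hb hab t
    rw [hWi, inner_add_right, inner_smul_right, inner_smul_right]
    have h1 := hx t
    have h2 := hy t
    rw [hWi] at h1 h2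
    calc _ ≤ a * σ + b * σ := add_le_add (mul_le_mul_of_nonneg_left h1 ha) (mul_le_mul_of_nonneg_left h2 hb)
      _ = σ := by rw [← add_mul, hab, one_mul]
  have h1m : MemLp (fun _ : ℝ => (1:ℝ)) 2 l := memLp_const 1
  have hS0 : h1m.toLp ∈ S := by
    intro t
    rw [(Wf_congr l _ _ h1m.coeFn_toLp).2]
    simpa [Wf2] using hbd t
  have hex : ∀ f : Lp ℝ 2 l, ∃ y : Lp ℝ 2 l, f ∈ S → ∃ g, IsEq (v f) g ∧ y =ᵐ[l] tau (dm g) := by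
    intro f
    by_cases hf : f ∈ S
    · obtain ⟨g, hg⟩ := equil (c / β) (div_pos hc0 hβ) (v f) (Vv_Wf l hl Q hQ hQe β f (Lp.memLp f)).1
        (fun t => by
          refine div_le_div_of_nonneg_right ?_ hβ.le
          have := hf t
          have := hQ2 t
          linarith)
        (fun t => by simp only [v, i2e, Wf2, mul_neg, cos_neg])
      obtain ⟨-, -, a, M, -, hN, -⟩ := id hg
      have := hN.prob
      exact ⟨(tau_memLp l (dm g)).toLp, fun _ => ⟨g, hg, (tau_memLp l (dm g)).coeFn_toLp⟩⟩
    · exact ⟨0, fun h => absurd h hf⟩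
  choose T hT using hex
  have hTS : ∀ x ∈ S, T x ∈ S := by
    intro x hx t
    obtain ⟨g, hg, hy⟩ := hT x hx
    obtain ⟨-, hev, a, M, -, hN, -⟩ := hg
    have := hN.prob
    rw [(Wf_congr l _ _ hy).2]
    unfold Wf2
    rw [conv_fubini l (dm g) (sin_zero_of_even hN hev) (fun ω => ω ^ 2) isq]
    calc _ ≤ ∫ s, σ ∂(dm g) := by
          refine integral_mono ?_ (integrable_const _) (fun s => hbd (t - s))
          refine Integrable.of_bound (C := ∫ ω, ω ^ 2 ∂l) (hcont.comp (continuous_const.sub continuous_id)).aestronglyMeasurable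
            (Eventually.of_forall fun s => ?_)
          refine norm_integral_le_of_norm_le isq (Eventually.of_forall fun ω => ?_)
          rw [norm_mul, norm_eq_abs, norm_eq_abs, abs_of_nonneg (sq_nonneg ω)]
          exact mul_le_of_le_one_right (by positivity) (abs_cos_le_one _)
      _ = σ := by simp
  have hC0 : 0 ≤ C := by simpa using hC 0
  have hL2int : ∀ f : Lp ℝ 2 l, Integrable f l := fun f => (Lp.memLp f).integrable (by norm_num)
  have hmono : ∀ x ∈ S, ∀ y ∈ S, (β / (2 * (C + 1))) * ‖T x - T y‖ ^ 2 ≤ - inner ℝ (x - y) (T x - T y) := by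
    intro x hx y hy
    obtain ⟨g1, hg1, hy1⟩ := hT x hx
    obtain ⟨g2, hg2, hy2⟩ := hT y hy
    have hcmp := comparison _ _ _ _ hg1 hg2 (hVc _ (Lp.memLp x)) (hVc _ (Lp.memLp y))
    obtain ⟨-, -, a1, M1, -, hN1, -⟩ := hg1
    obtain ⟨-, -, a2, M2, -, hN2, -⟩ := hg2
    have p1 := hN1.prob
    have p2 := hN2.prob
    have hd1 := hd_le κ hκ0 hκe hκi (C + 1) (fun ω => (hC ω).trans (by linarith)) hN1 hN2
    have hnorm : ‖T x - T y‖ ^ 2 ≤ hd κ (dm g1) (dm g2) := by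
      rw [← real_inner_self_eq_norm_sq, inner_Lp]
      have e : ∫ ω, (T x - T y) ω * (T x - T y) ω ∂l = ∫ ω, (tau (dm g1) ω - tau (dm g2) ω) ^ 2 ∂l := by
        refine integral_congr_ae ?_
        filter_upwards [Lp.coeFn_sub (T x) (T y), hy1, hy2] with ω h1 h2 h3
        rw [h1, Pi.sub_apply, h2, h3]; ring
      rw [e, lint]
      have ii := hd_int κ (by simpa using hκi 0) (dm g1) (dm g2)
      refine integral_mono_of_nonneg (Eventually.of_forall fun ω => mul_nonneg (sq_nonneg _) (hκ0 ω)) ii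
        (Eventually.of_forall fun ω => ?_)
      simp only
      rw [mul_comm]
      refine mul_le_mul_of_nonneg_left ?_ (hκ0 ω)
      rw [tau_eq_re, tau_eq_re, ← Complex.sub_re, ← sq_abs]
      exact pow_le_pow_left₀ (abs_nonneg _) (Complex.abs_re_le_norm _) 2
    have q : Continuous Q := continuous_iff_continuousAt.2 fun t => (hQ t).continuousAt
    have iC : ∀ (V : ℝ → ℝ), Continuous V → ∀ {g a M}, Nice g a M → Integrable V (dm g) := by
      intro V hV g a M hN
      obtain ⟨B, hB⟩ := (isCompact_Icc (a := -a) (b := a)).bddAbove_image hV.abs.continuousOn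
      exact hN.int_of_bdd V hV.measurable B fun t ht => hB ⟨t, abs_le.1 ht, rfl⟩
    have hV : ∀ (f : Lp ℝ 2 l) {g a M}, Nice g a M → ∫ t, Vv (v f) t ∂(dm g) =
        ((∫ t, (Q t - Q 0) ∂(dm g)) + ∫ ω, (tau (dm g) ω - 1) * f ω ∂l) / β := by
      intro f g a M hN
      have := hN.prob
      rw [← Wf_fubini l (dm g) f (hL2int f), ← integral_add (f := fun t => Q t - Q 0) (iC _ (q.sub continuous_const) hN)
        (iC _ (Wf_cont l hl f (Lp.memLp f)) hN), ← integral_div]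
      exact integral_congr_ae (Eventually.of_forall fun t => (Vv_Wf l hl Q hQ hQe β f (Lp.memLp f)).2 t)
    have it : ∀ (f : Lp ℝ 2 l) {g a M}, Nice g a M → Integrable (fun ω => (tau (dm g) ω - 1) * f ω) l := by
      intro f g a M hN
      have := hN.prob
      refine (hL2int f).bdd_mul (c := 2) ((tau_cont (dm g)).sub continuous_const).aestronglyMeasurable
        (Eventually.of_forall fun ω => ?_)
      have := abs_le.1 (tau_abs (dm g) ω)
      rw [norm_eq_abs, abs_le]; constructor <;> linarith
    have hin : inner ℝ (x - y) (T x - T y) = ∫ ω, (tau (dm g1) ω - 1) * x ω ∂l - ∫ ω, (tau (dm g2) ω - 1) * x ω ∂l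
        - ∫ ω, (tau (dm g1) ω - 1) * y ω ∂l + ∫ ω, (tau (dm g2) ω - 1) * y ω ∂l := by
      rw [inner_Lp, ← integral_sub (it x hN1) (it x hN2),
        ← integral_sub (f := fun ω => (tau (dm g1) ω - 1) * x ω - (tau (dm g2) ω - 1) * x ω) ((it x hN1).sub (it x hN2)) (it y hN1),
        ← integral_add (f := fun ω => (tau (dm g1) ω - 1) * x ω - (tau (dm g2) ω - 1) * x ω - (tau (dm g1) ω - 1) * y ω)
          (((it x hN1).sub (it x hN2)).sub (it y hN1)) (it y hN2)]
      refine integral_congr_ae ?_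
      filter_upwards [Lp.coeFn_sub (T x) (T y), Lp.coeFn_sub x y, hy1, hy2] with ω h1 h0 h2 h3
      simp only [h0, h1, Pi.sub_apply, h2, h3]; ring
    rw [hV x hN1, hV x hN2, hV y hN1, hV y hN2] at hcmp
    have hcmp2 : qd nl (dm g1) (dm g2) ≤ - inner ℝ (x - y) (T x - T y) / β := by
      rw [hin]; refine hcmp.trans (le_of_eq ?_); ring
    calc β / (2 * (C + 1)) * ‖T x - T y‖ ^ 2 ≤ β / (2 * (C + 1)) * (2 * (C + 1) * (- inner ℝ (x - y) (T x - T y) / β)) := by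
          refine mul_le_mul_of_nonneg_left (hnorm.trans (hd1.trans ?_)) (by positivity)
          exact mul_le_mul_of_nonneg_left hcmp2 (by positivity)
      _ = _ := by field_simp
  obtain ⟨x, hx, hfix⟩ := mono_fixed S hS1 hS2 _ hS0 T hTS _ (by positivity) hmono
  obtain ⟨g, hg, hy⟩ := hT x hx
  rw [hfix] at hy
  obtain ⟨hgc, hge, a, M, ha, hN, hpos, hz, ℓ, hl1, hl2⟩ := hg
  have := hN.prob
  have ic : ∀ t : ℝ, Integrable (fun ω => cos (ω * t)) l := fun t =>
    Integrable.of_bound (C := 1) (Continuous.aestronglyMeasurable (by fun_prop)) (Eventually.of_forall fun _ => abs_cos_le_one _)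
  have key : ∀ t, Q t + ∫ s, h (t - s) ∂(dm g) - β * Pot g t =
      β * (Vv (v x) t - Pot g t) + (Q 0 + ∫ ω, tau (dm g) ω ∂l) := by
    intro t
    have e1 : Vv (v x) t = _ := (Vv_Wf l hl Q hQ hQe β x (Lp.memLp x)).2 t
    have it0 : Integrable (tau (dm g)) l := (tau_memLp l (dm g)).integrable (by norm_num)
    have e2 : Wf l x t = ∫ s, h (t - s) ∂(dm g) - ∫ ω, tau (dm g) ω ∂l := by
      rw [(Wf_congr l _ _ hy).1]
      have := conv_fubini l (dm g) (sin_zero_of_even hN hge) (fun _ => 1) (integrable_const _) t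
      simp only [one_mul] at this
      simp only [hh1]
      rw [← this, ← integral_sub (it0.bdd_mul (c := 1) (Continuous.aestronglyMeasurable (by fun_prop)) (Eventually.of_forall fun _ => abs_cos_le_one _)) it0]
      exact integral_congr_ae (Eventually.of_forall fun ω => by simp only; ring)
    rw [e1, e2]
    field_simp
    ring
  refine ⟨g, hgc, hge, a, M, ha, hN, hpos, hz, β * ℓ + (Q 0 + ∫ ω, tau (dm g) ω ∂l), fun t ht => ?_, fun t => ?_⟩
  · rw [key, hl1 t ht]
  · rw [key]
    have := mul_le_mul_of_nonneg_left (hl2 t) hβ.le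
    linarith

/-- empirical measure -/
def emp {N : ℕ} (x : Fin N → ℝ) : Measure ℝ := (N : ENNReal)⁻¹ • ∑ i, Measure.dirac (x i)

lemma emp_int {N : ℕ} (hN : 0 < N) (x : Fin N → ℝ) {E : Type*} [NormedAddCommGroup E] (f : ℝ → E) : Integrable f (emp x) := by
  unfold emp
  refine Integrable.smul_measure ?_ (by simp [hN.ne'])
  rw [integrable_finsetSum_measure]
  intro i _
  exact integrable_dirac (by simp)

lemma emp_integral {N : ℕ} (hN : 0 < N) (x : Fin N → ℝ) {E : Type*} [NormedAddCommGroup E] [NormedSpace ℝ E] [CompleteSpace E]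
    (f : ℝ → E) : ∫ t, f t ∂(emp x) = (N : ℝ)⁻¹ • ∑ i, f (x i) := by
  unfold emp
  rw [integral_smul_measure, integral_finsetSum_measure]
  · simp
  · intro i _
    exact integrable_dirac (by simp)

lemma emp_prob {N : ℕ} (hN : 0 < N) (x : Fin N → ℝ) : IsProbabilityMeasure (emp x) := by
  constructor
  simp [emp]
  exact ENNReal.inv_mul_cancel (by simp [hN.ne']) (by simp)

lemma BB_emp {N : ℕ} (hN : 0 < N) (x : Fin N → ℝ) (k : ℝ → ℝ) (hk : Measurable k) (C : ℝ)
    (hC : ∀ u, |k u| ≤ C * (1 + |u|)) :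
    BB k (emp x) (emp x) = ((N : ℝ) ^ 2)⁻¹ * ∑ i, ∑ j, k (x i - x j) := by
  have := emp_prob hN x
  have hC0 : 0 ≤ C := by have := (abs_nonneg _).trans (hC 0); simpa using this
  have i1 : Integrable (fun p : ℝ × ℝ => k (p.1 - p.2)) ((emp x).prod (emp x)) := by
    have a1 := (emp_int hN x (fun t => |t|)).comp_fst (emp x)
    have a2 := (emp_int hN x (fun t => |t|)).comp_snd (emp x)
    refine (((integrable_const (1:ℝ)).add (a1.add a2)).const_mul C).mono' (hk.comp (by fun_prop)).aestronglyMeasurable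
      (Eventually.of_forall fun p => (hC _).trans ?_)
    refine mul_le_mul_of_nonneg_left ?_ hC0
    simp only [Pi.add_apply]
    have := abs_sub p.1 p.2
    linarith
  unfold BB
  rw [integral_prod _ i1]
  simp only [emp_integral hN, smul_eq_mul, ← mul_sum]
  rw [← mul_assoc, sq, mul_inv]

lemma double_sum {N : ℕ} (x : Fin N → ℝ) (k : ℝ → ℝ) (hk : ∀ u, k (-u) = k u) :
    ∑ i, ∑ j, k (x i - x j) = 2 * pairSum k x + N * k 0 := by
  rw [← Finset.sum_product', Finset.univ_product_univ,
    ← Finset.sum_filter_add_sum_filter_not univ (fun p : Fin N × Fin N => p.1 < p.2),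
    ← Finset.sum_filter_add_sum_filter_not (univ.filter (fun p : Fin N × Fin N => ¬ p.1 < p.2)) (fun p : Fin N × Fin N => p.2 < p.1)]
  have e1 : ∑ p ∈ (univ.filter (fun p : Fin N × Fin N => ¬ p.1 < p.2)).filter (fun p => p.2 < p.1), k (x p.1 - x p.2)
      = pairSum k x := by
    unfold pairSum
    refine Finset.sum_nbij' (fun p => p.swap) (fun p => p.swap) ?_ ?_ ?_ ?_ ?_
    · intro p hp; simp at hp ⊢; exact hp.2
    · intro p hp; simp at hp ⊢; exact ⟨hp.le, hp⟩
    · intro p _; simp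
    · intro p _; simp
    · intro p _
      simp only [Prod.fst_swap, Prod.snd_swap]
      rw [← hk]; congr 1; ring
  have e2 : ∑ p ∈ (univ.filter (fun p : Fin N × Fin N => ¬ p.1 < p.2)).filter (fun p => ¬ p.2 < p.1), k (x p.1 - x p.2)
      = N * k 0 := by
    have : ∑ p ∈ (univ.filter (fun p : Fin N × Fin N => ¬ p.1 < p.2)).filter (fun p => ¬ p.2 < p.1), k (x p.1 - x p.2)
      = ∑ i : Fin N, k 0 := by
      refine Finset.sum_nbij' (fun p => p.1) (fun i => (i, i)) ?_ ?_ ?_ ?_ ?_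
      · intro p _; simp
      · intro p _; simp
      · rintro ⟨p, q⟩ hp; simp at hp ⊢; exact le_antisymm hp.2 hp.1
      · intro p _; simp
      · rintro ⟨p, q⟩ hp
        simp at hp
        have : p = q := le_antisymm hp.2 hp.1
        simp [this]
    rw [this]; simp
  rw [e1, e2]
  change pairSum k x + _ = _
  ring

/-- effective potential -/
def Uf (β : ℝ) (h Q g : ℝ → ℝ) (t : ℝ) : ℝ := Q t + ∫ s, h (t - s) ∂(dm g) - β * Pot g t

/-- Hamiltonian -/
def HH (β : ℝ) (h Q : ℝ → ℝ) {N : ℕ} (x : Fin N → ℝ) : ℝ :=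
  N * ∑ j, Q (x j) + pairSum h x + β * pairSum nl x

/-- interaction energy -/
def Jc (β : ℝ) (h g : ℝ → ℝ) : ℝ := 1 / 2 * BB h (dm g) (dm g) + β / 2 * BB nl (dm g) (dm g)

lemma h_props (h κ : ℝ → ℝ) (hκc : Continuous κ) (hκ0 : ∀ ω, 0 ≤ κ ω)
    (hκi : ∀ n : ℕ, Integrable (fun ω => |ω| ^ n * κ ω)) (hh : ∀ u, h u = ∫ ω, κ ω * cos (ω * u)) :
    Continuous h ∧ (∀ u, h (-u) = h u) ∧ ∀ u, |h u| ≤ h 0 := by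
  refine ⟨continuous_iff_continuousAt.2 fun u => ((kappa_deriv κ h hκc hκ0 hκi hh).1 u).continuousAt,
    fun u => by simp [hh], fun u => ?_⟩
  rw [hh, hh 0]
  rw [← norm_eq_abs]
  refine norm_integral_le_of_norm_le (by simpa using hκi 0) (Eventually.of_forall fun ω => ?_)
  rw [norm_mul, norm_eq_abs, norm_eq_abs, abs_of_nonneg (hκ0 ω)]
  simpa using mul_le_of_le_one_right (hκ0 ω) (abs_cos_le_one (ω * u))

lemma energy_lower (β : ℝ) (hβ : 0 < β) (h κ Q : ℝ → ℝ) (hκc : Continuous κ) (hκ0 : ∀ ω, 0 ≤ κ ω)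
    (hκi : ∀ n : ℕ, Integrable (fun ω => |ω| ^ n * κ ω)) (hh : ∀ u, h u = ∫ ω, κ ω * cos (ω * u))
    {g a M} (hg : Nice g a M) {N : ℕ} (hN : 0 < N) (x : Fin N → ℝ) (hx : Function.Injective x) (ε : ℝ) (hε : 0 < ε) :
    N * ∑ i, Uf β h Q g (x i) - N ^ 2 * Jc β h g + N ^ 2 * (β / 2 * we ε (emp x) (dm g))
      - N ^ 2 * (2 * β * √ε * (1 + M * K0)) - N * (h 0 / 2 - β / 2 * log ε) ≤ HH β h Q x := by
  obtain ⟨hc, he, hb⟩ := h_props h κ hκc hκ0 hκi hh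
  have := hg.prob
  have := emp_prob hN x
  have hid : Integrable (fun t : ℝ => t) (emp x) := emp_int hN x _
  have hN' : (0:ℝ) < N := by exact_mod_cast hN
  have h00 : 0 ≤ h 0 := (abs_nonneg _).trans (hb 0)
  -- Fourier identities
  have f1 := (Lk_quad ε hε (emp x) (dm g) hid hg.int_id).2
  have f2 := (pair_fourier_quad volume κ κ h 0 hκc.measurable (by simpa using hκi 0)
    (Eventually.of_forall fun ω u => by
      rw [sub_zero, abs_mul, abs_of_nonneg (hκ0 ω)]
      refine mul_le_mul_of_nonneg_left ?_ (hκ0 ω)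
      have := abs_cos_le_one (ω * u); have := abs_nonneg u; linarith)
    (fun u => by simpa using hh u) (emp x) (dm g) hid hg.int_id).2
  have f3 : 0 ≤ ∫ ω, κ ω * ‖charFun (emp x) ω - charFun (dm g) ω‖ ^ 2 :=
    integral_nonneg fun ω => mul_nonneg (hκ0 ω) (by positivity)
  rw [← f2] at f3
  have f4 := cross_le hg ε hε (emp x) hid
  have f5 := self_ge hg ε hε
  -- sums
  have s1 := BB_emp hN x h hc.measurable (h 0) (fun u => (hb u).trans (by nlinarith [abs_nonneg u]))
  rw [double_sum x h he] at s1
  have s2 := BB_emp hN x (Lk ε) (Lk_meas ε) ε⁻¹ (fun u => (Lk_abs_le ε hε u).trans (by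
    rw [div_eq_inv_mul]; exact mul_le_mul_of_nonneg_left (by linarith) (by positivity)))
  rw [double_sum x (Lk ε) (fun u => by simp [Lk])] at s2
  have s3 : pairSum (Lk ε) x - pairSum (fun _ => log ε) x ≤ pairSum nl x := by
    unfold pairSum
    rw [← Finset.sum_sub_distrib]
    refine Finset.sum_le_sum fun p hp => ?_
    simp only [Finset.mem_filter, Finset.mem_univ, true_and] at hp
    exact neg_log_ge_Lk ε _ hε (sub_ne_zero.2 fun h => hp.ne (hx h))
  have s4 := double_sum x (fun _ => log ε) (fun _ => rfl)
  simp only [Finset.sum_const, Finset.card_univ, Fintype.card_fin, nsmul_eq_mul] at s4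
  -- effective potential
  have ih : Integrable (fun p : ℝ × ℝ => h (p.1 - p.2)) ((emp x).prod (dm g)) :=
    Integrable.of_bound (C := h 0) (hc.measurable.comp (by fun_prop)).aestronglyMeasurable (Eventually.of_forall fun p => hb _)
  have u1 := BB_int_fst ih
  have u2 := (Pot_int hg (emp x) hid).2
  rw [emp_integral hN, smul_eq_mul] at u1 u2
  have u3 : ∑ i, Uf β h Q g (x i) = ∑ i, Q (x i) + N * BB h (emp x) (dm g) + β * (N * BB nl (emp x) (dm g)) := by
    have e2 : N * BB nl (emp x) (dm g) = - ∑ i, Pot g (x i) := by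
      have : BB nl (emp x) (dm g) = - ((N:ℝ)⁻¹ * ∑ i, Pot g (x i)) := by linarith
      rw [this]; field_simp
    rw [u1, e2]
    unfold Uf
    rw [Finset.sum_sub_distrib, Finset.sum_add_distrib, ← Finset.mul_sum]
    field_simp
    ring
  have L0 : Lk ε 0 = 0 := by simp [Lk]
  rw [L0] at s2
  have s1' : N ^ 2 * BB h (emp x) (emp x) = 2 * pairSum h x + N * h 0 := by rw [s1]; field_simp
  have s2' : N ^ 2 * BB (Lk ε) (emp x) (emp x) = 2 * pairSum (Lk ε) x := by rw [s2]; field_simp; ring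
  rw [u3]
  unfold HH Jc we
  rw [← f1]
  change 0 ≤ BB h _ _ - 2 * BB h _ _ + BB h _ _ at f3
  change _ + N ^ 2 * (β / 2 * (BB _ _ _ - 2 * BB _ _ _ + BB _ _ _)) - _ - _ ≤ _
  have t1 := mul_le_mul_of_nonneg_left f4 (by positivity : 0 ≤ (N:ℝ) ^ 2 * β)
  have t2 := mul_le_mul_of_nonneg_left f5 (by positivity : 0 ≤ (N:ℝ) ^ 2 * β / 2)
  have t3 := mul_le_mul_of_nonneg_left s3 hβ.le
  have t4 := mul_le_mul_of_nonneg_left f3 (by positivity : 0 ≤ (N:ℝ) ^ 2 / 2)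
  have s4' : 2 * (β / 2) * pairSum (fun _ => log ε) x = (β / 2) * (N * (N * log ε) - N * log ε) := by rw [s4]; ring
  have s1dd : (N:ℝ) ^ 2 * BB h (emp x) (emp x) / 2 = pairSum h x + N * h 0 / 2 := by rw [s1']; ring
  have s2dd : β / 2 * ((N:ℝ) ^ 2 * BB (Lk ε) (emp x) (emp x)) = β * pairSum (Lk ε) x := by rw [s2']; ring
  linarith

/-- product measure -/
def pid (g : ℝ → ℝ) (N : ℕ) : Measure (Fin N → ℝ) := Measure.pi (fun _ => dm g)

lemma pid_eq {g A M} (hg : Nice g A M) (N : ℕ) :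
    pid g N = volume.withDensity (fun x : Fin N → ℝ => ENNReal.ofReal (∏ i, g (x i))) := by
  have := hg.prob
  refine Measure.pi_eq fun s hs => ?_
  have hm := hg.meas
  rw [withDensity_apply _ (MeasurableSet.univ_pi hs), ← lintegral_indicator (MeasurableSet.univ_pi hs)]
  have e : ∀ x : Fin N → ℝ, (Set.univ.pi s).indicator (fun x => ENNReal.ofReal (∏ i, g (x i))) x =
      ENNReal.ofReal (∏ i, (s i).indicator g (x i)) := by
    intro x
    by_cases hx : x ∈ Set.univ.pi s
    · rw [Set.indicator_of_mem hx]
      congr 1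
      exact Finset.prod_congr rfl fun i _ => (Set.indicator_of_mem (hx i trivial) _).symm
    · rw [Set.indicator_of_notMem hx]
      simp only [Set.mem_pi, Set.mem_univ, true_implies, not_forall] at hx
      obtain ⟨i, hi⟩ := hx
      rw [Finset.prod_eq_zero (Finset.mem_univ i) (Set.indicator_of_notMem hi _), ENNReal.ofReal_zero]
  simp only [e]
  have ii : ∀ i, Integrable ((s i).indicator g) := fun i => hg.int.indicator (hs i)
  have nn : ∀ i t, 0 ≤ (s i).indicator g t := fun i t => Set.indicator_nonneg (fun t _ => hg.nonneg t) t
  have iv : Integrable (fun x : Fin N → ℝ => ∏ i, (s i).indicator g (x i)) := Integrable.fintype_prod ii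
  rw [← ofReal_integral_eq_lintegral_ofReal iv
    (Eventually.of_forall fun x => Finset.prod_nonneg fun i _ => nn i _),
    integral_fintype_prod_volume_eq_prod (fun i => (s i).indicator g),
    ENNReal.ofReal_prod_of_nonneg (fun i _ => integral_nonneg (nn i))]
  refine Finset.prod_congr rfl fun i _ => ?_
  rw [dm, withDensity_apply _ (hs i), integral_indicator (hs i),
    ofReal_integral_eq_lintegral_ofReal hg.int.integrableOn (Eventually.of_forall hg.nonneg)]

lemma pid_prob {g A M} (hg : Nice g A M) (N : ℕ) : IsProbabilityMeasure (pid g N) := by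
  have := hg.prob
  unfold pid
  infer_instance

lemma pid_eval {g A M} (hg : Nice g A M) {N : ℕ} (i : Fin N) :
    MeasurePreserving (fun x : Fin N → ℝ => x i) (pid g N) (dm g) := by
  have := hg.prob
  exact measurePreserving_eval (fun _ => dm g) i

lemma pid_pair {g A M} (hg : Nice g A M) {N : ℕ} (i j : Fin N) (hij : i ≠ j) :
    MeasurePreserving (fun x : Fin N → ℝ => (x i, x j)) (pid g N) ((dm g).prod (dm g)) := by
  have := hg.prob
  have := pid_prob hg N
  refine ⟨by fun_prop, ?_⟩
  have h1 := (ProbabilityTheory.iIndepFun_pi (μ := fun _ : Fin N => dm g) (X := fun _ (t : ℝ) => t)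
    (fun i => aemeasurable_id)).indepFun hij
  have h2 := (ProbabilityTheory.indepFun_iff_map_prod_eq_prod_map_map (measurable_pi_apply i).aemeasurable
    (measurable_pi_apply j).aemeasurable).1 h1
  change Measure.map _ (pid g N) = (Measure.map _ (pid g N)).prod (Measure.map _ (pid g N)) at h2
  rw [(pid_eval hg i).map_eq, (pid_eval hg j).map_eq] at h2
  exact h2

lemma pid_inj {g A M} (hg : Nice g A M) (N : ℕ) : ∀ᵐ x ∂(pid g N), Function.Injective x := by
  have := hg.prob
  have h : ∀ i j : Fin N, ∀ᵐ x ∂(pid g N), i ≠ j → x i - x j ≠ 0 := by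
    intro i j
    by_cases hij : i = j
    · simp [hij]
    · have := (pid_pair hg i j hij).quasiMeasurePreserving.ae (prod_ae_ne (dm g) (g := g))
      exact this.mono fun x hx _ => hx
  have h' := ae_all_iff.2 fun i => ae_all_iff.2 (h i)
  refine h'.mono fun x hx i j hij => ?_
  by_contra hne
  exact hx i j hne (sub_eq_zero.2 hij)

lemma pid_pairSum {g A M} (hg : Nice g A M) {N : ℕ} (k : ℝ → ℝ) (hk : Measurable k)
    (hi : Integrable (fun p : ℝ × ℝ => k (p.1 - p.2)) ((dm g).prod (dm g))) :
    Integrable (fun x : Fin N → ℝ => pairSum k x) (pid g N) ∧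
    ∫ x, pairSum k x ∂(pid g N) = (N ^ 2 - N) / 2 * BB k (dm g) (dm g) := by
  have ii : ∀ p ∈ Finset.univ.filter (fun p : Fin N × Fin N => p.1 < p.2),
      Integrable (fun x : Fin N → ℝ => k (x p.1 - x p.2)) (pid g N) := by
    intro p hp
    simp only [Finset.mem_filter, Finset.mem_univ, true_and] at hp
    exact (pid_pair hg p.1 p.2 hp.ne).integrable_comp_of_integrable hi
  unfold pairSum
  refine ⟨integrable_finsetSum _ ii, ?_⟩
  rw [integral_finsetSum _ ii]
  have e : ∀ p ∈ Finset.univ.filter (fun p : Fin N × Fin N => p.1 < p.2),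
      ∫ x : Fin N → ℝ, k (x p.1 - x p.2) ∂(pid g N) = BB k (dm g) (dm g) := by
    intro p hp
    simp only [Finset.mem_filter, Finset.mem_univ, true_and] at hp
    unfold BB
    have hmp := pid_pair hg p.1 p.2 hp.ne
    rw [← hmp.map_eq, integral_map hmp.measurable.aemeasurable (by rw [hmp.map_eq]; exact hi.1)]
  rw [Finset.sum_congr rfl e]
  have s4 := double_sum (fun _ : Fin N => 0) (fun _ => BB k (dm g) (dm g)) (fun _ => rfl)
  simp only [Finset.sum_const, Finset.card_univ, Fintype.card_fin, nsmul_eq_mul] at s4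
  unfold pairSum at s4
  linarith

lemma HH_mean (β : ℝ) (h κ Q : ℝ → ℝ) (hκc : Continuous κ) (hκ0 : ∀ ω, 0 ≤ κ ω)
    (hκi : ∀ n : ℕ, Integrable (fun ω => |ω| ^ n * κ ω)) (hh : ∀ u, h u = ∫ ω, κ ω * cos (ω * u))
    (hQ : Continuous Q) {g a M} (hg : Nice g a M) (ℓ : ℝ) (hℓ : ∀ t, |t| ≤ a → Uf β h Q g t = ℓ) (N : ℕ) :
    Integrable (fun x : Fin N → ℝ => HH β h Q x) (pid g N) ∧
    ∫ x : Fin N → ℝ, HH β h Q x ∂(pid g N) = N ^ 2 * (ℓ - Jc β h g) - N * Jc β h g := by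
  obtain ⟨hc, he, hb⟩ := h_props h κ hκc hκ0 hκi hh
  have := hg.prob
  have := pid_prob hg N
  have iQ : Integrable Q (dm g) := by
    obtain ⟨B, hB⟩ := (isCompact_Icc (a := -a) (b := a)).bddAbove_image hQ.abs.continuousOn
    exact hg.int_of_bdd Q hQ.measurable B fun t ht => hB ⟨t, abs_le.1 ht, rfl⟩
  have ih : Integrable (fun p : ℝ × ℝ => h (p.1 - p.2)) ((dm g).prod (dm g)) :=
    Integrable.of_bound (C := h 0) (hc.measurable.comp (by fun_prop)).aestronglyMeasurable (Eventually.of_forall fun p => hb _)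
  have inl := hg.ker_int_prod nl nl_meas 2 nl_bd (dm g) hg.int_id
  obtain ⟨a1, a2⟩ := pid_pairSum hg (N := N) h hc.measurable ih
  obtain ⟨b1, b2⟩ := pid_pairSum hg (N := N) nl nl_meas inl
  have c1 : ∀ i : Fin N, Integrable (fun x : Fin N → ℝ => Q (x i)) (pid g N) := fun i =>
    (pid_eval hg i).integrable_comp_of_integrable iQ
  have c2 : ∀ i : Fin N, ∫ x : Fin N → ℝ, Q (x i) ∂(pid g N) = ∫ t, Q t ∂(dm g) := fun i => by
    have hmp := pid_eval hg i
    rw [← hmp.map_eq, integral_map hmp.measurable.aemeasurable (by rw [hmp.map_eq]; exact iQ.1)]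
  have c3 := integrable_finsetSum Finset.univ (fun i _ => c1 i)
  have hU : ∫ t, Uf β h Q g t ∂(dm g) = ℓ := by
    rw [dm_integral g hg.meas hg.nonneg]
    have : ∀ t, Uf β h Q g t * g t = ℓ * g t := fun t => by
      by_cases ht : |t| ≤ a
      · rw [hℓ t ht]
      · rw [hg.supp t (not_le.1 ht)]; simp
    simp only [this]
    rw [integral_const_mul, hg.one, mul_one]
  have hU2 : ∫ t, Uf β h Q g t ∂(dm g) = ∫ t, Q t ∂(dm g) + 2 * Jc β h g := by
    have p := Pot_int hg (dm g) hg.int_id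
    have q1 := ih.integral_prod_left
    unfold Uf
    rw [integral_sub (f := fun t => Q t + ∫ s, h (t - s) ∂(dm g)) (iQ.add q1) (p.1.const_mul β), integral_add iQ q1,
      integral_const_mul, p.2, ← BB_int_fst ih]
    unfold Jc; ring
  refine ⟨((c3.const_mul _).add a1).add (b1.const_mul _), ?_⟩
  unfold HH
  rw [integral_add (f := fun x : Fin N → ℝ => N * ∑ j, Q (x j) + pairSum h x) ((c3.const_mul _).add a1) (b1.const_mul _),
    integral_add (c3.const_mul _) a1, integral_const_mul, integral_const_mul, integral_finsetSum _ (fun i _ => c1 i), a2, b2]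
  simp only [c2, Finset.sum_const, Finset.card_univ, Fintype.card_fin, nsmul_eq_mul]
  have : ∫ t, Q t ∂(dm g) = ℓ - 2 * Jc β h g := by linarith
  rw [this]; unfold Jc; ring

lemma Z_lower {g a M} (hg : Nice g a M) (N : ℕ) (w H : (Fin N → ℝ) → ℝ) (hw : Integrable w) (hw0 : ∀ x, 0 ≤ w x)
    (hH : Integrable H (pid g N)) (hwH : ∀ᵐ x ∂(pid g N), w x = exp (- H x)) :
    exp (- ∫ x, H x ∂(pid g N)) ≤ M ^ N * ∫ x, w x := by
  have := pid_prob hg N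
  have hm := hg.meas
  have hpm : Measurable (fun x : Fin N → ℝ => ∏ i, g (x i)) :=
    Finset.measurable_prod _ fun i _ => hm.comp (measurable_pi_apply i)
  have hp0 : ∀ x : Fin N → ℝ, 0 ≤ ∏ i, g (x i) := fun x => Finset.prod_nonneg fun i _ => hg.nonneg _
  have hp1 : ∀ x : Fin N → ℝ, ∏ i, g (x i) ≤ M ^ N := fun x => by
    refine (Finset.prod_le_prod (fun i _ => hg.nonneg _) (fun i _ => hg.le (x i))).trans (le_of_eq (by simp))
  have i1 : Integrable (fun x => (∏ i, g (x i)) * w x) :=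
    hw.bdd_mul (c := M ^ N) hpm.aestronglyMeasurable (Eventually.of_forall fun x => by
      rw [norm_eq_abs, abs_of_nonneg (hp0 x)]; exact hp1 x)
  have i2 : Integrable w (pid g N) := by
    rw [pid_eq hg, integrable_withDensity_iff_integrable_smul' (by fun_prop) (Eventually.of_forall fun x => ENNReal.ofReal_lt_top)]
    refine i1.congr (Eventually.of_forall fun x => ?_)
    simp only [smul_eq_mul, ENNReal.toReal_ofReal (hp0 x)]
  have e2 : ∫ x, w x ∂(pid g N) = ∫ x, (∏ i, g (x i)) * w x := by
    rw [pid_eq hg, integral_withDensity_eq_integral_toReal_smul (by fun_prop) (Eventually.of_forall fun x => ENNReal.ofReal_lt_top)]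
    refine integral_congr_ae (Eventually.of_forall fun x => ?_)
    simp only [smul_eq_mul, ENNReal.toReal_ofReal (hp0 x)]
  set E := ∫ x, H x ∂(pid g N) with hE
  have i3 : Integrable (fun x => exp (-E) * ((1 + E) - H x)) (pid g N) := ((integrable_const _).sub hH).const_mul _
  calc exp (-E) = ∫ x, exp (-E) * ((1 + E) - H x) ∂(pid g N) := by
        rw [integral_const_mul, integral_sub (integrable_const _) hH, ← hE]; simp
    _ ≤ ∫ x, w x ∂(pid g N) := by
        refine integral_mono_ae i3 i2 (hwH.mono fun x hx => ?_)
        simp only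
        rw [hx]
        have := add_one_le_exp (E - H x)
        calc exp (-E) * (1 + E - H x) ≤ exp (-E) * exp (E - H x) := by
              refine mul_le_mul_of_nonneg_left ?_ (exp_pos _).le; linarith
          _ = _ := by rw [← exp_add]; ring_nf
    _ = ∫ x, (∏ i, g (x i)) * w x := e2
    _ ≤ ∫ x, M ^ N * w x := integral_mono i1 (hw.const_mul _) fun x => mul_le_mul_of_nonneg_right (hp1 x) (hw0 x)
    _ = _ := integral_const_mul _ _

lemma charFun_lip (μ : Measure ℝ) [IsProbabilityMeasure μ] (hμ : Integrable (fun x : ℝ => x) μ) (s t : ℝ) :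
    ‖charFun μ s - charFun μ t‖ ≤ |s - t| * ∫ x, |x| ∂μ := by
  rw [charFun_apply_real, charFun_apply_real]
  have ii : ∀ s : ℝ, Integrable (fun x : ℝ => Complex.exp (s * x * Complex.I)) μ := fun s => by
    refine Integrable.of_bound (C := 1) (by fun_prop) (Eventually.of_forall fun x => ?_)
    rw [show (s * x * Complex.I : ℂ) = ((s * x : ℝ) : ℂ) * Complex.I by push_cast; ring, Complex.norm_exp_ofReal_mul_I]
  rw [← integral_sub (ii s) (ii t), ← integral_const_mul]
  refine norm_integral_le_of_norm_le (hμ.abs.const_mul _) (Eventually.of_forall fun x => ?_)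
  have e : Complex.exp (s * x * Complex.I) - Complex.exp (t * x * Complex.I) =
      Complex.exp (((t * x : ℝ) : ℂ) * Complex.I) * (Complex.exp (Complex.I * (((s - t) * x : ℝ) : ℂ)) - 1) := by
    rw [mul_sub, ← Complex.exp_add, mul_one]; push_cast; ring_nf
  rw [e, norm_mul, Complex.norm_exp_ofReal_mul_I, one_mul, ← abs_mul]
  exact Real.norm_exp_I_mul_ofReal_sub_one_le

lemma we_lower (μ ν : Measure ℝ) [IsProbabilityMeasure μ] [IsProbabilityMeasure ν]
    (hμ : Integrable (fun x : ℝ => x) μ) (hν : Integrable (fun x : ℝ => x) ν) (w η ε : ℝ) (hw : 0 < w)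
    (hη : 0 < η) (hη1 : η ≤ 1) (hε : 0 < ε) (hε1 : ε ≤ 1) :
    η / ((w + 1) * exp (w + 1)) * (‖charFun μ w - charFun ν w‖ ^ 2 - 4 * η * (∫ x, |x| ∂μ + ∫ x, |x| ∂ν))
      ≤ we ε μ ν := by
  have i1 := (Lk_quad ε hε μ ν hμ hν).1
  set m := ∫ x, |x| ∂μ + ∫ x, |x| ∂ν with hm
  have m0 : 0 ≤ m := add_nonneg (integral_nonneg fun _ => abs_nonneg _) (integral_nonneg fun _ => abs_nonneg _)
  set K := (w + 1) * exp (w + 1) with hK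
  have K0 : 0 < K := by positivity
  set F := fun s => ‖charFun μ s - charFun ν s‖ ^ 2 with hF
  have hsub : Set.Ioc w (w + η) ⊆ Set.Ioi (0:ℝ) := fun s hs => hw.trans hs.1
  have i2 : IntegrableOn (fun ω => wE ε ω * F ω) (Set.Ioc w (w + η)) := IntegrableOn.mono_set i1 hsub
  have s1 : ∫ ω in Set.Ioc w (w + η), wE ε ω * F ω ≤ we ε μ ν := by
    refine setIntegral_mono_set i1 ?_ (Eventually.of_forall hsub)
    refine (ae_restrict_iff' measurableSet_Ioi).2 (Eventually.of_forall fun ω hω => ?_)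
    have : 0 < ω := hω
    simp only [wE, Pi.zero_apply]; positivity
  refine le_trans ?_ s1
  have s2 : ∫ _ω in Set.Ioc w (w + η), (1 / K * (F w - 4 * η * m)) = η / K * (F w - 4 * η * m) := by
    rw [setIntegral_const]
    simp only [Measure.real, Real.volume_Ioc, smul_eq_mul]
    rw [ENNReal.toReal_ofReal (by linarith)]; ring
  rw [← s2]
  refine setIntegral_mono_on (integrable_const _) i2 measurableSet_Ioc fun s hs => ?_
  have hs0 : 0 < s := hw.trans hs.1
  have hwE : 1 / K ≤ wE ε s := by
    unfold wE
    rw [one_div, hK, mul_inv, ← exp_neg, mul_comm, div_eq_mul_inv]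
    have h1 : s ≤ w + 1 := by linarith [hs.2]
    refine mul_le_mul (exp_le_exp.2 ?_) (inv_anti₀ hs0 h1) (by positivity) (by positivity)
    nlinarith
  have hF0 : 0 ≤ F s := by positivity
  have hFd : F w - 4 * η * m ≤ F s := by
    have b1 : ‖charFun μ w - charFun ν w‖ ≤ 2 := (norm_sub_le _ _).trans (by
      have := norm_charFun_le_one (μ := μ) w
      have := norm_charFun_le_one (μ := ν) w
      linarith)
    have b2 : ‖charFun μ s - charFun ν s‖ ≤ 2 := (norm_sub_le _ _).trans (by
      have := norm_charFun_le_one (μ := μ) s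
      have := norm_charFun_le_one (μ := ν) s
      linarith)
    have b3 : ‖charFun μ w - charFun ν w‖ - ‖charFun μ s - charFun ν s‖ ≤ η * m := by
      refine (norm_sub_norm_le _ _).trans ?_
      have c1 := charFun_lip μ hμ w s
      have c2 := charFun_lip ν hν w s
      have hd : |w - s| ≤ η := by rw [abs_sub_comm, abs_of_pos (sub_pos.2 hs.1)]; linarith [hs.2]
      calc _ = ‖(charFun μ w - charFun μ s) - (charFun ν w - charFun ν s)‖ := by congr 1; ring
        _ ≤ _ := norm_sub_le _ _
        _ ≤ |w - s| * m := by rw [hm, mul_add]; exact add_le_add c1 c2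
        _ ≤ _ := mul_le_mul_of_nonneg_right hd m0
    have n1 := norm_nonneg (charFun μ w - charFun ν w)
    have n2 := norm_nonneg (charFun μ s - charFun ν s)
    have hem : 0 ≤ η * m := by positivity
    simp only [hF]
    nlinarith
  calc 1 / K * (F w - 4 * η * m) ≤ 1 / K * F s := mul_le_mul_of_nonneg_left hFd (by positivity)
    _ ≤ _ := mul_le_mul_of_nonneg_right hwE hF0

lemma Vv_nonneg (v : ℝ → ℝ) (hv : ∀ t, 0 ≤ v t) (t : ℝ) : 0 ≤ Vv v t := by
  unfold Vv
  rcases le_total 0 t with ht | ht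
  · exact intervalIntegral.integral_nonneg ht fun s hs => mul_nonneg (by linarith [hs.2]) (hv s)
  · rw [intervalIntegral.integral_symm, ← intervalIntegral.integral_neg]
    refine intervalIntegral.integral_nonneg ht fun s hs => ?_
    have := mul_nonneg (sub_nonneg.2 hs.1) (hv s)
    linarith

lemma Q_lower (Q : ℝ → ℝ) (hQ : ∀ x, AnalyticAt ℝ Q x) (c : ℝ) (hc : ∀ t, c ≤ iteratedDeriv 2 Q t) (t : ℝ) :
    Q 0 + deriv Q 0 * t + c / 2 * t ^ 2 ≤ Q t := by
  have hQs : ContDiff ℝ 2 Q := contDiff_iff_contDiffAt.2 fun x => (hQ x).contDiffAt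
  have d1 : ∀ t, HasDerivAt Q (deriv Q t) t := fun t => (hQ t).differentiableAt.hasDerivAt
  have d2 : ∀ t, HasDerivAt (deriv Q) (iteratedDeriv 2 Q t) t := fun t => by
    rw [iteratedDeriv_succ, iteratedDeriv_one]
    exact (hQ t).deriv.differentiableAt.hasDerivAt
  have hcont : Continuous (iteratedDeriv 2 Q) := hQs.continuous_iteratedDeriv 2 le_rfl
  have h := Vv_of_deriv (fun t => Q t - deriv Q 0 * t - c / 2 * t ^ 2) (fun t => deriv Q t - deriv Q 0 - c * t)
    (fun t => iteratedDeriv 2 Q t - c)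
    (fun t => (((d1 t).sub ((hasDerivAt_id t).const_mul _)).sub (((hasDerivAt_id t).pow 2).const_mul _)).congr_deriv
      (by simp only [id]; ring))
    (fun t => (((d2 t).sub_const _).sub ((hasDerivAt_id t).const_mul c)).congr_deriv (by ring))
    (by fun_prop) (by simp) t
  have h2 := Vv_nonneg (fun t => iteratedDeriv 2 Q t - c) (fun t => by linarith [hc t]) t
  rw [h] at h2
  norm_num at h2
  linarith

lemma Pot_le {g a M} (hg : Nice g a M) (t : ℝ) : Pot g t ≤ |t| + a := by
  have := hg.prob
  have ii := hg.ker_int (fun u => log |u|) log_meas 2 abs_log_le t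
  unfold Pot
  have i2 : Integrable (fun s => |t - s|) (dm g) := ((integrable_const t).sub hg.int_id).abs
  calc ∫ s, log |t - s| ∂(dm g) ≤ ∫ s, (|t| + a) ∂(dm g) := by
        rw [dm_integral g hg.meas hg.nonneg, dm_integral g hg.meas hg.nonneg]
        rw [dm_integrable g hg.meas hg.nonneg] at ii
        refine integral_mono ii (hg.int.const_mul _) fun s => ?_
        by_cases hs : |s| ≤ a
        · refine mul_le_mul_of_nonneg_right ?_ (hg.nonneg s)
          have h1 := log_le_self (abs_nonneg (t - s))
          have h2 := abs_sub t s
          linarith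
        · simp only [hg.supp s (not_le.1 hs), mul_zero, le_refl]
    _ = _ := by simp

lemma Uf_meas (β : ℝ) (h Q g : ℝ → ℝ) (hh : Measurable h) (hQ : Measurable Q) {a M} (hg : Nice g a M) :
    Measurable (Uf β h Q g) := by
  have := hg.prob
  have h1 : Measurable (fun t => ∫ s, h (t - s) ∂(dm g)) := by
    have : StronglyMeasurable (fun p : ℝ × ℝ => h (p.1 - p.2)) := (hh.comp (by fun_prop)).stronglyMeasurable
    exact this.integral_prod_right'.measurable
  have h2 : Measurable (fun t => Pot g t) := by
    have : StronglyMeasurable (fun p : ℝ × ℝ => log |p.1 - p.2|) := by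
      apply Measurable.stronglyMeasurable; fun_prop
    exact this.integral_prod_right'.measurable
  exact (hQ.add h1).sub (h2.const_mul β)

lemma Uf_growth (β : ℝ) (hβ : 0 < β) (h Q g : ℝ → ℝ) (hb : ∀ u, |h u| ≤ h 0)
    (hQ : ∀ x, AnalyticAt ℝ Q x) (c : ℝ) (hc0 : 0 < c) (hcQ : ∀ t, c ≤ iteratedDeriv 2 Q t) {a M} (hg : Nice g a M)
    (ℓ : ℝ) : ∃ C1, ∀ t, |t| ≤ Uf β h Q g t - ℓ + C1 := by
  have := hg.prob
  set B := |deriv Q 0| + β + 1 with hB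
  refine ⟨ℓ - Q 0 + h 0 + β * a + B ^ 2 / (2 * c), fun t => ?_⟩
  have h1 := Q_lower Q hQ c hcQ t
  have h2 := mul_le_mul_of_nonneg_left (Pot_le hg t) hβ.le
  have h3 : - h 0 ≤ ∫ s, h (t - s) ∂(dm g) := by
    have := norm_integral_le_of_norm_le_const (μ := dm g) (f := fun s => h (t - s)) (C := h 0)
      (Eventually.of_forall fun s => hb _)
    simp only [norm_eq_abs, probReal_univ, mul_one] at this
    linarith [(abs_le.1 this).1]
  have h4 : -(|deriv Q 0| * |t|) ≤ deriv Q 0 * t := by rw [← abs_mul]; exact neg_abs_le _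
  have h5 : B * |t| ≤ c / 2 * t ^ 2 + B ^ 2 / (2 * c) := by
    have e : c / 2 * t ^ 2 + B ^ 2 / (2 * c) - B * |t| = (c * |t| - B) ^ 2 / (2 * c) := by
      rw [← sq_abs t]; field_simp; ring
    have : 0 ≤ (c * |t| - B) ^ 2 / (2 * c) := by positivity
    linarith
  have h6 : B * |t| = |deriv Q 0| * |t| + β * |t| + |t| := by rw [hB]; ring
  unfold Uf
  nlinarith

lemma weightH_inj (β : ℝ) (h Q : ℝ → ℝ) {N : ℕ} (x : Fin N → ℝ) (hx : Function.Injective x) :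
    weightH β Q h N x = exp (- HH β h Q x) := by
  unfold weightH vdm
  have e : ∏ p ∈ Finset.univ.filter (fun p : Fin N × Fin N => p.1 < p.2), |x p.1 - x p.2| ^ β =
      exp (- (β * pairSum nl x)) := by
    unfold pairSum
    rw [Finset.mul_sum, ← Finset.sum_neg_distrib, exp_sum]
    refine Finset.prod_congr rfl fun p hp => ?_
    simp only [Finset.mem_filter, Finset.mem_univ, true_and] at hp
    rw [rpow_def_of_pos (abs_pos.2 (sub_ne_zero.2 fun he => hp.ne (hx he)))]
    unfold nl; ring_nf
  rw [e, ← exp_add]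
  unfold HH; ring_nf

lemma weightH_ninj (β : ℝ) (hβ : 0 < β) (h Q : ℝ → ℝ) {N : ℕ} (x : Fin N → ℝ) (hx : ¬ Function.Injective x) :
    weightH β Q h N x = 0 := by
  unfold weightH vdm
  rw [Function.not_injective_iff] at hx
  obtain ⟨i, j, he, hne⟩ := hx
  rw [mul_eq_zero]; left
  rcases lt_or_gt_of_ne hne with hl | hl
  · refine Finset.prod_eq_zero (i := (i, j)) (by simpa using hl) ?_
    simp [he, hβ.ne']
  · refine Finset.prod_eq_zero (i := (j, i)) (by simpa using hl) ?_
    simp [he, hβ.ne']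

lemma weightH_nonneg (β : ℝ) (h Q : ℝ → ℝ) {N : ℕ} (x : Fin N → ℝ) : 0 ≤ weightH β Q h N x := by
  unfold weightH vdm; positivity

lemma weightH_meas (β : ℝ) (h Q : ℝ → ℝ) (hh : Measurable h) (hQ : Measurable Q) (N : ℕ) :
    Measurable (weightH β Q h N) := by
  unfold weightH vdm pairSum
  refine Measurable.mul (Finset.measurable_prod _ fun p _ => by fun_prop) ?_
  refine Real.measurable_exp.comp (Measurable.sub ?_ (Finset.measurable_sum _ fun p _ => by fun_prop))
  exact (Finset.measurable_sum _ fun p _ => by fun_prop).const_mul _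

/-- bundled data -/
structure St (β : ℝ) (h κ Q g : ℝ → ℝ) (a M ℓ C1 : ℝ) : Prop where
  hβ : 0 < β
  κc : Continuous κ
  κ0 : ∀ ω, 0 ≤ κ ω
  κi : ∀ n : ℕ, Integrable (fun ω => |ω| ^ n * κ ω)
  hh : ∀ u, h u = ∫ ω, κ ω * cos (ω * u)
  hc : Continuous h
  Qc : Continuous Q
  ng : Nice g a M
  eq : ∀ t, |t| ≤ a → Uf β h Q g t = ℓ
  ge : ∀ t, ℓ ≤ Uf β h Q g t
  gr : ∀ t, |t| ≤ Uf β h Q g t - ℓ + C1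

/-- squared distance of characteristic functions -/
def Fw (g : ℝ → ℝ) (w : ℝ) {N : ℕ} (x : Fin N → ℝ) : ℝ := ‖charFun (emp x) w - charFun (dm g) w‖ ^ 2

/-- first moment constant -/
def C2 (g : ℝ → ℝ) (C1 : ℝ) : ℝ := C1 + ∫ x, |x| ∂(dm g)

/-- θ -/
def th (β w η : ℝ) : ℝ := β / 2 * (η / ((w + 1) * exp (w + 1)))

/-- δ -/
def dl (β M ε : ℝ) : ℝ := 2 * β * √ε * (1 + M * K0)

lemma St.HH_lower {β h κ Q g a M ℓ C1} (S : St β h κ Q g a M ℓ C1) {N : ℕ} (hN : 0 < N) (x : Fin N → ℝ)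
    (hx : Function.Injective x) (w η ε : ℝ) (hw : 0 < w) (hη : 0 < η) (hη1 : η ≤ 1) (hηβ : β * η ^ 2 ≤ 1 / 4)
    (hε : 0 < ε) (hε1 : ε ≤ 1) :
    N ^ 2 * (ℓ - Jc β h g) + N / 2 * ∑ i, (Uf β h Q g (x i) - ℓ) + N ^ 2 * (th β w η * Fw g w x)
      - N ^ 2 * (4 * η * th β w η * C2 g C1 + dl β M ε) - N * (h 0 / 2 - β / 2 * log ε) ≤ HH β h Q x := by
  have hβ := S.hβ
  have := S.ng.prob
  have := emp_prob hN x
  have e1 := energy_lower β S.hβ h κ Q S.κc S.κ0 S.κi S.hh S.ng hN x hx ε hε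
  have e2 := we_lower (emp x) (dm g) (emp_int hN x _) S.ng.int_id w η ε hw hη hη1 hε hε1
  have hN' : (0:ℝ) < N := by exact_mod_cast hN
  set K := (w + 1) * exp (w + 1) with hK
  have K1 : 1 ≤ K := by
    have : 1 ≤ exp (w + 1) := one_le_exp (by linarith)
    nlinarith
  set s := ∑ i, (Uf β h Q g (x i) - ℓ) with hs
  have s0 : 0 ≤ s := Finset.sum_nonneg fun i _ => sub_nonneg.2 (S.ge _)
  have hm : ∫ t, |t| ∂(emp x) ≤ (N:ℝ)⁻¹ * s + C1 := by
    rw [emp_integral hN, smul_eq_mul]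
    have : ∑ i, |x i| ≤ s + N * C1 := by
      rw [hs]
      calc ∑ i, |x i| ≤ ∑ i, (Uf β h Q g (x i) - ℓ + C1) := Finset.sum_le_sum fun i _ => S.gr _
        _ = _ := by rw [Finset.sum_add_distrib]; simp
    calc (N:ℝ)⁻¹ * ∑ i, |x i| ≤ (N:ℝ)⁻¹ * (s + N * C1) := mul_le_mul_of_nonneg_left this (by positivity)
      _ = _ := by field_simp
  have hth : th β w η = β / 2 * (η / K) := rfl
  have hth0 : 0 ≤ th β w η := by rw [hth]; positivity
  have hsm : 4 * η * th β w η ≤ 1 / 2 := by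
    have : η / K ≤ η := div_le_self hη.le K1
    rw [hth]
    calc 4 * η * (β / 2 * (η / K)) ≤ 4 * η * (β / 2 * η) := by gcongr
      _ = 2 * (β * η ^ 2) := by ring
      _ ≤ _ := by linarith
  have hsum : ∑ i, Uf β h Q g (x i) = s + N * ℓ := by rw [hs, Finset.sum_sub_distrib]; simp
  have e3 : th β w η * (Fw g w x - 4 * η * ((N:ℝ)⁻¹ * s + C2 g C1)) ≤ β / 2 * we ε (emp x) (dm g) := by
    have := mul_le_mul_of_nonneg_left e2 (show 0 ≤ β / 2 by positivity)
    refine le_trans ?_ this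
    rw [hth, mul_assoc]
    refine mul_le_mul_of_nonneg_left (mul_le_mul_of_nonneg_left ?_ (by positivity)) (by positivity)
    unfold Fw C2
    have := mul_le_mul_of_nonneg_left hm (show 0 ≤ 4 * η by positivity)
    linarith
  have e4 := mul_le_mul_of_nonneg_left e3 (show 0 ≤ (N:ℝ) ^ 2 by positivity)
  have e5 : (N:ℝ) ^ 2 * (th β w η * (Fw g w x - 4 * η * ((N:ℝ)⁻¹ * s + C2 g C1))) =
      N ^ 2 * (th β w η * Fw g w x) - N * ((4 * η * th β w η) * s) - N ^ 2 * (4 * η * th β w η * C2 g C1) := by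
    field_simp; ring
  have e6 : N * ((4 * η * th β w η) * s) ≤ N * (1 / 2 * s) := by gcongr
  rw [e5] at e4
  rw [hsum] at e1
  unfold dl
  linarith

lemma St.D_int {β h κ Q g a M ℓ C1} (S : St β h κ Q g a M ℓ C1) :
    Integrable (fun t => exp (-(1 / 2 * (Uf β h Q g t - ℓ)))) := by
  have hm := Uf_meas β h Q g S.hc.measurable S.Qc.measurable S.ng
  have i0 : Integrable (fun t : ℝ => exp (-(1/2) * |t|)) := by
    refine (integrable_inv_one_add_sq.const_mul 8).mono' (by fun_prop) (Eventually.of_forall fun t => ?_)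
    rw [norm_eq_abs, abs_of_pos (exp_pos _), show -(1/2) * |t| = -(|t| / 2) by ring, exp_neg]
    have h1 := quadratic_le_exp_of_nonneg (show 0 ≤ |t| / 2 by positivity)
    have h2 : (1 + t ^ 2) / 8 ≤ exp (|t| / 2) := by
      have := abs_nonneg t
      rw [← sq_abs t]; nlinarith
    calc (exp (|t| / 2))⁻¹ ≤ ((1 + t ^ 2) / 8)⁻¹ := inv_anti₀ (by positivity) h2
      _ = _ := by rw [inv_div]; rfl
  refine (i0.const_mul (exp (C1 / 2))).mono' (by fun_prop) (Eventually.of_forall fun t => ?_)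
  rw [norm_eq_abs, abs_of_pos (exp_pos _), ← exp_add]
  refine exp_le_exp.2 ?_
  linarith [S.gr t]

lemma St.M_pos {β h κ Q g a M ℓ C1} (S : St β h κ Q g a M ℓ C1) : 0 < M := by
  rcases S.ng.Mnn.lt_or_eq with hM | hM
  · exact hM
  · exfalso
    have h0 : ∀ t, g t = 0 := fun t => le_antisymm (hM ▸ S.ng.le t) (S.ng.nonneg t)
    have := S.ng.one
    simp [h0] at this

lemma St.w_le {β h κ Q g a M ℓ C1} (S : St β h κ Q g a M ℓ C1) {N : ℕ} (hN : 0 < N) (x : Fin N → ℝ)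
    (w η ε : ℝ) (hw : 0 < w) (hη : 0 < η) (hη1 : η ≤ 1) (hηβ : β * η ^ 2 ≤ 1 / 4)
    (hε : 0 < ε) (hε1 : ε ≤ 1) :
    exp (N ^ 2 * (th β w η * Fw g w x)) * weightH β Q h N x ≤ 
      exp (-(N ^ 2 * (ℓ - Jc β h g)) + (N ^ 2 * (4 * η * th β w η * C2 g C1 + dl β M ε) + N * (h 0 / 2 - β / 2 * log ε))) *
        ∏ i, exp (-(1 / 2 * (Uf β h Q g (x i) - ℓ))) := by
  by_cases hx : Function.Injective x
  · rw [weightH_inj β h Q x hx, ← exp_sum, ← exp_add, ← exp_add]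
    refine exp_le_exp.2 ?_
    have e := S.HH_lower hN x hx w η ε hw hη hη1 hηβ hε hε1
    have s0 : 0 ≤ ∑ i, (Uf β h Q g (x i) - ℓ) := Finset.sum_nonneg fun i _ => sub_nonneg.2 (S.ge _)
    have hN' : (1:ℝ) ≤ N := by exact_mod_cast hN
    rw [Finset.sum_neg_distrib, ← Finset.mul_sum]
    nlinarith
  · rw [weightH_ninj β S.hβ h Q x hx, mul_zero]; positivity

lemma St.w_int {β h κ Q g a M ℓ C1} (S : St β h κ Q g a M ℓ C1) {N : ℕ} (hN : 0 < N) :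
    Integrable (weightH β Q h N) := by
  have hβ := S.hβ
  obtain ⟨η, hη, hη1, hηβ⟩ : ∃ η : ℝ, 0 < η ∧ η ≤ 1 ∧ β * η ^ 2 ≤ 1 / 4 := by
    refine ⟨1 / (2 * (β + 1)), by positivity, by rw [div_le_one (by positivity)]; linarith, ?_⟩
    rw [div_pow, one_pow, mul_one_div, div_le_iff₀ (by positivity)]; nlinarith
  have i1 : Integrable (fun x : Fin N → ℝ => ∏ i, exp (-(1 / 2 * (Uf β h Q g (x i) - ℓ)))) :=
    Integrable.fintype_prod fun _ => S.D_int
  refine (i1.const_mul (exp (-(N ^ 2 * (ℓ - Jc β h g)) + (N ^ 2 * (4 * η * th β 1 η * C2 g C1 + dl β M 1) +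
    N * (h 0 / 2 - β / 2 * log 1))))).mono' (weightH_meas β h Q S.hc.measurable S.Qc.measurable N).aestronglyMeasurable
    (Eventually.of_forall fun x => ?_)
  · rw [norm_eq_abs, abs_of_nonneg (weightH_nonneg β h Q x)]
    refine le_trans ?_ (S.w_le hN x 1 η 1 one_pos hη hη1 hηβ one_pos le_rfl)
    refine le_mul_of_one_le_left (weightH_nonneg β h Q x) (one_le_exp ?_)
    unfold th Fw; positivity

lemma St.Z_low {β h κ Q g a M ℓ C1} (S : St β h κ Q g a M ℓ C1) {N : ℕ} (hN : 0 < N) :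
    exp (-(N ^ 2 * (ℓ - Jc β h g) - N * Jc β h g)) ≤ M ^ N * ZH β Q h N := by
  obtain ⟨h1, h2⟩ := HH_mean β h κ Q S.κc S.κ0 S.κi S.hh S.Qc S.ng ℓ S.eq N
  rw [← h2]
  exact Z_lower S.ng N (weightH β Q h N) (fun x => HH β h Q x) (S.w_int hN) (weightH_nonneg β h Q) h1
    ((pid_inj S.ng N).mono fun x hx => weightH_inj β h Q x hx)

lemma Fw_eq (w : ℝ) {N : ℕ} (hN : 0 < N) (x : Fin N → ℝ) :
    charFun (emp x) w = (N : ℝ)⁻¹ • ∑ i, Complex.exp (w * x i * Complex.I) := by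
  rw [charFun_apply_real, emp_integral hN]

lemma Fw_meas {g : ℝ → ℝ} (w : ℝ) {N : ℕ} (hN : 0 < N) : Measurable (fun x : Fin N → ℝ => Fw g w x) := by
  unfold Fw
  simp only [Fw_eq w hN]
  fun_prop

lemma St.EF {β h κ Q g a M ℓ C1} (S : St β h κ Q g a M ℓ C1) {N : ℕ} (hN : 0 < N)
    (w η ε : ℝ) (hw : 0 < w) (hη : 0 < η) (hη1 : η ≤ 1) (hηβ : β * η ^ 2 ≤ 1 / 4)
    (hε : 0 < ε) (hε1 : ε ≤ 1) :
    ∫ x : Fin N → ℝ, Fw g w x * PH β Q h N x ≤ 4 * η * C2 g C1 + dl β M ε / th β w η +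
      ((log M + log (∫ t, exp (-(1 / 2 * (Uf β h Q g t - ℓ)))) - Jc β h g + (h 0 / 2 - β / 2 * log ε)) * (N : ℝ)⁻¹
        + ((N : ℝ)⁻¹) ^ 2) / th β w η := by
  have := S.ng.prob
  have hβ := S.hβ
  have hM := S.M_pos
  have hN' : (0:ℝ) < N := by exact_mod_cast hN
  have hZ : 0 < ZH β Q h N := by
    have h1 := S.Z_low hN
    have h2 : 0 < M ^ N * ZH β Q h N := (exp_pos _).trans_le h1
    exact (pos_iff_pos_of_mul_pos h2).1 (by positivity)
  set D := ∫ t, exp (-(1 / 2 * (Uf β h Q g t - ℓ))) with hD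
  have hD0 : 0 < D := integral_exp_pos S.D_int
  set T := th β w η with hT
  have hT0 : 0 < T := by rw [hT]; unfold th; positivity
  set R := 4 * η * T * C2 g C1 + dl β M ε with hR
  set c := h 0 / 2 - β / 2 * log ε with hcdef
  set J := Jc β h g with hJ
  set A := N * log M - N * J + N ^ 2 * R + N * c + N * log D with hA
  have iw := S.w_int hN
  have iP : Integrable (PH β Q h N) := iw.div_const _
  have hP0 : ∀ x, 0 ≤ PH β Q h N x := fun x => div_nonneg (weightH_nonneg β h Q x) hZ.le
  have hP1 : ∫ x, PH β Q h N x = 1 := by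
    unfold PH; rw [integral_div]; exact div_self hZ.ne'
  have i1 : Integrable (fun x : Fin N → ℝ => ∏ i, exp (-(1 / 2 * (Uf β h Q g (x i) - ℓ)))) :=
    Integrable.fintype_prod fun _ => S.D_int
  have v1 : ∫ x : Fin N → ℝ, ∏ i, exp (-(1 / 2 * (Uf β h Q g (x i) - ℓ))) = D ^ N := by
    rw [integral_fintype_prod_volume_eq_pow (fun t => exp (-(1 / 2 * (Uf β h Q g t - ℓ))))]; simp [hD]
  have iF : Integrable (fun x : Fin N → ℝ => Fw g w x * PH β Q h N x) := by
    refine iP.bdd_mul (c := 4) (Fw_meas w hN).aestronglyMeasurable (Eventually.of_forall fun x => ?_)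
    have := emp_prob hN x
    have h4 := charFun_sub_le (emp x) (dm g) w
    unfold Fw
    rw [norm_eq_abs, abs_of_nonneg (by positivity)]; exact h4
  have pt : ∀ x : Fin N → ℝ, N ^ 2 * T * (Fw g w x * PH β Q h N x) ≤
      A * PH β Q h N x + exp (- (N * log D)) * ∏ i, exp (-(1 / 2 * (Uf β h Q g (x i) - ℓ))) := by
    intro x
    have b1 := S.w_le hN x w η ε hw hη hη1 hηβ hε hε1
    have b2 : exp (N ^ 2 * (T * Fw g w x)) * PH β Q h N x ≤ exp (A - N * log D) * ∏ i, exp (-(1 / 2 * (Uf β h Q g (x i) - ℓ))) := by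
      unfold PH
      rw [← mul_div_assoc, div_le_iff₀ hZ]
      refine b1.trans ?_
      rw [mul_right_comm (exp (A - N * log D))]
      refine mul_le_mul_of_nonneg_right ?_ (Finset.prod_nonneg fun i _ => (exp_pos _).le)
      have z := S.Z_low hN
      have hMe : M ^ N = exp (N * log M) := by rw [mul_comm, exp_mul, exp_log hM, rpow_natCast]
      rw [hMe] at z
      calc _ = exp (N ^ 2 * R + N * c - N * J) * exp (-(N ^ 2 * (ℓ - J) - N * J)) := by
            rw [← exp_add]; congr 1; ring
        _ ≤ exp (N ^ 2 * R + N * c - N * J) * (exp (N * log M) * ZH β Q h N) :=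
            mul_le_mul_of_nonneg_left z (exp_pos _).le
        _ = _ := by rw [← mul_assoc, ← exp_add]; congr 2; rw [hA]; ring
    have b3 : N ^ 2 * (T * Fw g w x) ≤ A + exp (N ^ 2 * (T * Fw g w x) - A) := by
      have := add_one_le_exp (N ^ 2 * (T * Fw g w x) - A); linarith
    calc N ^ 2 * T * (Fw g w x * PH β Q h N x) = (N ^ 2 * (T * Fw g w x)) * PH β Q h N x := by ring
      _ ≤ (A + exp (N ^ 2 * (T * Fw g w x) - A)) * PH β Q h N x := mul_le_mul_of_nonneg_right b3 (hP0 x)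
      _ = A * PH β Q h N x + exp (-A) * (exp (N ^ 2 * (T * Fw g w x)) * PH β Q h N x) := by
          rw [sub_eq_add_neg, exp_add]; ring
      _ ≤ A * PH β Q h N x + exp (-A) * (exp (A - N * log D) * ∏ i, exp (-(1 / 2 * (Uf β h Q g (x i) - ℓ)))) := by
          gcongr
      _ = _ := by rw [← mul_assoc (exp (-A)), ← exp_add]; congr 3; ring
  have fin := integral_mono (iF.const_mul (N ^ 2 * T)) ((iP.const_mul A).add (i1.const_mul (exp (- (N * log D))))) pt
  have ev : ∫ x : Fin N → ℝ, (A * PH β Q h N x + exp (- (N * log D)) * ∏ i, exp (-(1 / 2 * (Uf β h Q g (x i) - ℓ)))) = A + 1 := by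
    rw [integral_add (iP.const_mul A) (i1.const_mul _), integral_const_mul, integral_const_mul, hP1, v1, mul_one]
    congr 1
    rw [exp_neg, mul_comm (N:ℝ), exp_mul, exp_log hD0, rpow_natCast, inv_mul_cancel₀ (by positivity)]
  rw [integral_const_mul] at fin
  have fin2 : N ^ 2 * T * ∫ x : Fin N → ℝ, Fw g w x * PH β Q h N x ≤ A + 1 := fin.trans ev.le
  have : ∫ x : Fin N → ℝ, Fw g w x * PH β Q h N x ≤ (A + 1) / (N ^ 2 * T) := by
    rw [le_div_iff₀ (by positivity), mul_comm]; exact fin2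
  refine this.trans (le_of_eq ?_)
  rw [hA, hR]; field_simp; ring

lemma dl_tendsto (β M c : ℝ) : Tendsto (fun ε => dl β M ε / c) (𝓝[>] 0) (𝓝 0) := by
  have h : Continuous (fun ε => dl β M ε / c) := by unfold dl; fun_prop
  have := h.tendsto 0
  have e : dl β M 0 / c = 0 := by simp [dl]
  rw [e] at this
  exact this.mono_left nhdsWithin_le_nhds

lemma St.EF_tendsto {β h κ Q g a M ℓ C1} (S : St β h κ Q g a M ℓ C1) (w : ℝ) (hw : 0 < w) (τ : ℝ) (hτ : 0 < τ) :
    ∀ᶠ N : ℕ in atTop, ∫ x : Fin N → ℝ, Fw g w x * PH β Q h N x < τ := by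
  have hβ := S.hβ
  have t1 : Tendsto (fun η : ℝ => 4 * η * C2 g C1) (𝓝[>] 0) (𝓝 0) := by
    have h : Continuous (fun η : ℝ => 4 * η * C2 g C1) := by fun_prop
    have := h.tendsto 0
    simp only [mul_zero, zero_mul] at this
    exact this.mono_left nhdsWithin_le_nhds
  have t2 : Tendsto (fun η : ℝ => β * η ^ 2) (𝓝[>] 0) (𝓝 0) := by
    have h : Continuous (fun η : ℝ => β * η ^ 2) := by fun_prop
    have := h.tendsto 0
    norm_num at this
    exact this.mono_left nhdsWithin_le_nhds
  have t3 : Tendsto (fun η : ℝ => η) (𝓝[>] 0) (𝓝 0) := tendsto_id.mono_left nhdsWithin_le_nhds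
  obtain ⟨η, h1, h2, h3, h4⟩ := ((t1.eventually (gt_mem_nhds (show (0:ℝ) < τ / 3 by positivity))).and
    ((t2.eventually (gt_mem_nhds (show (0:ℝ) < 1 / 4 by positivity))).and
    ((t3.eventually (gt_mem_nhds (show (0:ℝ) < 1 by positivity))).and self_mem_nhdsWithin))).exists
  obtain ⟨ε, g1, g2, g3⟩ := (((dl_tendsto β M (th β w η)).eventually (gt_mem_nhds (show (0:ℝ) < τ / 3 by positivity))).and
    ((t3.eventually (gt_mem_nhds (show (0:ℝ) < 1 by positivity))).and self_mem_nhdsWithin)).exists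
  have t4 : Tendsto (fun N : ℕ => ((log M + log (∫ t, exp (-(1 / 2 * (Uf β h Q g t - ℓ)))) - Jc β h g +
      (h 0 / 2 - β / 2 * log ε)) * (N : ℝ)⁻¹ + ((N : ℝ)⁻¹) ^ 2) / th β w η) atTop (𝓝 0) := by
    have i : Tendsto (fun N : ℕ => (N : ℝ)⁻¹) atTop (𝓝 0) := tendsto_inv_atTop_nhds_zero_nat
    have := ((i.const_mul (log M + log (∫ t, exp (-(1 / 2 * (Uf β h Q g t - ℓ)))) - Jc β h g +
      (h 0 / 2 - β / 2 * log ε))).add (i.pow 2)).div_const (th β w η)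
    norm_num at this
    convert this using 2
    norm_num
  filter_upwards [t4.eventually (gt_mem_nhds (show (0:ℝ) < τ / 3 by positivity)), eventually_gt_atTop 0] with N k1 k2
  have := S.EF k2 w η ε hw h4 h3.le h2.le g3 g2.le
  linarith

lemma pairSum_perm {N : ℕ} (k : ℝ → ℝ) (hk : ∀ u, k (-u) = k u) (σ : Equiv.Perm (Fin N)) (x : Fin N → ℝ) :
    pairSum k (x ∘ σ) = pairSum k x := by
  have h1 := double_sum x k hk
  have h2 := double_sum (x ∘ σ) k hk
  have h3 : ∑ i, ∑ j, k ((x ∘ σ) i - (x ∘ σ) j) = ∑ i, ∑ j, k (x i - x j) := by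
    simp only [Function.comp]
    rw [← Equiv.sum_comp σ (fun i => ∑ j, k (x i - x j))]
    refine Finset.sum_congr rfl fun i _ => ?_
    exact Equiv.sum_comp σ (fun j => k (x (σ i) - x j))
  linarith

lemma PH_perm (β : ℝ) (hβ : 0 < β) (h Q : ℝ → ℝ) (he : ∀ u, h (-u) = h u) {N : ℕ} (σ : Equiv.Perm (Fin N)) (x : Fin N → ℝ) :
    PH β Q h N (x ∘ σ) = PH β Q h N x := by
  unfold PH
  congr 1
  by_cases hx : Function.Injective x
  · rw [weightH_inj β h Q x hx, weightH_inj β h Q _ (hx.comp σ.injective)]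
    congr 2
    unfold HH
    rw [pairSum_perm h he, pairSum_perm nl nl_even]
    congr 3
    exact Equiv.sum_comp σ (fun j => Q (x j))
  · rw [weightH_ninj β hβ h Q x hx, weightH_ninj β hβ h Q]
    rwa [Function.Injective.of_comp_iff' _ σ.bijective] 

lemma int_perm {N : ℕ} {E : Type*} [NormedAddCommGroup E] [NormedSpace ℝ E] (σ : Equiv.Perm (Fin N)) (F : (Fin N → ℝ) → E) :
    ∫ x : Fin N → ℝ, F (x ∘ σ) = ∫ x, F x := by
  have h := volume_measurePreserving_piCongrLeft (fun _ : Fin N => ℝ) σ.symm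
  have h2 := h.integral_comp (MeasurableEquiv.measurableEmbedding _) F
  rw [← h2]
  refine integral_congr_ae (Eventually.of_forall fun x => ?_)
  simp only
  congr 1
  ext i
  have := Equiv.piCongrLeft_apply_apply (fun _ : Fin N => ℝ) σ.symm x (σ i)
  simp only [Equiv.symm_apply_apply] at this
  rw [MeasurableEquiv.coe_piCongrLeft, this]; rfl

lemma avg_eq (β : ℝ) (hβ : 0 < β) (h Q : ℝ → ℝ) (he : ∀ u, h (-u) = h u) {n : ℕ}
    (φ : ℝ → ℂ) (hφ : Measurable φ) (C : ℝ) (hC : ∀ t, ‖φ t‖ ≤ C) (hi : Integrable (PH β Q h (n + 1))) :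
    ∫ x : Fin (n + 1) → ℝ, PH β Q h (n + 1) x • φ (x 0) =
      ∫ x : Fin (n + 1) → ℝ, PH β Q h (n + 1) x • ∫ t, φ t ∂(emp x) := by
  have h1 : ∀ i : Fin (n + 1), ∫ x : Fin (n + 1) → ℝ, PH β Q h (n + 1) x • φ (x i) =
      ∫ x : Fin (n + 1) → ℝ, PH β Q h (n + 1) x • φ (x 0) := fun i => by
    rw [← int_perm (Equiv.swap 0 i) (fun x : Fin (n + 1) → ℝ => PH β Q h (n + 1) x • φ (x i))]
    simp [PH_perm β hβ h Q he]
  have ii : ∀ i : Fin (n + 1), Integrable (fun x : Fin (n + 1) → ℝ => PH β Q h (n + 1) x • φ (x i)) := fun i =>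
    (hi.norm.mul_const C).mono' (hi.1.smul (hφ.comp (measurable_pi_apply i)).aestronglyMeasurable)
      (Eventually.of_forall fun x => by
        rw [norm_smul]; exact mul_le_mul_of_nonneg_left (hC _) (norm_nonneg _))
  simp only [emp_integral (Nat.succ_pos n)]
  have e : ∀ x : Fin (n + 1) → ℝ, PH β Q h (n + 1) x • (((n + 1 : ℕ) : ℝ)⁻¹ • ∑ i, φ (x i)) =
      ((n + 1 : ℕ) : ℝ)⁻¹ • ∑ i, PH β Q h (n + 1) x • φ (x i) := fun x => by
    rw [smul_comm, Finset.smul_sum]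
  simp only [e]
  rw [integral_smul, integral_finsetSum _ (fun i _ => ii i)]
  simp only [h1, Finset.sum_const, Finset.card_univ, Fintype.card_fin]
  rw [← Nat.cast_smul_eq_nsmul ℝ, smul_smul, inv_mul_cancel₀ (by positivity), one_smul]

/-- law of the first coordinate -/
def law (β : ℝ) (h Q : ℝ → ℝ) (n : ℕ) : Measure ℝ :=
  Measure.map (fun x : Fin (n + 1) → ℝ => x 0) (volume.withDensity (fun x => ENNReal.ofReal (PH β Q h (n + 1) x)))

lemma law_integral (β : ℝ) (h Q : ℝ → ℝ) (n : ℕ) (hm : Measurable (PH β Q h (n + 1))) (h0 : ∀ x, 0 ≤ PH β Q h (n + 1) x)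
    {E : Type*} [NormedAddCommGroup E] [NormedSpace ℝ E] (φ : ℝ → E) (hφ : StronglyMeasurable φ) :
    ∫ t, φ t ∂(law β h Q n) = ∫ x : Fin (n + 1) → ℝ, PH β Q h (n + 1) x • φ (x 0) := by
  unfold law
  rw [integral_map (measurable_pi_apply 0).aemeasurable hφ.aestronglyMeasurable,
    integral_withDensity_eq_integral_toReal_smul (by fun_prop) (Eventually.of_forall fun x => ENNReal.ofReal_lt_top)]
  simp only [ENNReal.toReal_ofReal (h0 _)]

lemma corr_eq (β : ℝ) (h Q : ℝ → ℝ) (n : ℕ) (hi : Integrable (PH β Q h (n + 1))) (f : ℝ → ℝ) (hf : Measurable f) (C : ℝ)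
    (hC : ∀ t, |f t| ≤ C) :
    ∫ t, f t * correlationFn (n + 1) 1 (PH β Q h (n + 1)) (fun _ => t) =
      ∫ x : Fin (n + 1) → ℝ, PH β Q h (n + 1) x * f (x 0) := by
  set P := PH β Q h (n + 1) with hP
  have mp := (volume_preserving_piFinSuccAbove (fun _ : Fin (n + 1) => ℝ) 0).symm
  have ii : Integrable (fun x : Fin (n + 1) → ℝ => P x * f (x 0)) :=
    hi.mul_bdd (c := C) (hf.comp (measurable_pi_apply 0)).aestronglyMeasurable (Eventually.of_forall fun x => hC _)
  have i2 := mp.integrable_comp_of_integrable ii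
  have e2 := mp.integral_comp (MeasurableEquiv.measurableEmbedding _) (fun x : Fin (n + 1) → ℝ => P x * f (x 0))
  rw [← e2]
  have i3 := i2
  rw [Measure.volume_eq_prod] at i3 ⊢
  have i4 := integral_prod _ i3
  simp only [Function.comp] at i4
  rw [i4]
  refine integral_congr_ae (Eventually.of_forall fun t => ?_)
  simp only
  unfold correlationFn
  rw [← integral_const_mul]
  refine integral_congr_ae (Eventually.of_forall fun y => ?_)
  have e : (MeasurableEquiv.piFinSuccAbove (fun _ : Fin (n + 1) => ℝ) 0).symm (t, y) =
      (fun i : Fin (n + 1) => if hik : (i : ℕ) < 1 then t else y ⟨(i : ℕ) - 1, by have := i.isLt; omega⟩) := by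
    ext i
    refine Fin.cases ?_ (fun j => ?_) i
    · rfl
    · rfl
  simp only
  rw [e, mul_comm]
  simp

lemma St.PH_basic {β h κ Q g a M ℓ C1} (S : St β h κ Q g a M ℓ C1) {N : ℕ} (hN : 0 < N) :
    Integrable (PH β Q h N) ∧ (∀ x, 0 ≤ PH β Q h N x) ∧ ∫ x, PH β Q h N x = 1 ∧ Measurable (PH β Q h N) := by
  have hZ : 0 < ZH β Q h N := by
    have h1 := S.Z_low hN
    have h2 : 0 < M ^ N * ZH β Q h N := (exp_pos _).trans_le h1
    have hM := S.M_pos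
    exact (pos_iff_pos_of_mul_pos h2).1 (by positivity)
  refine ⟨(S.w_int hN).div_const _, fun x => div_nonneg (weightH_nonneg β h Q x) hZ.le, ?_, ?_⟩
  · unfold PH; rw [integral_div]; exact div_self hZ.ne'
  · exact (weightH_meas β h Q S.hc.measurable S.Qc.measurable N).div_const _

lemma St.law_prob {β h κ Q g a M ℓ C1} (S : St β h κ Q g a M ℓ C1) (n : ℕ) : IsProbabilityMeasure (law β h Q n) := by
  obtain ⟨h1, h2, h3, h4⟩ := S.PH_basic (Nat.succ_pos n)
  have : IsProbabilityMeasure ((volume : Measure (Fin (n + 1) → ℝ)).withDensity (fun x => ENNReal.ofReal (PH β Q h (n + 1) x))) := by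
    constructor
    rw [withDensity_apply _ MeasurableSet.univ, Measure.restrict_univ,
      ← ofReal_integral_eq_lintegral_ofReal h1 (Eventually.of_forall h2), h3]
    simp
  exact Measure.isProbabilityMeasure_map (measurable_pi_apply 0).aemeasurable

lemma St.cf_bound {β h κ Q g a M ℓ C1} (S : St β h κ Q g a M ℓ C1) (n : ℕ) (w τ : ℝ) (hτ : 0 < τ) :
    ‖charFun (law β h Q n) w - charFun (dm g) w‖ ≤ τ + τ⁻¹ * ∫ x : Fin (n + 1) → ℝ, Fw g w x * PH β Q h (n + 1) x := by
  obtain ⟨h1, h2, h3, h4⟩ := S.PH_basic (Nat.succ_pos n)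
  have := S.ng.prob
  have he := (h_props h κ S.κc S.κ0 S.κi S.hh).2.1
  have nb : ∀ t : ℝ, ‖Complex.exp (w * t * Complex.I)‖ ≤ 1 := fun t => by
    rw [show (w * t * Complex.I : ℂ) = ((w * t : ℝ) : ℂ) * Complex.I by push_cast; ring, Complex.norm_exp_ofReal_mul_I]
  have mexp : Measurable (fun t : ℝ => Complex.exp (w * t * Complex.I)) := by fun_prop
  have e1 : charFun (law β h Q n) w = ∫ x : Fin (n + 1) → ℝ, PH β Q h (n + 1) x • charFun (emp x) w := by
    rw [charFun_apply_real, law_integral β h Q n h4 h2 _ mexp.stronglyMeasurable,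
      avg_eq β S.hβ h Q he _ mexp 1 nb h1]
    simp only [charFun_apply_real]
  have e2 : charFun (dm g) w = ∫ x : Fin (n + 1) → ℝ, PH β Q h (n + 1) x • charFun (dm g) w := by
    rw [integral_smul_const, h3, one_smul]
  have mE : Measurable (fun x : Fin (n + 1) → ℝ => charFun (emp x) w) := by
    simp only [Fw_eq w (Nat.succ_pos n)]; fun_prop
  have i1 : Integrable (fun x : Fin (n + 1) → ℝ => PH β Q h (n + 1) x • charFun (emp x) w) := by
    refine h1.norm.mono' (h1.1.smul mE.aestronglyMeasurable) (Eventually.of_forall fun x => ?_)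
    have := emp_prob (Nat.succ_pos n) x
    rw [norm_smul]
    exact mul_le_of_le_one_right (norm_nonneg _) (norm_charFun_le_one w)
  have i2 : Integrable (fun x : Fin (n + 1) → ℝ => PH β Q h (n + 1) x • charFun (dm g) w) := h1.smul_const _
  have iF : Integrable (fun x : Fin (n + 1) → ℝ => Fw g w x * PH β Q h (n + 1) x) := by
    refine h1.bdd_mul (c := 4) (Fw_meas w (Nat.succ_pos n)).aestronglyMeasurable (Eventually.of_forall fun x => ?_)
    have := emp_prob (Nat.succ_pos n) x
    have h4 := charFun_sub_le (emp x) (dm g) w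
    unfold Fw
    rw [norm_eq_abs, abs_of_nonneg (by positivity)]; exact h4
  rw [e1]
  nth_rewrite 1 [e2]
  rw [← integral_sub i1 i2]
  have e3 : τ + τ⁻¹ * ∫ x : Fin (n + 1) → ℝ, Fw g w x * PH β Q h (n + 1) x =
      ∫ x : Fin (n + 1) → ℝ, (τ * PH β Q h (n + 1) x + τ⁻¹ * (Fw g w x * PH β Q h (n + 1) x)) := by
    rw [integral_add (h1.const_mul _) (iF.const_mul _), integral_const_mul, integral_const_mul, h3, mul_one]
  rw [e3]
  refine norm_integral_le_of_norm_le ((h1.const_mul _).add (iF.const_mul _)) (Eventually.of_forall fun x => ?_)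
  rw [← smul_sub, norm_smul, norm_eq_abs, abs_of_nonneg (h2 x)]
  unfold Fw
  set z := ‖charFun (emp x) w - charFun (dm g) w‖
  have hz : z ≤ τ + τ⁻¹ * z ^ 2 := by
    have : τ * z ≤ τ * (τ + τ⁻¹ * z ^ 2) := by
      have : τ * (τ + τ⁻¹ * z ^ 2) = τ ^ 2 + z ^ 2 := by field_simp
      nlinarith [sq_nonneg (τ - z), sq_nonneg τ, sq_nonneg z]
    exact le_of_mul_le_mul_left this hτ
  have := mul_le_mul_of_nonneg_left hz (h2 x)
  linarith

lemma St.cf_tendsto {β h κ Q g a M ℓ C1} (S : St β h κ Q g a M ℓ C1) (w : ℝ) :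
    Tendsto (fun n : ℕ => charFun (law β h Q n) w) atTop (𝓝 (charFun (dm g) w)) := by
  have hpos : ∀ w : ℝ, 0 < w → Tendsto (fun n : ℕ => charFun (law β h Q n) w) atTop (𝓝 (charFun (dm g) w)) := by
    intro w hw
    rw [Metric.tendsto_nhds]
    intro τ hτ
    have h1 := (tendsto_add_atTop_nat 1).eventually (S.EF_tendsto w hw (τ / 4 * (τ / 4)) (by positivity))
    filter_upwards [h1] with n hn
    rw [dist_eq_norm]
    refine (S.cf_bound n w (τ / 4) (by positivity)).trans_lt ?_
    have : (τ / 4)⁻¹ * ∫ x : Fin (n + 1) → ℝ, Fw g w x * PH β Q h (n + 1) x ≤ (τ / 4)⁻¹ * (τ / 4 * (τ / 4)) :=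
      mul_le_mul_of_nonneg_left hn.le (by positivity)
    rw [← mul_assoc, inv_mul_cancel₀ (by positivity), one_mul] at this
    linarith
  rcases lt_trichotomy w 0 with hw | hw | hw
  · have := hpos (-w) (by linarith)
    have h2 := (Complex.continuous_conj.tendsto _).comp this
    simp only [Function.comp_def, ← charFun_neg, neg_neg] at h2
    exact h2
  · have := S.ng.prob
    have hl := S.law_prob
    subst hw
    simp [charFun_zero]
  · exact hpos w hw

lemma St.weak {β h κ Q g a M ℓ C1} (S : St β h κ Q g a M ℓ C1) (f : BoundedContinuousFunction ℝ ℝ) :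
    Tendsto (fun N : ℕ => ∫ t : ℝ, f t * correlationFn N 1 (PH β Q h N) (fun _ => t)) atTop (𝓝 (∫ t : ℝ, f t * g t)) := by
  rw [← tendsto_add_atTop_iff_nat 1]
  have hl := S.law_prob
  have hd := S.ng.prob
  let L : ℕ → ProbabilityMeasure ℝ := fun n => ⟨law β h Q n, hl n⟩
  let L0 : ProbabilityMeasure ℝ := ⟨dm g, hd⟩
  have t1 : Tendsto L atTop (𝓝 L0) :=
    ProbabilityMeasure.tendsto_of_tendsto_charFun S.cf_tendsto
  have t2 := ProbabilityMeasure.tendsto_iff_forall_integral_tendsto.1 t1 f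
  change Tendsto (fun n => ∫ t, f t ∂(law β h Q n)) atTop (𝓝 (∫ t, f t ∂(dm g))) at t2
  rw [dm_integral g S.ng.meas S.ng.nonneg] at t2
  refine t2.congr fun n => ?_
  obtain ⟨h1, h2, h3, h4⟩ := S.PH_basic (Nat.succ_pos n)
  rw [law_integral β h Q n h4 h2 _ f.continuous.stronglyMeasurable,
    corr_eq β h Q n h1 f f.continuous.measurable ‖f‖ (fun t => f.norm_coe_le_norm t)]
  rfl

/-- remark after Theorem 1.1: for positive semi-definite `h`
(nonnegative Fourier transform), the threshold may be chosen as
`α^h = sup_t (-h''(t))`. -/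
theorem global_convergence_positive_semidefinite
    (β : ℝ) (hβ : 0 < β) (h : ℝ → ℝ)
    (hAn : ∀ x : ℝ, AnalyticAt ℝ h x) (hEv : IsEvenFun h) (hSch : IsSchwartz h)
    (hpsd : ∀ t : ℝ, (hhatC h t).im = 0 ∧ 0 ≤ (hhatC h t).re) :
    ∀ Q : ℝ → ℝ, (∀ x : ℝ, AnalyticAt ℝ Q x) → (∃ c > 0, ∀ t : ℝ, c ≤ iteratedDeriv 2 Q t) →
      IsEvenFun Q → (⨆ t : ℝ, -(iteratedDeriv 2 h t)) < alphaQ Q →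
      ∃ g : ℝ → ℝ,
        -- `g` is the density of a compactly supported probability measure `μ_{Q,β}^h`
        (∀ t, 0 ≤ g t) ∧ Measurable g ∧ (∫ t : ℝ, g t) = 1 ∧ HasCompactSupport g ∧
        -- non-zero and continuous on the interior of its support
        ContinuousOn g (interior (tsupport g)) ∧
        (∀ t ∈ interior (tsupport g), g t ≠ 0) ∧
        -- weak convergence of the first correlation measure
        (∀ f : BoundedContinuousFunction ℝ ℝ,
          Tendsto
            (fun N : ℕ =>
              ∫ t : ℝ, f t * correlationFn N 1 (PH β Q h N) (fun _ => t))
            atTop (𝓝 (∫ t : ℝ, f t * g t))) := by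
  intro Q hQ hQc hQe hs
  obtain ⟨κ, κc, κ0, κe, κi, ⟨C, hC⟩, hh⟩ := h_repr h hEv hSch hpsd
  obtain ⟨g, gc, ge, a, M, ha, ng, gpos, gzero, ℓ, eq, le⟩ :=
    mf_equil β hβ h κ Q κc κ0 κe κi C hC hh hQ hQe hQc hs
  obtain ⟨hc, -, hb⟩ := h_props h κ κc κ0 κi hh
  obtain ⟨c, hc0, hcQ⟩ := hQc
  obtain ⟨C1, gr⟩ := Uf_growth β hβ h Q g hb hQ c hc0 hcQ ng ℓ
  have Qcont : Continuous Q := continuous_iff_continuousAt.2 fun t => (hQ t).continuousAt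
  have S : St β h κ Q g a M ℓ C1 := ⟨hβ, κc, κ0, κi, hh, hc, Qcont, ng, eq, le, gr⟩
  have hsupp : tsupport g ⊆ Set.Icc (-a) a := by
    refine closure_minimal (fun t ht => ?_) isClosed_Icc
    by_contra hn
    refine ht (gzero t ?_)
    by_contra hlt
    exact hn (abs_le.1 (not_le.1 hlt).le)
  refine ⟨g, ng.nonneg, ng.meas, ng.one, HasCompactSupport.of_support_subset_isCompact isCompact_Icc
    ((subset_tsupport g).trans hsupp), gc.continuousOn, fun t ht => ?_, S.weak⟩
  have h1 : t ∈ Set.Ioo (-a) a := by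
    rw [← interior_Icc]; exact interior_mono hsupp ht
  exact (gpos t (abs_lt.2 h1)).ne'

end
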